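/- arXiv:1606.08036 — 7 statements merged into one kernel-verified Lean document; each statement's English description precedes it below -/
import Mathlib

section
/- There exist a finite alphabet A and a decidable set R of nonempty words over A^{±1} such that: the word problem for the presentation ⟨A ∥ R⟩ is solvable (the set of words W over A^{±1} with W = 1 in the presented group is decidable), while both the bounded word problem (the set of pairs (W, n) such that W is a product of at most n conjugates of words in R^{±1}) and the precise word problem (the set of pairs (W, n) such that W is a product of n conjugates of words in R^{±1} and n is minimal with this property) are unsolvable (undecidable). [Proposition 1.1(a)] -/
namespace Stmt0

/-- Words over the alphabet `A^{±1}` where `A = {a_1, ..., a_m}`: a letter is a pair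
`(i, ε)` with `ε = true` for `a_i` and `ε = false` for `a_i⁻¹`. -/
abbrev Word (m : ℕ) := List (Fin m × Bool)

/-- The image of a word in the free group `F(A)`. -/
def evalW {m : ℕ} (w : Word m) : FreeGroup (Fin m) := FreeGroup.mk w

/-- `g` is a product of exactly `n` conjugates of elements of `R ∪ R⁻¹`. -/
def IsProdConj {G : Type*} [Group G] (R : Set G) (n : ℕ) (g : G) : Prop :=
  ∃ r s : Fin n → G,
    (∀ i, r i ∈ R ∨ (r i)⁻¹ ∈ R) ∧
    g = (List.ofFn fun i => s i * r i * (s i)⁻¹).prod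

/-- The bounded word problem: `W` is a product of at most `n` conjugates of words in
`R^{±1}` in the free group `F(A)`. -/
def BWP {m : ℕ} (R : Set (Word m)) (W : Word m) (n : ℕ) : Prop :=
  ∃ k ≤ n, IsProdConj (evalW '' R) k (evalW W)

/-- The precise word problem: `W` is a product of `n` conjugates of words in `R^{±1}`
in `F(A)` and `n` is minimal with this property. -/
def PWP {m : ℕ} (R : Set (Word m)) (W : Word m) (n : ℕ) : Prop :=
  IsProdConj (evalW '' R) n (evalW W) ∧
    ∀ k, IsProdConj (evalW '' R) k (evalW W) → n ≤ k

/-- The word problem: `W = 1` in the group `⟨A ∥ R⟩`, i.e. `W` lies in the normal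
closure of `R` in `F(A)`. -/
def WP {m : ℕ} (R : Set (Word m)) (W : Word m) : Prop :=
  evalW W ∈ Subgroup.normalClosure (evalW '' R)

/-- Number of letters with sign `b` in a word. -/
def cnt (b : Bool) (w : Word 1) : ℕ := (w.filter (fun x => decide (x.2 = b))).length

open Nat.Partrec (Code) in
/-- The relators: the letter `a`, and all words with `k + 2 + t` letters `a` and `t` letters
`a⁻¹` such that the `k`-th program halts on input `0` within `t` steps. -/
def RR : Set (Word 1) :=
  {w | w = [(0, true)] ∨ (cnt false w + 2 ≤ cnt true w ∧
    (Code.evaln (cnt false w) (Denumerable.ofNat Code (cnt true w - cnt false w - 2)) 0).isSome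
      = true)}

/-- The word `a ^ (k + 2)`, where `k` is the number of the program `c`. -/
def WW (c : Nat.Partrec.Code) : Word 1 :=
  (List.range (Encodable.encode c + 2)).map (fun _ => (0, true))

/-- Exponent sum. -/
def expo : FreeGroup (Fin 1) →* Multiplicative ℤ :=
  FreeGroup.lift (fun _ => Multiplicative.ofAdd 1)

lemma expo_evalW (w : Word 1) :
    Multiplicative.toAdd (expo (evalW w)) = (cnt true w : ℤ) - cnt false w := by
  unfold evalW expo
  rw [FreeGroup.lift_mk]
  induction w with
  | nil => simp [cnt]
  | cons x w ih =>
    obtain ⟨i, b⟩ := x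
    rw [List.map_cons, List.prod_cons, toAdd_mul, ih]
    cases b <;> simp [cnt] <;> ring

lemma WW_eq (c : Nat.Partrec.Code) :
    WW c = List.replicate (Encodable.encode c + 2) (0, true) := by
  simp [WW, List.map_const']

lemma expo_WW (c : Nat.Partrec.Code) :
    Multiplicative.toAdd (expo (evalW (WW c))) = (Encodable.encode c : ℤ) + 2 := by
  rw [expo_evalW, WW_eq]; simp [cnt]

lemma primrec_cnt (b : Bool) : Primrec (cnt b) :=
  Primrec.list_length.comp
    (Primrec.listFilter (p := fun x : Fin 1 × Bool => x.2 = b)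
      (Primrec.eq.comp Primrec.snd (Primrec.const b)))

lemma computable_RR : ComputablePred (fun w : Word 1 => w ∈ RR) := by
  have h : PrimrecPred (fun w : Word 1 => w ∈ RR) := by
    refine PrimrecPred.or (Primrec.eq.comp Primrec.id (Primrec.const _)) (PrimrecPred.and ?_ ?_)
    · exact Primrec.nat_le.comp
        (Primrec.nat_add.comp (primrec_cnt false) (Primrec.const 2)) (primrec_cnt true)
    · refine Primrec.eq.comp (Primrec.option_isSome.comp
        (Nat.Partrec.Code.primrec_evaln.comp (Primrec.pair (Primrec.pair (primrec_cnt false) ?_)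
          (Primrec.const 0)))) (Primrec.const true)
      exact (Primrec.ofNat Nat.Partrec.Code).comp (Primrec.nat_sub.comp
        (Primrec.nat_sub.comp (primrec_cnt true) (primrec_cnt false)) (Primrec.const 2))
  obtain ⟨d, h⟩ := h
  exact ⟨d, h.to_comp⟩

lemma normalClosure_RR : Subgroup.normalClosure (evalW '' RR) = ⊤ := by
  rw [eq_top_iff]
  intro g _
  have hg : g ∈ Subgroup.closure (Set.range (FreeGroup.of : Fin 1 → FreeGroup (Fin 1))) := by
    rw [FreeGroup.closure_range_of]; trivial
  refine (Subgroup.closure_le _).2 ?_ hg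
  rintro _ ⟨i, rfl⟩
  refine Subgroup.subset_normalClosure ⟨[(0, true)], Or.inl rfl, ?_⟩
  rw [Subsingleton.elim i 0]; rfl

lemma not_zero (c : Nat.Partrec.Code) : ¬ IsProdConj (evalW '' RR) 0 (evalW (WW c)) := by
  rintro ⟨r, s, -, h⟩
  have h2 := expo_WW c
  rw [h] at h2
  simp at h2
  omega

lemma one_iff (c : Nat.Partrec.Code) :
    IsProdConj (evalW '' RR) 1 (evalW (WW c)) ↔ (Nat.Partrec.Code.eval c 0).Dom := by
  constructor
  · rintro ⟨r, s, hr, h⟩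
    have h2 := expo_WW c
    rw [h] at h2
    simp at h2
    rcases hr 0 with ⟨w, hw, e⟩ | ⟨w, hw, e⟩
    · have h3 := expo_evalW w
      rw [e, h2] at h3
      rcases hw with rfl | ⟨h4, h5⟩
      · simp [cnt] at h3; omega
      · have h6 : cnt true w - cnt false w - 2 = Encodable.encode c := by omega
        rw [h6, Denumerable.ofNat_encode] at h5
        obtain ⟨x, hx⟩ := Option.isSome_iff_exists.1 h5
        exact Part.dom_iff_mem.2 ⟨x, Nat.Partrec.Code.evaln_sound hx⟩
    · have h3 := expo_evalW w
      rw [e, map_inv, toAdd_inv, h2] at h3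
      rcases hw with rfl | ⟨h4, h5⟩
      · simp [cnt] at h3; omega
      · omega
  · intro h
    obtain ⟨x, hx⟩ := Part.dom_iff_mem.1 h
    obtain ⟨t, ht⟩ := Nat.Partrec.Code.evaln_complete.1 hx
    refine ⟨fun _ => evalW (WW c), fun _ => 1, fun _ => Or.inl ?_, by simp⟩
    refine ⟨List.replicate (Encodable.encode c + 2) (0, true) ++
      (List.replicate t (0, true) ++ List.replicate t (0, false)), Or.inr ?_, ?_⟩
    · have h1 : cnt true (List.replicate (Encodable.encode c + 2) (0, true) ++
          (List.replicate t (0, true) ++ List.replicate t (0, false))) =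
          Encodable.encode c + 2 + t := by simp [cnt]
      have h0 : cnt false (List.replicate (Encodable.encode c + 2) (0, true) ++
          (List.replicate t (0, true) ++ List.replicate t (0, false))) = t := by simp [cnt]
      rw [h0, h1]
      refine ⟨by omega, ?_⟩
      rw [show Encodable.encode c + 2 + t - t - 2 = Encodable.encode c by omega,
        Denumerable.ofNat_encode]
      exact Option.isSome_iff_exists.2 ⟨x, ht⟩
    · rw [WW_eq]
      unfold evalW
      rw [← FreeGroup.mul_mk]
      have : FreeGroup.mk (List.replicate t ((0 : Fin 1), true) ++ List.replicate t (0, false))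
          = 1 := by
        have e : List.replicate t ((0 : Fin 1), false)
            = FreeGroup.invRev (List.replicate t (0, true)) := by
          simp [FreeGroup.invRev]
        rw [e, ← FreeGroup.mul_mk, ← FreeGroup.inv_mk, mul_inv_cancel]
      rw [this, mul_one]

lemma computable_WW : Computable (fun c => (WW c, 1)) := by
  refine (Primrec.pair ?_ (Primrec.const 1)).to_comp
  exact Primrec.list_map (Primrec.list_range.comp
    (Primrec.nat_add.comp Primrec.encode (Primrec.const 2))) (Primrec.const _).to₂

/-- Proposition 1.1(a): there is a decidable group presentation with solvable word
problem for which both the bounded and the precise word problems are unsolvable. -/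
theorem statement0 :
    ∃ (m : ℕ) (R : Set (Word m)),
      (∀ w ∈ R, w ≠ []) ∧
      ComputablePred (fun w : Word m => w ∈ R) ∧
      ComputablePred (fun w : Word m => WP R w) ∧
      ¬ ComputablePred (fun p : Word m × ℕ => BWP R p.1 p.2) ∧
      ¬ ComputablePred (fun p : Word m × ℕ => PWP R p.1 p.2) := by
  refine ⟨1, RR, ?_, computable_RR, ?_, ?_, ?_⟩
  · rintro w hw rfl
    rcases hw with h | ⟨h, -⟩
    · simp at h
    · simp [cnt] at h
  · refine ⟨fun _ => isTrue (by unfold WP; rw [normalClosure_RR]; trivial), ?_⟩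
    exact (Computable.const true)
  · intro h
    refine ComputablePred.halting_problem 0
      (ComputablePred.computable_of_manyOneReducible ⟨_, computable_WW, fun c => ?_⟩ h)
    refine (one_iff c).symm.trans ?_
    constructor
    · exact fun h => ⟨1, le_rfl, h⟩
    · rintro ⟨k, hk, h⟩
      rcases Nat.le_one_iff_eq_zero_or_eq_one.1 hk with rfl | rfl
      · exact absurd h (not_zero c)
      · exact h
  · intro h
    refine ComputablePred.halting_problem 0
      (ComputablePred.computable_of_manyOneReducible ⟨_, computable_WW, fun c => ?_⟩ h)
    refine (one_iff c).symm.trans ?_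
    constructor
    · refine fun h => ⟨h, fun k hk => ?_⟩
      rcases Nat.eq_zero_or_pos k with rfl | h0
      · exact absurd hk (not_zero c)
      · exact h0
    · exact fun h => h.1

end Stmt0
end

section
/- For every finite group presentation ⟨A ∥ R⟩ (both A and R finite), the bounded word problem and the precise word problem are solvable: the set of pairs (W, n) such that W is a product of at most n conjugates of words in R^{±1} is decidable, and the set of pairs (W, n) such that W is a product of n conjugates of words in R^{±1} while not being a product of fewer conjugates is decidable. [decidability content of Proposition 1.1(c)] -/
namespace Stmt2

/-- Words over the alphabet `A^{±1}` where `A = {a_1, ..., a_m}`: a letter is a pair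
`(i, ε)` with `ε = true` for `a_i` and `ε = false` for `a_i⁻¹`. -/
abbrev Word (m : ℕ) := List (Fin m × Bool)

/-- The image of a word in the free group `F(A)`. -/
def evalW {m : ℕ} (w : Word m) : FreeGroup (Fin m) := FreeGroup.mk w

/-- `g` is a product of exactly `n` conjugates of elements of `R ∪ R⁻¹`. -/
def IsProdConj {G : Type*} [Group G] (R : Set G) (n : ℕ) (g : G) : Prop :=
  ∃ r s : Fin n → G,
    (∀ i, r i ∈ R ∨ (r i)⁻¹ ∈ R) ∧
    g = (List.ofFn fun i => s i * r i * (s i)⁻¹).prod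

/-- The bounded word problem: `W` is a product of at most `n` conjugates of words in
`R^{±1}` in the free group `F(A)`. -/
def BWP {m : ℕ} (R : Set (Word m)) (W : Word m) (n : ℕ) : Prop :=
  ∃ k ≤ n, IsProdConj (evalW '' R) k (evalW W)

/-- The precise word problem: `W` is a product of `n` conjugates of words in `R^{±1}`
in `F(A)` and `n` is minimal with this property. -/
def PWP {m : ℕ} (R : Set (Word m)) (W : Word m) (n : ℕ) : Prop :=
  IsProdConj (evalW '' R) n (evalW W) ∧
    ∀ k, IsProdConj (evalW '' R) k (evalW W) → n ≤ k

/-- The word problem: `W = 1` in the group `⟨A ∥ R⟩`, i.e. `W` lies in the normal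
closure of `R` in `F(A)`. -/
def WP {m : ℕ} (R : Set (Word m)) (W : Word m) : Prop :=
  evalW W ∈ Subgroup.normalClosure (evalW '' R)


open FreeGroup (invRev)

section Comb

variable {α : Type*}

/-- The inverse letter. -/
def invL (a : α × Bool) : α × Bool := (a.1, !a.2)

@[simp] lemma invL_invL (a : α × Bool) : invL (invL a) = a := by
  simp [invL]

lemma invRev_cons' (a : α × Bool) (w : List (α × Bool)) :
    invRev (a :: w) = invRev w ++ [invL a] := by
  simp [invRev, invL]

lemma split_mid {β : Type*} {e : β} {X B : List β} : ∀ {V A : List β}, V ++ e :: X = A ++ B →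
    (∃ A2, A = V ++ e :: A2 ∧ X = A2 ++ B) ∨ (∃ B1, V = A ++ B1 ∧ B = B1 ++ e :: X)
  | V, [], h => Or.inr ⟨V, by simp, by simpa using h.symm⟩
  | [], a :: A, h => by
      simp only [List.nil_append, List.cons_append, List.cons.injEq] at h
      exact Or.inl ⟨A, by simp [h.1], h.2⟩
  | v :: V, a :: A, h => by
      simp only [List.cons_append, List.cons.injEq] at h
      rcases split_mid h.2 with ⟨A2, h1, h2⟩ | ⟨B1, h1, h2⟩
      · exact Or.inl ⟨A2, by simp [h.1, h1], h2⟩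
      · exact Or.inr ⟨B1, by simp [h.1, h1], h2⟩

/-- Combinatorial disk diagrams with at most `n` faces and boundary label the given word;
`C` is the set of relators, closed under inverses and cyclic shifts. -/
inductive D (C : Set (List (α × Bool))) : ℕ → List (α × Bool) → Prop
  | nil (n : ℕ) : D C n []
  | bridge {k l : ℕ} {V X : List (α × Bool)} (a : α × Bool) :
      D C k V → D C l X → D C (k + l) (a :: (V ++ invL a :: X))
  | face {n : ℕ} {y W : List (α × Bool)} (a : α × Bool) :
      (a :: y) ∈ C → D C n (invRev y ++ W) → D C (n + 1) (a :: W)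

variable {C : Set (List (α × Bool))}

lemma D.cast {n m : ℕ} {W W' : List (α × Bool)} (h : D C n W) (hn : n = m) (hW : W = W') :
    D C m W' := by
  subst hn hW; exact h

lemma D.append {k l : ℕ} {U Q : List (α × Bool)} (hU : D C k U) (hQ : D C l Q) :
    D C (k + l) (U ++ Q) := by
  induction hU with
  | nil n =>
    -- monotonicity
    have mono : ∀ {l Q}, D C l Q → ∀ n, D C (n + l) Q := by
      intro l Q h
      induction h with
      | nil m => intro n; exact D.nil _
      | bridge a h1 h2 ih1 ih2 =>
        intro n
        exact (D.bridge a (ih1 n) h2).cast (by omega) rfl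
      | face a hc h ih =>
        intro n
        exact (D.face a hc (ih n)).cast (by omega) rfl
    exact mono hQ n
  | bridge a h1 h2 ih1 ih2 =>
    exact (D.bridge a h1 ih2).cast (by omega) (by simp)
  | face a hc h ih =>
    refine (D.face a hc (ih.cast rfl (List.append_assoc _ _ _))).cast (by omega) (by simp)

lemma D.mono {n m : ℕ} {W : List (α × Bool)} (h : D C n W) (hnm : n ≤ m) : D C m W :=
  ((D.nil (m - n)).append h).cast (by omega) (by simp)

lemma D.insert {k l : ℕ} {U W : List (α × Bool)} (hU : D C k U) (h : D C l W) :
    ∀ P Q, W = P ++ Q → D C (k + l) (P ++ U ++ Q) := by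
  induction h with
  | nil n =>
    intro P Q hPQ
    have h1 : P = [] ∧ Q = [] := by simpa using hPQ
    rw [h1.1, h1.2]
    exact hU.mono (by omega) |>.cast rfl (by simp)
  | @bridge k' l' V X a h1 h2 ih1 ih2 =>
    rintro (_ | ⟨c, P⟩) Q hPQ
    · exact (hU.append (D.bridge a h1 h2)).cast rfl (by simpa using hPQ)
    · simp only [List.cons_append, List.cons.injEq] at hPQ
      obtain ⟨rfl, hPQ⟩ := hPQ
      rcases split_mid hPQ with ⟨A, rfl, h4⟩ | ⟨B, h3, rfl⟩
      · exact (D.bridge a h1 (ih2 _ _ h4)).cast (by omega) (by simp)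
      · exact (D.bridge a (ih1 _ _ h3) h2).cast (by omega) (by simp)
  | @face n y W a hc h ih =>
    rintro (_ | ⟨c, P⟩) Q hPQ
    · exact (hU.append (D.face a hc h)).cast rfl (by simpa using hPQ)
    · simp only [List.cons_append, List.cons.injEq] at hPQ
      obtain ⟨rfl, rfl⟩ := hPQ
      have := ih (invRev y ++ P) Q (by simp)
      exact (D.face a hc (W := P ++ U ++ Q) (this.cast rfl (by simp))).cast (by omega) (by simp)

/-- Invariance under cyclic shifts at level `k`. -/
def Cyc (C : Set (List (α × Bool))) (k : ℕ) : Prop :=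
  ∀ U V, D C k (U ++ V) → D C k (V ++ U)

lemma D.faceAny (hrot : ∀ u v, u ++ v ∈ C → v ++ u ∈ C) {N : ℕ} (hcyc : ∀ k ≤ N, Cyc C k)
    {a : α × Bool} {y : List (α × Bool)} (hy : a :: y ∈ C)
    {n : ℕ} {W : List (α × Bool)} (h : D C n W) :
    n ≤ N → ∀ P Q, W = P ++ (invRev y ++ Q) → D C (n + 1) (P ++ a :: Q) := by
  induction h with
  | nil n =>
    intro hn P Q hW
    have h1 : P = [] := by
      have := congrArg List.length hW
      simp at this
      exact List.length_eq_zero_iff.1 (by omega)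
    subst h1
    exact D.face a hy ((D.nil n).cast rfl (by simpa using hW))
  | @bridge k l V X c h1 h2 ih1 ih2 =>
    rintro hn (_ | ⟨c', P⟩) Q hW
    · exact D.face a hy ((D.bridge c h1 h2).cast rfl (by simpa using hW))
    · simp only [List.cons_append, List.cons.injEq] at hW
      obtain ⟨rfl, hW⟩ := hW
      rcases split_mid hW with ⟨A, rfl, h4⟩ | ⟨B, rfl, h4⟩
      · exact (D.bridge c h1 (ih2 (by omega) _ _ h4)).cast (by omega) (by simp)
      · rcases split_mid h4.symm with ⟨A, h5, rfl⟩ | ⟨B', rfl, rfl⟩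
        · -- the hard case
          have hyy : y = invRev A ++ c :: invRev B := by
            have := congrArg invRev h5
            simpa [FreeGroup.invRev_append, invRev_cons'] using this
          have hc : c :: (invRev B ++ a :: invRev A) ∈ C := by
            have := hrot (a :: invRev A) (c :: invRev B) (by simpa [hyy] using hy)
            simpa using this
          have e1 : D C k (B ++ P) := hcyc k (by omega) _ _ h1
          have e2 := D.bridge (invL a) e1 (D.nil 0)
          have e3 := D.insert e2 h2 A Q rfl
          refine (D.face c hc (W := P ++ a :: Q) (e3.cast rfl ?_)).cast (by omega) (by simp)
          simp [FreeGroup.invRev_append, invRev_cons']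
        · exact (D.bridge c (ih1 (by omega) P B' rfl) h2).cast (by omega) (by simp)
  | @face n y' W c hc h ih =>
    rintro hn (_ | ⟨c', P⟩) Q hW
    · exact D.face a hy ((D.face c hc h).cast rfl (by simpa using hW))
    · simp only [List.cons_append, List.cons.injEq] at hW
      obtain ⟨rfl, rfl⟩ := hW
      have := ih (by omega) (invRev y' ++ P) Q (by simp)
      exact (D.face c hc (W := P ++ a :: Q) (this.cast rfl (by simp))).cast (by omega) (by simp)

lemma D.cyc (hrot : ∀ u v, u ++ v ∈ C → v ++ u ∈ C) : ∀ k, Cyc C k := by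
  intro k
  induction k using Nat.strong_induction_on with
  | _ k IH =>
  have key : ∀ {n W}, D C n W → n ≤ k → ∀ U a, W = U ++ [a] → D C n (a :: U) := by
    intro n W h
    induction h with
    | nil n => intro _ U a h; simp at h
    | @bridge i j V X b h1 h2 ih1 ih2 =>
      rintro hn (_ | ⟨c, U⟩) a hW
      · simp at hW
      · simp only [List.cons_append, List.cons.injEq] at hW
        obtain ⟨rfl, hW⟩ := hW
        rcases split_mid hW with ⟨A, rfl, h4⟩ | ⟨B, rfl, h4⟩
        · have e1 := ih2 (by omega) A a h4
          have e2 := D.bridge b h1 (D.nil 0)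
          exact (D.insert e2 e1 [a] A rfl).cast (by omega) (by simp)
        · rcases B with _ | ⟨_, B⟩
          · simp only [List.nil_append, List.cons.injEq] at h4
            obtain ⟨rfl, rfl⟩ := h4
            have e := D.bridge (invL b) (D.nil (C := C) 0) h1
            exact (e.mono (m := i + j) (by omega)).cast rfl (by simp)
          · simp at h4
    | @face n y W b hc h ih =>
      rintro hn (_ | ⟨c, U⟩) a hW
      · simp only [List.nil_append, List.cons.injEq] at hW
        obtain ⟨rfl, rfl⟩ := hW
        exact D.face b hc h
      · simp only [List.cons_append, List.cons.injEq] at hW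
        obtain ⟨rfl, rfl⟩ := hW
        have e1 := ih (by omega) (invRev y ++ U) a (by simp)
        exact D.faceAny hrot (N := n) (fun i hi => IH i (by omega)) hc e1 le_rfl [a] U (by simp)
  intro U V h
  induction V using List.reverseRecOn generalizing U with
  | nil => simpa using h
  | append_singleton V a ih =>
    have := key h le_rfl (U ++ V) a (by simp)
    have := ih (a :: U) (this.cast rfl (by simp))
    exact this.cast rfl (by simp)

lemma D.cut (hrot : ∀ u v, u ++ v ∈ C → v ++ u ∈ C) (hinv : ∀ u ∈ C, invRev u ∈ C)
    {r : List (α × Bool)} (hr : r ∈ C) {n : ℕ} {W : List (α × Bool)} (h : D C n W) :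
    ∀ V, W = V ++ r → D C (n + 1) V := by
  induction h with
  | nil n =>
    intro V hV
    have : V = [] := by
      have := congrArg List.length hV
      simp at this
      exact List.length_eq_zero_iff.1 (by omega)
    subst this; exact D.nil _
  | @bridge k l Y X b h1 h2 ih1 ih2 =>
    rintro (_ | ⟨c, V⟩) hW
    · exact D.nil _
    · simp only [List.cons_append, List.cons.injEq] at hW
      obtain ⟨rfl, hW⟩ := hW
      rcases split_mid hW with ⟨A, rfl, h4⟩ | ⟨B, rfl, rfl⟩
      · exact (D.bridge b h1 (ih2 _ h4)).cast (by omega) (by simp)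
      · have e := D.cyc hrot _ _ _ ((D.insert h2 h1 V B rfl).cast rfl (List.append_assoc _ _ _))
        have hc : b :: (invRev B ++ invRev X) ∈ C := by
          have := hinv _ hr
          simp only [FreeGroup.invRev_append, invRev_cons', invL_invL, List.append_assoc] at this
          simpa using hrot _ _ this
        exact (D.face b hc (e.cast rfl (by simp [FreeGroup.invRev_append]))).cast (by omega) rfl
  | @face n y W b hc h ih =>
    rintro (_ | ⟨c, V⟩) hW
    · exact D.nil _
    · simp only [List.cons_append, List.cons.injEq] at hW
      obtain ⟨rfl, rfl⟩ := hW
      exact D.face b hc (ih (invRev y ++ V) (by simp))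

lemma D.del (hrot : ∀ u v, u ++ v ∈ C → v ++ u ∈ C) (hinv : ∀ u ∈ C, invRev u ∈ C)
    {n : ℕ} {W : List (α × Bool)} (h : D C n W) :
    ∀ U a V, W = U ++ a :: invL a :: V → D C n (U ++ V) := by
  induction h with
  | nil n => intro U a V h; simp at h
  | @bridge k l Y X b h1 h2 ih1 ih2 =>
    rintro (_ | ⟨c, U⟩) a V hW
    · simp only [List.nil_append, List.cons.injEq] at hW
      obtain ⟨rfl, hW⟩ := hW
      rcases Y with _ | ⟨y, Y⟩
      · simp only [List.nil_append, List.cons.injEq, true_and] at hW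
        subst hW
        exact h2.mono (by omega)
      · simp only [List.cons_append, List.cons.injEq] at hW
        obtain ⟨rfl, rfl⟩ := hW
        have e := D.cyc hrot _ [invL b] Y h1
        exact (e.append h2).cast rfl (by simp)
    · simp only [List.cons_append, List.cons.injEq] at hW
      obtain ⟨rfl, hW⟩ := hW
      rcases split_mid hW with ⟨A, rfl, h4⟩ | ⟨B, rfl, h4⟩
      · exact (D.bridge b h1 (ih2 _ _ _ h4)).cast rfl (by simp)
      · rcases B with _ | ⟨x, _ | ⟨x', B⟩⟩
        · simp only [List.nil_append, List.cons.injEq] at h4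
          obtain ⟨rfl, rfl⟩ := h4
          have h2' : D C l (b :: V) := by simpa using h2
          exact (D.insert h1 h2' [b] V rfl).cast (by omega) (by simp)
        · simp only [List.cons_append, List.nil_append, List.cons.injEq] at h4
          obtain ⟨rfl, h5, rfl⟩ := h4
          have hab : a = b := by simpa using congrArg invL h5
          subst hab
          have e := D.cyc hrot _ U [a] h1
          exact (e.append h2).cast rfl (by simp)
        · simp only [List.cons_append, List.cons.injEq] at h4
          obtain ⟨rfl, rfl, rfl⟩ := h4
          exact (D.bridge b (ih1 U a B rfl) h2).cast rfl (by simp)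
  | @face n y W b hc h ih =>
    rintro (_ | ⟨c, U⟩) a V hW
    · simp only [List.nil_append, List.cons.injEq] at hW
      obtain ⟨rfl, rfl⟩ := hW
      have hr := hinv _ hc
      rw [invRev_cons'] at hr
      have e := D.cyc hrot _ (invRev y ++ [invL b]) V (h.cast rfl (by simp))
      exact D.cut hrot hinv hr e V rfl
    · simp only [List.cons_append, List.cons.injEq] at hW
      obtain ⟨rfl, rfl⟩ := hW
      have := ih (invRev y ++ U) a V (by simp)
      exact D.face b hc (this.cast rfl (by simp))

lemma D.of_mk_eq (hrot : ∀ u v, u ++ v ∈ C → v ++ u ∈ C) (hinv : ∀ u ∈ C, invRev u ∈ C)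
    {n : ℕ} {W W' : List (α × Bool)} (h : D C n W)
    (hW : FreeGroup.mk W = FreeGroup.mk W') : D C n W' := by
  obtain ⟨Z, h1, h2⟩ := FreeGroup.Red.exact.1 hW
  have hZ : D C n Z := by
    clear h2
    induction h1 with
    | refl => exact h
    | tail _ hs ih =>
      cases hs with
      | @not L1 L2 x b => exact D.del hrot hinv ih L1 (x, b) L2 rfl
  clear h1 h hW
  induction h2 using Relation.ReflTransGen.head_induction_on with
  | refl => exact hZ
  | head hs _ ih =>
    cases hs with
    | @not L1 L2 x b =>
      have e := D.bridge (C := C) (x, b) (D.nil 0) (D.nil 0)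
      exact (D.insert e ih L1 L2 rfl).cast (by omega) (by simp [invL])

lemma D.inv_self (w : List (α × Bool)) : D C 0 (invRev w ++ w) := by
  induction w with
  | nil => exact D.nil 0
  | cons a w ih =>
    have e := D.bridge (C := C) (invL a) (D.nil 0) (D.nil 0)
    exact (D.insert e ih (invRev w) w rfl).cast rfl (by simp [invRev_cons'])

lemma D.rel {r : List (α × Bool)} (hr : r ∈ C) : D C 1 r := by
  rcases r with _ | ⟨a, y⟩
  · exact D.nil 1
  · exact D.face a hr (D.inv_self y)

lemma D.conj {r : List (α × Bool)} (hr : r ∈ C) (s : List (α × Bool)) :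
    D C 1 (s ++ r ++ invRev s) := by
  have e := D.inv_self (C := C) (invRev s)
  rw [FreeGroup.invRev_invRev] at e
  exact D.insert (D.rel hr) e s (invRev s) rfl

/-- The stack machine version. -/
inductive M (C : Set (List (α × Bool))) : ℕ → List (α × Bool) → List (α × Bool) → Prop
  | nil (n : ℕ) : M C n [] []
  | push {n : ℕ} {S W : List (α × Bool)} (a : α × Bool) : M C n (a :: S) W → M C n S (a :: W)
  | pop {n : ℕ} {S W : List (α × Bool)} (a : α × Bool) :
      M C n S W → M C n (a :: S) (invL a :: W)
  | face {n : ℕ} {S W y : List (α × Bool)} (a : α × Bool) :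
      (a :: y) ∈ C → M C n S (invRev y ++ W) → M C (n + 1) S (a :: W)

lemma M.mono {n m : ℕ} {S W : List (α × Bool)} (h : M C n S W) : n ≤ m → M C m S W := by
  induction h generalizing m with
  | nil n => intro _; exact M.nil m
  | push a _ ih => intro h; exact M.push a (ih h)
  | pop a _ ih => intro h; exact M.pop a (ih h)
  | face a hc _ ih =>
    intro h
    obtain ⟨m, rfl⟩ : ∃ m', m = m' + 1 := ⟨m - 1, by omega⟩
    exact M.face a hc (ih (by omega))

lemma D.toM {k : ℕ} {V : List (α × Bool)} (h : D C k V) :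
    ∀ {l S X}, M C l S X → M C (k + l) S (V ++ X) := by
  induction h with
  | nil n => intro l S X h; exact h.mono (by omega)
  | bridge a _ _ ih1 ih2 =>
    intro l S X h
    have := M.push a (ih1 (M.pop a (ih2 h)))
    simpa [Nat.add_assoc] using this
  | @face n y W a hc _ ih =>
    intro l S X h
    have := M.face a hc (S := S) (W := W ++ X) (by simpa using ih h)
    exact this.mono (by omega)

end Comb

section Group

lemma IsProdConj.zero {G : Type*} [Group G] (R : Set G) : IsProdConj R 0 1 :=
  ⟨fun _ => 1, fun _ => 1, fun i => i.elim0, by simp⟩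

lemma IsProdConj.cons {G : Type*} [Group G] {R : Set G} {n : ℕ} {g r : G} (s : G)
    (hr : r ∈ R ∨ r⁻¹ ∈ R) (h : IsProdConj R n g) :
    IsProdConj R (n + 1) (s * r * s⁻¹ * g) := by
  obtain ⟨rs, ss, h1, h2⟩ := h
  refine ⟨Fin.cons r rs, Fin.cons s ss, ?_, ?_⟩
  · intro i
    refine Fin.cases ?_ ?_ i
    · simpa using hr
    · intro j; simpa using h1 j
  · rw [List.ofFn_succ]
    simp [h2]

lemma IsProdConj.uncons {G : Type*} [Group G] {R : Set G} {n : ℕ} {g : G}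
    (h : IsProdConj R (n + 1) g) :
    ∃ s r g', (r ∈ R ∨ r⁻¹ ∈ R) ∧ IsProdConj R n g' ∧ g = s * r * s⁻¹ * g' := by
  obtain ⟨rs, ss, h1, h2⟩ := h
  refine ⟨ss 0, rs 0, _, h1 0, ⟨fun i => rs i.succ, fun i => ss i.succ, fun i => h1 _, rfl⟩, ?_⟩
  rw [h2, List.ofFn_succ]
  simp

/-- Cyclic shifts of relators and their inverses. -/
def CR {α : Type*} (R : Set (List (α × Bool))) : Set (List (α × Bool)) :=
  {w | ∃ r ∈ R, w ~r r ∨ invRev w ~r r}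

variable {α : Type*} {R : Set (List (α × Bool))}

lemma invRev_rot {u v : List (α × Bool)} (h : u ~r v) : invRev u ~r invRev v :=
  (h.map _).reverse

lemma CR_rot : ∀ u v, u ++ v ∈ CR R → v ++ u ∈ CR R := by
  rintro u v ⟨r, hr, h⟩
  refine ⟨r, hr, ?_⟩
  have e : (v ++ u) ~r (u ++ v) := List.isRotated_append
  rcases h with h | h
  · exact Or.inl (e.trans h)
  · exact Or.inr ((invRev_rot e).trans h)

lemma CR_inv : ∀ u ∈ CR R, invRev u ∈ CR R := by
  rintro u ⟨r, hr, h⟩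
  refine ⟨r, hr, ?_⟩
  rw [FreeGroup.invRev_invRev]
  exact h.symm

lemma rot_conj {u v : List (α × Bool)} (h : u ~r v) :
    ∃ s : FreeGroup α, FreeGroup.mk u = s * FreeGroup.mk v * s⁻¹ := by
  obtain ⟨n, rfl⟩ := h.symm
  rw [List.rotate_eq_drop_append_take_mod]
  refine ⟨FreeGroup.mk (v.drop (n % v.length)), ?_⟩
  conv_rhs => rw [← List.take_append_drop (n % v.length) v]
  rw [← FreeGroup.mul_mk, ← FreeGroup.mul_mk]
  simp only [List.take_append_drop]
  group

lemma CR_conj {w : List (α × Bool)} (hw : w ∈ CR R) :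
    ∃ s r : FreeGroup α, (r ∈ FreeGroup.mk '' R ∨ r⁻¹ ∈ FreeGroup.mk '' R) ∧
      FreeGroup.mk w = s * r * s⁻¹ := by
  obtain ⟨r, hr, h | h⟩ := hw
  · obtain ⟨s, hs⟩ := rot_conj h
    exact ⟨s, FreeGroup.mk r, Or.inl ⟨r, hr, rfl⟩, hs⟩
  · obtain ⟨s, hs⟩ := rot_conj h
    refine ⟨s, (FreeGroup.mk r)⁻¹, Or.inr ⟨r, hr, by simp⟩, ?_⟩
    rw [← FreeGroup.inv_mk, inv_eq_iff_eq_inv] at hs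
    rw [hs]
    group

lemma mk_mem_CR {g : FreeGroup α} (h : g ∈ FreeGroup.mk '' R ∨ g⁻¹ ∈ FreeGroup.mk '' R) :
    ∃ w ∈ CR R, FreeGroup.mk w = g := by
  rcases h with ⟨r, hr, h⟩ | ⟨r, hr, h⟩
  · exact ⟨r, ⟨r, hr, Or.inl (List.IsRotated.refl _)⟩, h⟩
  · refine ⟨invRev r, ⟨r, hr, Or.inr ?_⟩, ?_⟩
    · rw [FreeGroup.invRev_invRev]
    · rw [← FreeGroup.inv_mk, h, inv_inv]

lemma CR_finite (hfin : R.Finite) : (CR R).Finite := by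
  have h1 : ∀ r : List (α × Bool), {w | w ~r r}.Finite := by
    intro r
    refine (List.finite_toSet ((List.range (r.length + 1)).map r.rotate)).subset ?_
    intro w hw
    exact List.isRotated_iff_mem_map_range.1 (List.IsRotated.symm hw)
  have h2 : CR R ⊆ ⋃ r ∈ R, ({w | w ~r r} ∪ invRev '' {w | w ~r r}) := by
    rintro w ⟨r, hr, h⟩
    simp only [Set.mem_iUnion]
    refine ⟨r, hr, ?_⟩
    rcases h with h | h
    · exact Or.inl h
    · exact Or.inr ⟨invRev w, h, FreeGroup.invRev_invRev⟩
  exact (hfin.biUnion fun r _ => (h1 r).union ((h1 r).image _)).subset h2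

lemma IsProdConj.toD {n : ℕ} {g : FreeGroup α} (h : IsProdConj (FreeGroup.mk '' R) n g) :
    ∃ W, FreeGroup.mk W = g ∧ D (CR R) n W := by
  induction n generalizing g with
  | zero =>
    obtain ⟨_, _, _, h⟩ := h
    exact ⟨[], by simpa [FreeGroup.one_eq_mk] using h.symm, D.nil 0⟩
  | succ n ih =>
    obtain ⟨s, r, g', hr, hg', rfl⟩ := h.uncons
    obtain ⟨W, rfl, hW⟩ := ih hg'
    obtain ⟨w, hw, rfl⟩ := mk_mem_CR hr
    obtain ⟨s, rfl⟩ : ∃ s', FreeGroup.mk s' = s := ⟨_, Quot.out_eq s⟩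
    refine ⟨(s ++ w ++ invRev s) ++ W, ?_, ((D.conj hw s).append hW).cast (by omega) rfl⟩
    simp [← FreeGroup.mul_mk, mul_assoc]

lemma M.sound {n : ℕ} {S W : List (α × Bool)} (h : M (CR R) n S W) :
    ∃ k ≤ n, IsProdConj (FreeGroup.mk '' R) k (FreeGroup.mk (S.reverse ++ W)) := by
  induction h with
  | nil n => exact ⟨0, by omega, IsProdConj.zero _⟩
  | push a _ ih => simpa using ih
  | @pop n S W a _ ih =>
    obtain ⟨k, hk, h⟩ := ih
    refine ⟨k, hk, ?_⟩
    have : FreeGroup.mk ((a :: S).reverse ++ invL a :: W) = FreeGroup.mk (S.reverse ++ W) := by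
      refine Quot.sound ?_
      have := @FreeGroup.Red.Step.not _ S.reverse W a.1 a.2
      simpa [invL] using this
    rw [this]; exact h
  | @face n S W y a hc _ ih =>
    obtain ⟨k, hk, h⟩ := ih
    refine ⟨k + 1, by omega, ?_⟩
    obtain ⟨s, r, hr, e⟩ := CR_conj hc
    have := h.cons (FreeGroup.mk S.reverse * s) hr
    convert this using 1
    have e2 : FreeGroup.mk (a :: W) = FreeGroup.mk (a :: y) * FreeGroup.mk (invRev y ++ W) := by
      rw [← FreeGroup.mul_mk, ← FreeGroup.inv_mk]
      have h1 : FreeGroup.mk (a :: y) = FreeGroup.mk [a] * FreeGroup.mk y := by simp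
      have h2 : FreeGroup.mk (a :: W) = FreeGroup.mk [a] * FreeGroup.mk W := by simp
      rw [h1, h2]; group
    rw [← FreeGroup.mul_mk, ← FreeGroup.mul_mk, e2, e]
    group

lemma bwp_iff {n : ℕ} {W : List (α × Bool)} :
    (∃ k ≤ n, IsProdConj (FreeGroup.mk '' R) k (FreeGroup.mk W)) ↔ M (CR R) n [] W := by
  constructor
  · rintro ⟨k, hk, h⟩
    obtain ⟨W', e, h⟩ := h.toD
    have := (h.of_mk_eq CR_rot CR_inv e).toM (M.nil 0)
    simpa using this.mono (by omega)
  · intro h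
    simpa using h.sound

end Group

section Machine

variable {L : Type*} [DecidableEq L]

/-- Successor states of the stack machine. -/
def succs (inv : L → L) (F : List (L × List L)) (st : List L × List L × ℕ) :
    List (List L × List L × ℕ) :=
  List.casesOn st.2.1 [st] fun a W =>
    (a :: st.1, W, st.2.2) ::
      ((if st.1.head? = some (inv a) then [(st.1.tail, W, st.2.2)] else []) ++
        (if st.2.2 = 0 then [] else
          F.filterMap fun p => if p.1 = a then some (st.1, p.2 ++ W, st.2.2 - 1) else none))

/-- Iterated successors. -/
def run (inv : L → L) (F : List (L × List L)) (T : ℕ) (l : List (List L × List L × ℕ)) :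
    List (List L × List L × ℕ) :=
  (fun l => l.flatMap (succs inv F))^[T] l

lemma run_primrec [Primcodable L] (inv : L → L) (hinv : Primrec inv) (F : List (L × List L)) (B : ℕ) :
    PrimrecPred fun p : List L × ℕ =>
      ∃ st ∈ run inv F (p.1.length + p.2 * B) [([], p.1, p.2)], st.1 = [] ∧ st.2.1 = [] := by
  have hs : Primrec (succs inv F) := by
    unfold succs
    refine Primrec.list_casesOn (f := fun st : List L × List L × ℕ => st.2.1)
      (h := fun (st : List L × List L × ℕ) (q : L × List L) => (q.1 :: st.1, q.2, st.2.2) ::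
        ((if st.1.head? = some (inv q.1) then [(st.1.tail, q.2, st.2.2)] else []) ++
        (if st.2.2 = 0 then [] else
          F.filterMap fun p =>
            if p.1 = q.1 then some (st.1, p.2 ++ q.2, st.2.2 - 1) else none)))
      (Primrec.fst.comp Primrec.snd)
      (Primrec.list_cons.comp Primrec.id (Primrec.const [])) ?_
    have hS : Primrec fun q : (List L × List L × ℕ) × (L × List L) => q.1.1 :=
      Primrec.fst.comp Primrec.fst
    have hn : Primrec fun q : (List L × List L × ℕ) × (L × List L) => q.1.2.2 :=
      Primrec.snd.comp (Primrec.snd.comp Primrec.fst)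
    have ha : Primrec fun q : (List L × List L × ℕ) × (L × List L) => q.2.1 :=
      Primrec.fst.comp Primrec.snd
    have hW : Primrec fun q : (List L × List L × ℕ) × (L × List L) => q.2.2 :=
      Primrec.snd.comp Primrec.snd
    refine Primrec.list_cons.comp
      (Primrec.pair (Primrec.list_cons.comp ha hS) (Primrec.pair hW hn)) ?_
    refine Primrec.list_append.comp ?_ ?_
    · refine Primrec.ite (Primrec.eq.comp (Primrec.list_head?.comp hS)
        (Primrec.option_some.comp (hinv.comp ha))) ?_ (Primrec.const [])
      exact Primrec.list_cons.comp
        (Primrec.pair (Primrec.list_tail.comp hS) (Primrec.pair hW hn)) (Primrec.const [])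
    · refine Primrec.ite (Primrec.eq.comp hn (Primrec.const 0)) (Primrec.const []) ?_
      refine Primrec.listFilterMap (Primrec.const F) ?_
      refine Primrec.ite (Primrec.eq.comp (Primrec.fst.comp Primrec.snd) (ha.comp Primrec.fst)) ?_
        (Primrec.const none)
      refine Primrec.option_some.comp (Primrec.pair (hS.comp Primrec.fst) (Primrec.pair ?_ ?_))
      · exact Primrec.list_append.comp (Primrec.snd.comp Primrec.snd) (hW.comp Primrec.fst)
      · exact Primrec.nat_sub.comp (hn.comp Primrec.fst) (Primrec.const 1)
  have hr : Primrec fun p : List L × ℕ =>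
      run inv F (p.1.length + p.2 * B) [([], p.1, p.2)] := by
    unfold run
    refine Primrec.nat_iterate
      (Primrec.nat_add.comp (Primrec.list_length.comp Primrec.fst)
        (Primrec.nat_mul.comp Primrec.snd (Primrec.const B))) ?_ ?_
    · exact Primrec.list_cons.comp
        (Primrec.pair (Primrec.const []) (Primrec.pair Primrec.fst Primrec.snd)) (Primrec.const [])
    · exact Primrec.list_flatMap Primrec.snd (hs.comp Primrec.snd)
  have hacc : PrimrecPred fun st : List L × List L × ℕ => st.1 = [] ∧ st.2.1 = [] :=
    (Primrec.eq.comp Primrec.fst (Primrec.const [])).and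
      (Primrec.eq.comp (Primrec.fst.comp Primrec.snd) (Primrec.const []))
  exact hacc.exists_mem_list.comp hr

end Machine

section Final

variable {α : Type*} [DecidableEq α] {C : Set (List (α × Bool))} {F : List ((α × Bool) × List (α × Bool))}

lemma M_of_succs (hF : ∀ a x, (a, x) ∈ F → ∃ y, a :: y ∈ C ∧ x = invRev y)
    {st st' : List (α × Bool) × List (α × Bool) × ℕ} (h : st' ∈ succs invL F st)
    (hM : M C st'.2.2 st'.1 st'.2.1) : M C st.2.2 st.1 st.2.1 := by
  obtain ⟨S, W, n⟩ := st
  rcases W with _ | ⟨a, W⟩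
  · simp only [succs, List.mem_singleton] at h
    subst h; exact hM
  · simp only [succs, List.mem_cons, List.mem_append] at h
    rcases h with rfl | h | h
    · exact M.push a hM
    · split_ifs at h with h1
      · rcases S with _ | ⟨b, S⟩
        · simp at h1
        · simp only [List.head?_cons, Option.some.injEq] at h1
          have hab : a = invL b := by rw [h1, invL_invL]
          simp only [List.mem_singleton] at h
          subst h
          rw [hab]
          exact M.pop b hM
      · simp at h
    · split_ifs at h with h1
      · simp at h
      · simp only [List.mem_filterMap] at h
        obtain ⟨⟨b, x⟩, hb, h⟩ := h
        split_ifs at h with h2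
        obtain ⟨y, hy, rfl⟩ := hF b x hb
        simp only [Option.some.injEq] at h
        subst h
        simp only at h2
        subst h2
        exact (M.face b hy hM).mono (by simp only; omega)

lemma M_of_run (hF : ∀ a x, (a, x) ∈ F → ∃ y, a :: y ∈ C ∧ x = invRev y) (T : ℕ)
    (l : List (List (α × Bool) × List (α × Bool) × ℕ))
    (h : ∃ st ∈ run invL F T l, st.1 = [] ∧ st.2.1 = []) :
    ∃ st ∈ l, M C st.2.2 st.1 st.2.1 := by
  induction T generalizing l with
  | zero =>
    obtain ⟨st, h, h1, h2⟩ := h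
    refine ⟨st, h, ?_⟩
    rw [h1, h2]; exact M.nil _
  | succ T ih =>
    obtain ⟨st', h, hM⟩ := ih (l.flatMap (succs invL F)) h
    obtain ⟨st, hst, h⟩ := List.mem_flatMap.1 h
    exact ⟨st, hst, M_of_succs hF h hM⟩

lemma run_of_M (hF : ∀ a y, a :: y ∈ C → (a, invRev y) ∈ F) (B : ℕ)
    (hB : ∀ a y, a :: y ∈ C → y.length ≤ B)
    {n : ℕ} {S W : List (α × Bool)} (h : M C n S W) :
    ∀ T l, W.length + n * B ≤ T → (S, W, n) ∈ l →
      ∃ st ∈ run invL F T l, st.1 = [] ∧ st.2.1 = [] := by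
  induction h with
  | nil n =>
    intro T l hT hl
    clear hT
    induction T generalizing l with
    | zero => exact ⟨_, hl, rfl, rfl⟩
    | succ T ih =>
      exact ih (l.flatMap (succs invL F)) (List.mem_flatMap.2 ⟨_, hl, by simp [succs]⟩)
  | @push n S W a _ ih =>
    intro T l hT hl
    obtain ⟨T, rfl⟩ : ∃ T', T = T' + 1 := ⟨T - 1, by simp at hT; omega⟩
    exact ih T (l.flatMap (succs invL F)) (by simp at hT; omega)
      (List.mem_flatMap.2 ⟨_, hl, by simp [succs]⟩)
  | @pop n S W a _ ih =>
    intro T l hT hl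
    obtain ⟨T, rfl⟩ : ∃ T', T = T' + 1 := ⟨T - 1, by simp at hT; omega⟩
    exact ih T (l.flatMap (succs invL F)) (by simp at hT; omega)
      (List.mem_flatMap.2 ⟨_, hl, by simp [succs]⟩)
  | @face n S W y a hc _ ih =>
    intro T l hT hl
    obtain ⟨T, rfl⟩ : ∃ T', T = T' + 1 := ⟨T - 1, by simp at hT; omega⟩
    have := hB a y hc
    refine ih T (l.flatMap (succs invL F)) (by simp [Nat.add_mul] at hT ⊢; omega)
      (List.mem_flatMap.2 ⟨_, hl, ?_⟩)
    have := hF a y hc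
    simp only [succs, List.mem_cons, List.mem_append]
    refine Or.inr (Or.inr ?_)
    rw [if_neg (by omega)]
    exact List.mem_filterMap.2 ⟨_, this, by simp⟩

end Final

lemma bwp_primrec (m : ℕ) (R : Set (Word m)) (hfin : R.Finite) :
    PrimrecPred (fun p : Word m × ℕ => BWP R p.1 p.2) := by
  have hC := CR_finite hfin
  let F : List ((Fin m × Bool) × List (Fin m × Bool)) :=
    hC.toFinset.toList.filterMap fun c => match c with
      | [] => none
      | a :: y => some (a, invRev y)
  have hF1 : ∀ a x, (a, x) ∈ F → ∃ y, a :: y ∈ CR R ∧ x = invRev y := by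
    intro a x h
    obtain ⟨c, hc, h⟩ := List.mem_filterMap.1 h
    rcases c with _ | ⟨b, y⟩
    · simp at h
    · simp only [Option.some.injEq, Prod.mk.injEq] at h
      obtain ⟨rfl, rfl⟩ := h
      exact ⟨y, by simpa using hc, rfl⟩
  have hF2 : ∀ a y, a :: y ∈ CR R → (a, invRev y) ∈ F := by
    intro a y h
    exact List.mem_filterMap.2 ⟨a :: y, by simpa using h, rfl⟩
  obtain ⟨B, hB⟩ : ∃ B, ∀ a y, a :: y ∈ CR R → y.length ≤ B := by
    obtain ⟨B, hB⟩ := (hC.image List.length).bddAbove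
    refine ⟨B, fun a y h => ?_⟩
    have := hB ⟨_, h, rfl⟩
    simp at this
    omega
  refine (run_primrec (invL : Fin m × Bool → Fin m × Bool) (Primrec.dom_finite _) F B).of_eq ?_
  rintro ⟨W, n⟩
  refine Iff.trans ?_ (bwp_iff (R := R)).symm
  constructor
  · intro h
    obtain ⟨st, hst, h⟩ := M_of_run hF1 _ _ h
    simp only [List.mem_singleton] at hst
    subst hst
    exact h
  · intro h
    exact run_of_M hF2 B hB h _ _ le_rfl (by simp)

/-- Decidability content of Proposition 1.1(c): for every finite group presentation,
the bounded and the precise word problems are solvable. -/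
theorem statement2 (m : ℕ) (R : Set (Word m)) (hfin : R.Finite) :
    ComputablePred (fun p : Word m × ℕ => BWP R p.1 p.2) ∧
    ComputablePred (fun p : Word m × ℕ => PWP R p.1 p.2) := by
  have h := bwp_primrec m R hfin
  refine ⟨h.computablePred, PrimrecPred.computablePred ?_⟩
  have h0 : PrimrecPred fun p : Word m × ℕ => p.2 = 0 :=
    Primrec.eq.comp Primrec.snd (Primrec.const 0)
  have h1 : PrimrecPred fun p : Word m × ℕ => BWP R p.1 (p.2 - 1) :=
    h.comp (Primrec.pair Primrec.fst (Primrec.nat_sub.comp Primrec.snd (Primrec.const 1)))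
  refine (h.and (h0.or h1.not)).of_eq ?_
  rintro ⟨W, n⟩
  constructor
  · rintro ⟨⟨k, hk, hP⟩, h2⟩
    have hmin : ∀ j, IsProdConj (evalW '' R) j (evalW W) → n ≤ j := by
      intro j hj
      by_contra hlt
      rcases h2 with h2 | h2
      · simp only at h2; omega
      · exact h2 ⟨j, by simp only; omega, hj⟩
    have : k = n := le_antisymm hk (hmin k hP)
    subst this
    exact ⟨hP, hmin⟩
  · rintro ⟨hP, hmin⟩
    refine ⟨⟨n, le_rfl, hP⟩, ?_⟩
    rcases Nat.eq_zero_or_pos n with h0 | h0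
    · exact Or.inl h0
    · right
      rintro ⟨j, hj, hjP⟩
      have := hmin j hjP
      simp only at hj
      omega

end Stmt2
end

section
/- There exists a finite group presentation ⟨A ∥ R⟩ for which the bounded word problem and the precise word problem are solvable, while the word problem — the set of words W over A^{±1} with W = 1 in the presented group — is unsolvable (undecidable). [Proposition 1.1(d)] -/
namespace Stmt3

/-- Words over the alphabet `A^{±1}` where `A = {a_1, ..., a_m}`: a letter is a pair
`(i, ε)` with `ε = true` for `a_i` and `ε = false` for `a_i⁻¹`. -/
abbrev Word (m : ℕ) := List (Fin m × Bool)

/-- The image of a word in the free group `F(A)`. -/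
def evalW {m : ℕ} (w : Word m) : FreeGroup (Fin m) := FreeGroup.mk w

/-- `g` is a product of exactly `n` conjugates of elements of `R ∪ R⁻¹`. -/
def IsProdConj {G : Type*} [Group G] (R : Set G) (n : ℕ) (g : G) : Prop :=
  ∃ r s : Fin n → G,
    (∀ i, r i ∈ R ∨ (r i)⁻¹ ∈ R) ∧
    g = (List.ofFn fun i => s i * r i * (s i)⁻¹).prod

/-- The bounded word problem: `W` is a product of at most `n` conjugates of words in
`R^{±1}` in the free group `F(A)`. -/
def BWP {m : ℕ} (R : Set (Word m)) (W : Word m) (n : ℕ) : Prop :=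
  ∃ k ≤ n, IsProdConj (evalW '' R) k (evalW W)

/-- The precise word problem: `W` is a product of `n` conjugates of words in `R^{±1}`
in `F(A)` and `n` is minimal with this property. -/
def PWP {m : ℕ} (R : Set (Word m)) (W : Word m) (n : ℕ) : Prop :=
  IsProdConj (evalW '' R) n (evalW W) ∧
    ∀ k, IsProdConj (evalW '' R) k (evalW W) → n ≤ k

/-- The word problem: `W = 1` in the group `⟨A ∥ R⟩`, i.e. `W` lies in the normal
closure of `R` in `F(A)`. -/
def WP {m : ℕ} (R : Set (Word m)) (W : Word m) : Prop :=
  evalW W ∈ Subgroup.normalClosure (evalW '' R)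



section BoundedPart

section Gen
variable {G : Type*} [Group G] {R : Set G}

/-- products of at most `n` conjugates -/
def QConj (R : Set G) (n : ℕ) (g : G) : Prop := ∃ k ≤ n, IsProdConj R k g

theorem isProdConj_zero {g : G} : IsProdConj R 0 g ↔ g = 1 := by
  constructor
  · rintro ⟨r, s, -, h⟩; simpa using h
  · rintro rfl; exact ⟨Fin.elim0, Fin.elim0, fun i => i.elim0, by simp⟩

theorem isProdConj_succ {n : ℕ} {g : G} : IsProdConj R (n+1) g ↔
    ∃ r s g', (r ∈ R ∨ r⁻¹ ∈ R) ∧ IsProdConj R n g' ∧ g = s * r * s⁻¹ * g' := by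
  constructor
  · rintro ⟨r, s, h, rfl⟩
    refine ⟨r 0, s 0, _, h 0, ⟨fun i => r i.succ, fun i => s i.succ, fun i => h i.succ, rfl⟩, ?_⟩
    simp [List.ofFn_succ]
  · rintro ⟨r, s, g', h, ⟨r', s', h', rfl⟩, rfl⟩
    refine ⟨Fin.cons r r', Fin.cons s s', ?_, ?_⟩
    · intro i; refine Fin.cases ?_ ?_ i <;> simp [h, h']
    · simp [List.ofFn_succ]

theorem isProdConj_add {a b : ℕ} {g h : G} (hg : IsProdConj R a g) (hh : IsProdConj R b h) :
    IsProdConj R (a+b) (g*h) := by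
  induction a generalizing g with
  | zero => rw [isProdConj_zero] at hg; subst hg; simpa using hh
  | succ n ih =>
    obtain ⟨r, s, g', h1, h2, rfl⟩ := isProdConj_succ.1 hg
    have e : n + 1 + b = (n + b) + 1 := by omega
    rw [e, isProdConj_succ]
    exact ⟨r, s, g' * h, h1, ih h2, by group⟩

theorem isProdConj_conj {a : ℕ} {g : G} (s : G) (hg : IsProdConj R a g) :
    IsProdConj R a (s * g * s⁻¹) := by
  induction a generalizing g with
  | zero => rw [isProdConj_zero] at hg ⊢; subst hg; simp
  | succ n ih =>
    obtain ⟨r, s', g', h1, h2, rfl⟩ := isProdConj_succ.1 hg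
    rw [isProdConj_succ]
    exact ⟨r, s * s', s * g' * s⁻¹, h1, ih h2, by group⟩

theorem QConj.mono {a b : ℕ} {g : G} (h : QConj R a g) (hab : a ≤ b) : QConj R b g := by
  obtain ⟨k, hk, h⟩ := h; exact ⟨k, hk.trans hab, h⟩

theorem QConj.mul {a b : ℕ} {g h : G} (hg : QConj R a g) (hh : QConj R b h) :
    QConj R (a+b) (g*h) := by
  obtain ⟨k, hk, hg⟩ := hg; obtain ⟨l, hl, hh⟩ := hh
  exact ⟨k+l, by omega, isProdConj_add hg hh⟩

theorem QConj.conj {a : ℕ} {g : G} (s : G) (hg : QConj R a g) : QConj R a (s * g * s⁻¹) := by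
  obtain ⟨k, hk, hg⟩ := hg; exact ⟨k, hk, isProdConj_conj s hg⟩

theorem QConj.conj' {a : ℕ} {g : G} (s : G) (hg : QConj R a g) : QConj R a (s⁻¹ * g * s) := by
  simpa using hg.conj s⁻¹

theorem qConj_zero {g : G} : QConj R 0 g ↔ g = 1 := by
  simp [QConj, isProdConj_zero]

theorem QConj.of_eq_one {a : ℕ} {g : G} (h : g = 1) : QConj R a g :=
  ⟨0, Nat.zero_le _, isProdConj_zero.2 h⟩

theorem QConj.single {r : G} (h : r ∈ R ∨ r⁻¹ ∈ R) : QConj R 1 r :=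
  ⟨1, le_rfl, isProdConj_succ.2 ⟨r, 1, 1, h, isProdConj_zero.2 rfl, by simp⟩⟩

theorem QConj.exists_of_ne_one {a : ℕ} {g : G} (h : QConj R (a+1) g) (hg : g ≠ 1) :
    ∃ r s g', (r ∈ R ∨ r⁻¹ ∈ R) ∧ QConj R a g' ∧ g = s * r * s⁻¹ * g' := by
  obtain ⟨k, hk, h⟩ := h
  cases k with
  | zero => exact absurd (isProdConj_zero.1 h) hg
  | succ k =>
    obtain ⟨r, s, g', h1, h2, h3⟩ := isProdConj_succ.1 h
    exact ⟨r, s, g', h1, ⟨k, by omega, h2⟩, h3⟩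

end Gen

section Free
open FreeGroup
variable {α : Type*} {R : Set (FreeGroup α)} {C : Set (List (α × Bool))}

/-- the vertices from which a face can be peeled off -/
def Gam (R : Set (FreeGroup α)) (C : Set (List (α × Bool))) (n : ℕ) (W u : FreeGroup α) : Prop :=
  ∃ c ∈ C, QConj R n (u * FreeGroup.mk c * u⁻¹ * W)

/-- the relators closed under rotation and inversion -/
structure CycClosed (R : Set (FreeGroup α)) (C : Set (List (α × Bool))) : Prop where
  rot : ∀ l₁ l₂, l₁ ++ l₂ ∈ C → l₂ ++ l₁ ∈ C
  inv : ∀ c ∈ C, FreeGroup.invRev c ∈ C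
  one : ∀ c ∈ C, QConj R 1 (FreeGroup.mk c)
  surj : ∀ r, r ∈ R ∨ r⁻¹ ∈ R → ∃ c ∈ C, FreeGroup.mk c = r

theorem Gam.left {a b : ℕ} {h k u : FreeGroup α} (H : Gam R C a h u) (hk : QConj R b k) :
    Gam R C (a+b) (h*k) u := by
  obtain ⟨c, hc, H⟩ := H
  refine ⟨c, hc, ?_⟩
  have := H.mul hk
  simpa [mul_assoc] using this

theorem Gam.right {a b : ℕ} {h k u : FreeGroup α} (hh : QConj R a h) (H : Gam R C b k u) :
    Gam R C (a+b) (h*k) (h*u) := by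
  obtain ⟨c, hc, H⟩ := H
  refine ⟨c, hc, ?_⟩
  have := hh.mul H
  convert this using 1; group

theorem Gam.right' {a b : ℕ} {h k u : FreeGroup α} (hh : QConj R a h) (H : Gam R C b k u) :
    Gam R C (a+b) (h*k) u := by
  obtain ⟨c, hc, H⟩ := H
  refine ⟨c, hc, ?_⟩
  have := (hh.conj (u * FreeGroup.mk c * u⁻¹)).mul H
  convert this using 1; group

theorem Gam.mono {a b : ℕ} {W u : FreeGroup α} (H : Gam R C a W u) (hab : a ≤ b) :
    Gam R C b W u := by
  obtain ⟨c, hc, H⟩ := H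
  exact ⟨c, hc, H.mono hab⟩

theorem Gam.shift {a : ℕ} {W u : FreeGroup α} (H : Gam R C a W (W*u)) : Gam R C a W u := by
  obtain ⟨c, hc, H⟩ := H
  refine ⟨c, hc, ?_⟩
  have := H.conj' W
  convert this using 1; group

theorem Gam.base (hC : CycClosed R C) {c : List (α × Bool)} (hc : c ∈ C) (u : FreeGroup α)
    {p : List (α × Bool)} (hp : p <+: c) :
    Gam R C 0 (u * FreeGroup.mk c * u⁻¹) (u * FreeGroup.mk p) := by
  obtain ⟨q, rfl⟩ := hp
  refine ⟨_, hC.inv _ (hC.rot _ _ hc), qConj_zero.2 ?_⟩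
  rw [← FreeGroup.inv_mk, ← FreeGroup.mul_mk, ← FreeGroup.mul_mk]
  group

/-- a path reducing to a word starting with `x` crosses the edge `x` at the start vertex -/
theorem red_cross {L : List (α × Bool)} {x : α × Bool} {L' : List (α × Bool)}
    (h : FreeGroup.Red L (x :: L')) :
    ∃ w₁ w₂, L = w₁ ++ x :: w₂ ∧ FreeGroup.mk w₁ = 1 := by
  induction h using Relation.ReflTransGen.head_induction_on with
  | refl => exact ⟨[], L', rfl, rfl⟩
  | head h _ ih =>
    obtain ⟨w₁, w₂, hw, h1⟩ := ih
    cases h with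
    | @not l₁ l₂ y b =>
      rcases List.append_eq_append_iff.1 hw with ⟨a, ha, hb⟩ | ⟨a, ha, hb⟩
      · refine ⟨l₁ ++ (y, b) :: (y, !b) :: a, w₂, by simp [hb], ?_⟩
        rw [← h1, ha]
        exact (Quot.sound (FreeGroup.Red.Step.not (L₁ := l₁) (L₂ := a) (x := y) (b := b)))
      · cases a with
        | nil =>
          simp only [List.append_nil, List.nil_append] at ha hb
          refine ⟨l₁ ++ [(y, b), (y, !b)], w₂, by simp [← hb], ?_⟩
          rw [← h1, ← ha]
          have h : FreeGroup.mk (l₁ ++ (y, b) :: (y, !b) :: []) = FreeGroup.mk (l₁ ++ []) :=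
            Quot.sound (FreeGroup.Red.Step.not (L₁ := l₁) (L₂ := []) (x := y) (b := b))
          rwa [List.append_nil] at h
        | cons z a =>
          simp only [List.cons_append, List.cons.injEq] at hb
          obtain ⟨rfl, rfl⟩ := hb
          exact ⟨w₁, a ++ (y, b) :: (y, !b) :: l₂, by simp [ha], h1⟩

theorem exists_cross {L₁ L₂ : List (α × Bool)} (h : FreeGroup.mk L₁ = FreeGroup.mk L₂)
    (h1 : FreeGroup.mk L₁ ≠ 1) : ∃ x,
    (∃ w₁ w₂, L₁ = w₁ ++ x :: w₂ ∧ FreeGroup.mk w₁ = 1) ∧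
    (∃ w₁ w₂, L₂ = w₁ ++ x :: w₂ ∧ FreeGroup.mk w₁ = 1) := by
  obtain ⟨L, hL1, hL2⟩ := FreeGroup.Red.exact.1 h
  cases L with
  | nil => exact absurd (FreeGroup.Red.exact.2 ⟨[], hL1, FreeGroup.Red.refl⟩) h1
  | cons x L => exact ⟨x, red_cross hL1, red_cross hL2⟩

theorem prefix_invRev {p z : List (α × Bool)} (h : p <+: FreeGroup.invRev z) :
    ∃ z₁ z₂, z = z₁ ++ z₂ ∧ p = FreeGroup.invRev z₂ := by
  obtain ⟨q, hq⟩ := h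
  refine ⟨FreeGroup.invRev q, FreeGroup.invRev p, ?_, by simp⟩
  rw [← FreeGroup.invRev_append, hq, FreeGroup.invRev_invRev]

theorem prefix_app {β : Type*} {p a b : List β} (h : p <+: a ++ b) :
    p <+: a ∨ ∃ q, p = a ++ q ∧ q <+: b := by
  obtain ⟨t, ht⟩ := h
  rcases List.append_eq_append_iff.1 ht with ⟨c, h1, h2⟩ | ⟨c, h1, h2⟩
  · left; exact ⟨c, h1.symm⟩
  · right; exact ⟨c, h1, ⟨t, h2.symm⟩⟩

theorem main_claim (hC : CycClosed R C) : ∀ (n : ℕ) (W v : FreeGroup α) (w : List (α × Bool)),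
    QConj R (n+1) W → W ≠ 1 → v * FreeGroup.mk w = W * v →
    ∃ p, p <+: w ∧ Gam R C n W (v * FreeGroup.mk p) := by
  classical
  intro n
  induction n using Nat.strong_induction_on with
  | _ n IH =>
  intro W v w hW hW1 hw
  by_contra H
  push Not at H
  -- a closest vertex of `Gam` to `v`
  have hne : ∃ y : List (α × Bool), Gam R C n W (v * FreeGroup.mk y) := by
    obtain ⟨r, s, g', h1, h2, h3⟩ := hW.exists_of_ne_one hW1
    obtain ⟨c, hc, hcr⟩ := hC.surj r h1
    refine ⟨(v⁻¹ * s).toWord, FreeGroup.invRev c, hC.inv c hc, ?_⟩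
    rw [FreeGroup.mk_toWord, ← FreeGroup.inv_mk, hcr, h3]
    convert h2 using 1; group
  obtain ⟨y, hy, hmin⟩ := WellFounded.has_min (measure (List.length (α := α × Bool))).wf
    {y | Gam R C n W (v * FreeGroup.mk y)} hne
  replace hmin : ∀ y', Gam R C n W (v * FreeGroup.mk y') → y.length ≤ y'.length :=
    fun y' h => not_lt.1 (hmin y' h)
  change Gam R C n W (v * FreeGroup.mk y) at hy
  set u0 := v * FreeGroup.mk y with hu0
  have hy0 : y ≠ [] := by
    rintro rfl
    exact H [] ⟨_, List.nil_append _⟩ hy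
  -- the path from `u0` to `W u0` through `v`
  set A := FreeGroup.invRev y ++ (w ++ y) with hA
  have hAend : u0 * FreeGroup.mk A = W * u0 := by
    rw [hA, ← FreeGroup.mul_mk, ← FreeGroup.mul_mk, ← FreeGroup.inv_mk, hu0, ← mul_assoc W, ← hw]
    group
  have hApre : ∀ p, p <+: A → Gam R C n W (u0 * FreeGroup.mk p) → p = [] ∨ p = A := by
    intro p hp hG
    rcases prefix_app hp with hp | ⟨q, rfl, hq⟩
    · obtain ⟨y1, y2, rfl, rfl⟩ := prefix_invRev hp
      left
      have : u0 * FreeGroup.mk (FreeGroup.invRev y2) = v * FreeGroup.mk y1 := by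
        rw [hu0, ← FreeGroup.inv_mk, ← FreeGroup.mul_mk]; group
      rw [this] at hG
      have := hmin _ hG
      have : y2 = [] := by
        rw [List.length_append] at this
        exact List.length_eq_zero_iff.1 (by omega)
      simp [this]
    · have e1 : u0 * FreeGroup.mk (FreeGroup.invRev y) = v := by
        rw [hu0, ← FreeGroup.inv_mk]; group
      rw [← FreeGroup.mul_mk, ← mul_assoc, e1] at hG
      rcases prefix_app hq with hq | ⟨q', rfl, hq'⟩
      · exact absurd hG (H _ hq)
      · rw [← FreeGroup.mul_mk, ← mul_assoc, hw, mul_assoc] at hG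
        have := hmin _ hG.shift
        have : q' = y := hq'.eq_of_length_le this
        right; rw [this]
  have hAlen : 2 ≤ A.length := by
    have := List.length_pos_iff.2 hy0
    simp [hA]; omega
  -- no Gam-path from `u0` to `W u0`
  have key : ∀ z, u0 * FreeGroup.mk z = W * u0 →
      (∀ p, p <+: z → Gam R C n W (u0 * FreeGroup.mk p)) → False := by
    intro z hz hzG
    have e : FreeGroup.mk z = FreeGroup.mk A := by
      have := hz.trans hAend.symm; exact mul_left_cancel this
    have hz1 : FreeGroup.mk z ≠ 1 := by
      intro h; rw [h, mul_one] at hz; exact hW1 (by simpa using hz.symm)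
    obtain ⟨x, ⟨z1, z2, rfl, hz1'⟩, ⟨A1, A2, hA12, hA1⟩⟩ := exists_cross e hz1
    have h1 := hApre A1 (hA12 ▸ List.prefix_append _ _) (by rw [hA1, mul_one]; exact hy)
    have h2 := hApre (A1 ++ [x]) (by rw [hA12]; exact ⟨A2, by simp⟩) (by
      have := hzG (z1 ++ [x]) ⟨z2, by simp⟩
      rw [← FreeGroup.mul_mk, hz1'] at this
      rwa [← FreeGroup.mul_mk, hA1])
    rcases h1 with rfl | h1
    · rcases h2 with h2 | h2
      · simp at h2
      · rw [← h2] at hAlen; simp at hAlen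
    · rw [h1] at hA12
      have := congrArg List.length hA12
      simp at this
  -- growing clusters
  have grow : ∀ j, j ≤ n → ∃ (k h : FreeGroup α) (z : List (α × Bool)), QConj R (j+1) k ∧
      QConj R (n-j) h ∧ W = h * k ∧ u0 * FreeGroup.mk z = k * u0 ∧
      ∀ p, p <+: z → Gam R C j k (u0 * FreeGroup.mk p) := by
    intro j
    induction j with
    | zero =>
      intro _
      obtain ⟨c, hc, hq⟩ := hy
      have hk : QConj R 1 (u0 * FreeGroup.mk (FreeGroup.invRev c) * u0⁻¹) :=
        (hC.one _ (hC.inv c hc)).conj u0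
      refine ⟨_, _, FreeGroup.invRev c, hk, hq.conj (u0 * FreeGroup.mk (FreeGroup.invRev c) * u0⁻¹),
        ?_, by group, fun p hp => Gam.base hC (hC.inv c hc) u0 hp⟩
      rw [← FreeGroup.inv_mk]; group
    | succ j ih =>
      intro hj
      obtain ⟨k, h, z, hk, hh, rfl, hz, hG⟩ := ih (by omega)
      by_cases h1 : h = 1
      · subst h1
        simp only [one_mul] at *
        exact (key z hz (fun p hp => (hG p hp).mono (by omega))).elim
      obtain ⟨m, hm⟩ : ∃ m, n = j + 1 + m := ⟨n - (j+1), by omega⟩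
      have e1 : n - j = m + 1 := by omega
      have e2 : n - (j+1) = m := by omega
      rw [e1] at hh
      rw [e2]
      obtain ⟨p, hp, hpG⟩ := IH m (by omega) h (k * u0) (FreeGroup.invRev z ++ A) hh h1 (by
        rw [← FreeGroup.mul_mk, ← FreeGroup.inv_mk, ← hz]
        rw [mul_assoc, mul_inv_cancel_left, hAend, hz, mul_assoc])
      have toW : ∀ u, Gam R C m h u → Gam R C n (h*k) u := fun u hu =>
        (hu.left hk).mono (by omega)
      -- the two cases
      have cases12 : (∃ z1 z2, z = z1 ++ z2 ∧ Gam R C m h (u0 * FreeGroup.mk z1)) ∨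
          Gam R C m h (h * k * u0) := by
        rcases prefix_app hp with hp | ⟨q, rfl, hq⟩
        · obtain ⟨z1, z2, rfl, rfl⟩ := prefix_invRev hp
          left
          refine ⟨z1, z2, rfl, ?_⟩
          convert hpG using 1
          rw [← hz, ← FreeGroup.inv_mk, ← FreeGroup.mul_mk]; group
        · have e : k * u0 * FreeGroup.mk (FreeGroup.invRev z) = u0 := by
            rw [← hz, ← FreeGroup.inv_mk]; group
          rw [← FreeGroup.mul_mk, ← mul_assoc, e] at hpG
          rcases hApre q hq (toW _ hpG) with rfl | rfl
          · left; exact ⟨[], z, rfl, hpG⟩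
          · right; rwa [hAend] at hpG
      rcases cases12 with ⟨z1, z2, rfl, c, hc, hq⟩ | ⟨c, hc, hq⟩
      · obtain ⟨u, hu⟩ : ∃ u, u = u0 * FreeGroup.mk z1 := ⟨_, rfl⟩
        rw [← hu] at hq
        obtain ⟨g, hg⟩ : ∃ g, g = u * FreeGroup.mk (FreeGroup.invRev c) * u⁻¹ := ⟨_, rfl⟩
        have hg1 : QConj R 1 g := hg ▸ (hC.one _ (hC.inv c hc)).conj u
        have hginv : g = (u * FreeGroup.mk c * u⁻¹)⁻¹ := by
          rw [hg, ← FreeGroup.inv_mk]; group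
        have hz' : u * FreeGroup.mk z2 = k * u0 := by
          rw [← hz, ← FreeGroup.mul_mk, hu, mul_assoc]
        have hgu : u * FreeGroup.mk (FreeGroup.invRev c) = g * u := by rw [hg]; group
        refine ⟨g * k, g * (u * FreeGroup.mk c * u⁻¹ * h) * g⁻¹,
          z1 ++ (FreeGroup.invRev c ++ z2), ?_, hq.conj g, ?_, ?_, ?_⟩
        · exact (hg1.mul hk).mono (by omega)
        · rw [hginv]; group
        · rw [← FreeGroup.mul_mk, ← FreeGroup.mul_mk, ← mul_assoc, ← mul_assoc, ← hu, hgu,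
            mul_assoc, hz', mul_assoc]
        · intro p hp
          rcases prefix_app hp with hp | ⟨q, rfl, hq'⟩
          · exact ((hG p (hp.trans (List.prefix_append _ _))).right' hg1).mono (by omega)
          · rw [← FreeGroup.mul_mk, ← mul_assoc, ← hu]
            rcases prefix_app hq' with hq' | ⟨q', rfl, hq''⟩
            · exact ((hg ▸ Gam.base hC (hC.inv c hc) u hq' : Gam R C 0 g _).left hk).mono (by omega)
            · rw [← FreeGroup.mul_mk, ← mul_assoc, hgu, mul_assoc]
              refine (Gam.right hg1 ?_).mono (show 1 + j ≤ j + 1 by omega)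
              rw [hu, mul_assoc, FreeGroup.mul_mk]
              exact hG _ ((List.prefix_append_right_inj _).2 hq'')
      · obtain ⟨g, hg⟩ : ∃ g, g = u0 * FreeGroup.mk (FreeGroup.invRev c) * u0⁻¹ := ⟨_, rfl⟩
        have hg1 : QConj R 1 g := hg ▸ (hC.one _ (hC.inv c hc)).conj u0
        have hgu : u0 * FreeGroup.mk (FreeGroup.invRev c) = g * u0 := by rw [hg]; group
        refine ⟨k * g, h * k * u0 * FreeGroup.mk c * (h * k * u0)⁻¹ * h,
          z ++ FreeGroup.invRev c, hk.mul hg1, hq, ?_, ?_, ?_⟩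
        · rw [hg, ← FreeGroup.inv_mk]; group
        · rw [← FreeGroup.mul_mk, ← mul_assoc, hz, mul_assoc, hgu, mul_assoc]
        · intro p hp
          rcases prefix_app hp with hp | ⟨q, rfl, hq'⟩
          · exact (hG p hp).left hg1
          · rw [← FreeGroup.mul_mk, ← mul_assoc, hz, mul_assoc]
            exact (Gam.right hk (hg ▸ Gam.base hC (hC.inv c hc) u0 hq' : Gam R C 0 g _)).mono (by omega)
  obtain ⟨k, h, z, hk, hh, hWe, hz, hG⟩ := grow n le_rfl
  rw [Nat.sub_self, qConj_zero] at hh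
  subst hh
  rw [one_mul] at hWe
  subst hWe
  exact key z hz hG

end Free
end BoundedPart

section BoundedComp
open FreeGroup

variable {α : Type*}

/-- all cyclic rotations of relators and of their inverses -/
def cycSet (R : Set (List (α × Bool))) : Set (List (α × Bool)) :=
  {c | ∃ l₁ l₂, l₁ ++ l₂ ∈ R ∧ (c = l₂ ++ l₁ ∨ c = FreeGroup.invRev (l₂ ++ l₁))}

theorem cycSet_finite {R : Set (List (α × Bool))} (hR : R.Finite) : (cycSet R).Finite := by
  have : cycSet R ⊆ ⋃ w ∈ R, ⋃ i ∈ Finset.range (w.length + 1),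
      {w.drop i ++ w.take i, FreeGroup.invRev (w.drop i ++ w.take i)} := by
    rintro c ⟨l₁, l₂, h, hc⟩
    simp only [Set.mem_iUnion]
    refine ⟨l₁ ++ l₂, h, l₁.length, by simp, ?_⟩
    simpa using hc
  refine Set.Finite.subset ?_ this
  refine hR.biUnion fun w _ => ?_
  exact (Finset.finite_toSet _).biUnion fun i _ => by simp

theorem rot_cases {β : Type*} {a b c d : List β} (h : a ++ b = c ++ d) :
    ∃ e f, e ++ f = d ++ c ∧ f ++ e = b ++ a ∨ e ++ f = b ++ a ∧ f ++ e = d ++ c := by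
  rcases List.append_eq_append_iff.1 h with ⟨x, h1, h2⟩ | ⟨x, h1, h2⟩
  · subst h1 h2
    exact ⟨x, d ++ a, by simp⟩
  · subst h1 h2
    exact ⟨x, b ++ c, by simp⟩

theorem cycSet_rot {R : Set (List (α × Bool))} {a b : List (α × Bool)} (h : a ++ b ∈ cycSet R) :
    b ++ a ∈ cycSet R := by
  have aux : ∀ l₁ l₂ a b : List (α × Bool), a ++ b = l₂ ++ l₁ → l₁ ++ l₂ ∈ R →
      ∃ m₁ m₂, m₁ ++ m₂ ∈ R ∧ b ++ a = m₂ ++ m₁ := by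
    intro l₁ l₂ a b h hR
    rcases List.append_eq_append_iff.1 h with ⟨x, h1, h2⟩ | ⟨x, h1, h2⟩
    · subst h1 h2
      exact ⟨l₁ ++ a, x, by simpa using hR, by simp⟩
    · subst h1 h2
      exact ⟨x, b ++ l₂, by simpa using hR, by simp⟩
  obtain ⟨l₁, l₂, hR, h | h⟩ := h
  · obtain ⟨m₁, m₂, h1, h2⟩ := aux _ _ _ _ h hR
    exact ⟨m₁, m₂, h1, Or.inl h2⟩
  · have : FreeGroup.invRev b ++ FreeGroup.invRev a = l₂ ++ l₁ := by
      rw [← FreeGroup.invRev_append, h, FreeGroup.invRev_invRev]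
    obtain ⟨m₁, m₂, h1, h2⟩ := aux _ _ _ _ this hR
    refine ⟨m₁, m₂, h1, Or.inr ?_⟩
    rw [← h2, FreeGroup.invRev_append, FreeGroup.invRev_invRev, FreeGroup.invRev_invRev]

theorem cycSet_closed (R : Set (List (α × Bool))) :
    CycClosed (FreeGroup.mk '' R) (cycSet R) where
  rot _ _ h := cycSet_rot h
  inv := by
    rintro c ⟨l₁, l₂, h, rfl | rfl⟩
    · exact ⟨l₁, l₂, h, Or.inr rfl⟩
    · exact ⟨l₁, l₂, h, Or.inl (by simp)⟩
  one := by
    rintro c ⟨l₁, l₂, h, rfl | rfl⟩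
    · have := (QConj.single (Or.inl (Set.mem_image_of_mem FreeGroup.mk h))).conj'
        (FreeGroup.mk l₁)
      convert this using 1
      rw [← FreeGroup.mul_mk, ← FreeGroup.mul_mk]; group
    · have : (FreeGroup.mk (l₁ ++ l₂))⁻¹⁻¹ ∈ FreeGroup.mk '' R := by
        rw [inv_inv]; exact Set.mem_image_of_mem FreeGroup.mk h
      have := (QConj.single (Or.inr this)).conj' (FreeGroup.mk l₁)
      convert this using 1
      rw [← FreeGroup.inv_mk, ← FreeGroup.mul_mk, ← FreeGroup.mul_mk]; group
  surj := by
    rintro r (⟨w, hw, rfl⟩ | ⟨w, hw, h⟩)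
    · exact ⟨w, ⟨[], w, hw, Or.inl (by simp)⟩, rfl⟩
    · refine ⟨FreeGroup.invRev w, ⟨[], w, hw, Or.inr (by simp)⟩, ?_⟩
      rw [← FreeGroup.inv_mk, h, inv_inv]

theorem qConj_step {R : Set (FreeGroup α)} {C : Set (List (α × Bool))} (hC : CycClosed R C)
    (n : ℕ) (W : List (α × Bool)) :
    QConj R (n+1) (FreeGroup.mk W) ↔ QConj R n (FreeGroup.mk W) ∨
      ∃ U V c, W = U ++ V ∧ c ∈ C ∧ QConj R n (FreeGroup.mk (U ++ c ++ V)) := by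
  constructor
  · intro h
    by_cases h1 : FreeGroup.mk W = 1
    · left; exact QConj.of_eq_one h1
    · right
      obtain ⟨p, ⟨V, rfl⟩, c, hc, hq⟩ := main_claim hC n (FreeGroup.mk W) 1 W h h1 (by simp)
      refine ⟨p, V, c, rfl, hc, ?_⟩
      convert hq using 1
      rw [← FreeGroup.mul_mk, ← FreeGroup.mul_mk, ← FreeGroup.mul_mk]; group
  · rintro (h | ⟨U, V, c, rfl, hc, h⟩)
    · exact h.mono (by omega)
    · have := ((hC.one _ (hC.inv c hc)).conj (FreeGroup.mk U)).mul h
      convert this.mono (show 1 + n ≤ n + 1 by omega) using 1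
      rw [← FreeGroup.mul_mk, ← FreeGroup.mul_mk, ← FreeGroup.mul_mk, ← FreeGroup.inv_mk]; group

/-- all insertions of a word in `Cl` into `w` -/
def insAll (Cl : List (List (α × Bool))) (w : List (α × Bool)) : List (List (α × Bool)) :=
  (List.range (w.length + 1)).flatMap fun i => Cl.map fun c => w.take i ++ c ++ w.drop i

/-- one step of the search -/
def stepL (Cl : List (List (α × Bool))) (L : List (List (α × Bool))) : List (List (α × Bool)) :=
  L ++ L.flatMap (insAll Cl)

theorem mem_insAll {Cl : List (List (α × Bool))} {w v : List (α × Bool)} :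
    v ∈ insAll Cl w ↔ ∃ U V c, w = U ++ V ∧ c ∈ Cl ∧ v = U ++ c ++ V := by
  simp only [insAll, List.mem_flatMap, List.mem_range, List.mem_map]
  constructor
  · rintro ⟨i, _, c, hc, rfl⟩
    exact ⟨_, _, c, (List.take_append_drop i w).symm, hc, rfl⟩
  · rintro ⟨U, V, c, rfl, hc, rfl⟩
    exact ⟨U.length, by simp, c, hc, by simp⟩

theorem search_correct {R : Set (FreeGroup α)} {Cl : List (List (α × Bool))}
    (hC : CycClosed R {c | c ∈ Cl}) (n : ℕ) (L : List (List (α × Bool))) :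
    (∃ w ∈ (stepL Cl)^[n] L, FreeGroup.mk w = 1) ↔ ∃ W ∈ L, QConj R n (FreeGroup.mk W) := by
  induction n generalizing L with
  | zero => simp [qConj_zero]
  | succ n ih =>
    rw [Function.iterate_succ_apply, ih]
    constructor
    · rintro ⟨w, hw, h⟩
      rcases List.mem_append.1 hw with hw | hw
      · exact ⟨w, hw, h.mono (by omega)⟩
      · obtain ⟨W, hW, hw⟩ := List.mem_flatMap.1 hw
        obtain ⟨U, V, c, rfl, hc, rfl⟩ := mem_insAll.1 hw
        exact ⟨_, hW, (qConj_step hC n _).2 (Or.inr ⟨U, V, c, rfl, hc, h⟩)⟩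
    · rintro ⟨W, hW, h⟩
      rcases (qConj_step hC n _).1 h with h | ⟨U, V, c, rfl, hc, h⟩
      · exact ⟨W, List.mem_append_left _ hW, h⟩
      · exact ⟨_, List.mem_append_right _ (List.mem_flatMap.2
          ⟨_, hW, mem_insAll.2 ⟨U, V, c, rfl, hc, rfl⟩⟩), h⟩

end BoundedComp

section BoundedPrim
variable {m : ℕ}

theorem primrec_insAll (Cl : List (Word m)) : Primrec (insAll Cl) := by
  unfold insAll
  refine Primrec.list_flatMap (Primrec.list_range.comp
    (Primrec.succ.comp Primrec.list_length)) ?_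
  refine Primrec.list_map (Primrec.const Cl) ?_
  refine Primrec.list_append.comp (Primrec.list_append.comp
    (Primrec.list_take.comp (Primrec.snd.comp Primrec.fst) (Primrec.fst.comp Primrec.fst))
    Primrec.snd)
    (Primrec.list_drop.comp (Primrec.snd.comp Primrec.fst) (Primrec.fst.comp Primrec.fst))

theorem primrec_stepL (Cl : List (Word m)) : Primrec (stepL Cl) :=
  Primrec.list_append.comp Primrec.id
    (Primrec.list_flatMap Primrec.id ((primrec_insAll Cl).comp Primrec.snd).to₂)

theorem primrec_reduce : Primrec (FreeGroup.reduce : Word m → Word m) := by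
  have h : Primrec₂ (fun (_ : Word m) (q : (Fin m × Bool) × Word m × Word m) =>
      (List.casesOn q.2.2 [q.1] fun hd tl =>
        if q.1.1 = hd.1 ∧ q.1.2 = !hd.2 then tl else q.1 :: hd :: tl : Word m)) := by
    have f0 : Primrec (fun p : Word m × (Fin m × Bool) × Word m × Word m => p.2.2.2) :=
      Primrec.snd.comp (Primrec.snd.comp Primrec.snd)
    have f0' : Primrec (fun p : Word m × (Fin m × Bool) × Word m × Word m => [p.2.1]) :=
      Primrec.list_cons.comp (Primrec.fst.comp Primrec.snd) (Primrec.const [])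
    refine Primrec.list_casesOn (h := fun (p : Word m × (Fin m × Bool) × Word m × Word m)
      (r : (Fin m × Bool) × Word m) => (if p.2.1.1 = r.1.1 ∧ p.2.1.2 = !r.1.2 then r.2
        else p.2.1 :: r.1 :: r.2 : Word m)) f0 f0' ?_
    have f1 : Primrec (fun p : (Word m × (Fin m × Bool) × Word m × Word m) ×
      (Fin m × Bool) × Word m => p.1.2.1) := Primrec.fst.comp (Primrec.snd.comp Primrec.fst)
    have f2 : Primrec (fun p : (Word m × (Fin m × Bool) × Word m × Word m) ×
      (Fin m × Bool) × Word m => p.2.1) := Primrec.fst.comp Primrec.snd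
    have f3 : Primrec (fun p : (Word m × (Fin m × Bool) × Word m × Word m) ×
      (Fin m × Bool) × Word m => p.2.2) := Primrec.snd.comp Primrec.snd
    refine Primrec.ite ?_ f3 (Primrec.list_cons.comp f1 (Primrec.list_cons.comp f2 f3))
    exact PrimrecPred.and (Primrec.eq.comp (Primrec.fst.comp f1) (Primrec.fst.comp f2))
      (Primrec.eq.comp (Primrec.snd.comp f1) (Primrec.not.comp (Primrec.snd.comp f2)))
  refine (Primrec.list_rec Primrec.id (Primrec.const []) h).of_eq fun w => ?_
  rfl

theorem primrec_mk_eq_one : PrimrecPred (fun w : Word m => FreeGroup.mk w = 1) := by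
  have : PrimrecPred (fun w : Word m => FreeGroup.reduce w = []) :=
    Primrec.eq.comp primrec_reduce (Primrec.const [])
  refine this.of_eq fun w => ?_
  rw [← FreeGroup.toWord_mk, FreeGroup.toWord_eq_nil_iff]

theorem bwp_primrec {R : Set (Word m)} (hR : R.Finite) :
    PrimrecPred (fun p : Word m × ℕ => BWP R p.1 p.2) := by
  obtain ⟨Cl, hCl⟩ : ∃ Cl : List (Word m), {c | c ∈ Cl} = cycSet R :=
    ⟨(cycSet_finite hR).toFinset.toList, by ext; simp⟩
  have hC : CycClosed (FreeGroup.mk '' R) {c | c ∈ Cl} := hCl ▸ cycSet_closed R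
  have hs : Primrec (fun p : Word m × ℕ => (stepL Cl)^[p.2] [p.1]) :=
    Primrec.nat_iterate Primrec.snd (Primrec.list_cons.comp Primrec.fst (Primrec.const []))
      ((primrec_stepL Cl).comp Primrec.snd).to₂
  have := (PrimrecPred.exists_mem_list primrec_mk_eq_one).comp hs
  refine this.of_eq fun p => ?_
  rw [search_correct hC]
  simp only [List.mem_singleton, exists_eq_left]
  rfl

theorem pwp_iff {R : Set (Word m)} {W : Word m} {n : ℕ} :
    PWP R W n ↔ BWP R W n ∧ (n = 0 ∨ ¬ BWP R W (n - 1)) := by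
  constructor
  · rintro ⟨h, hm⟩
    refine ⟨⟨n, le_rfl, h⟩, ?_⟩
    by_cases hn : n = 0
    · exact Or.inl hn
    · right
      rintro ⟨k, hk, h'⟩
      have := hm k h'
      omega
  · rintro ⟨⟨k, hk, h⟩, h'⟩
    have key : ∀ j, IsProdConj (evalW '' R) j (evalW W) → n ≤ j := by
      intro j hj
      rcases h' with rfl | h'
      · omega
      · by_contra hlt
        exact h' ⟨j, by omega, hj⟩
    have := key k h
    obtain rfl : k = n := by omega
    exact ⟨h, key⟩

theorem pwp_primrec {R : Set (Word m)} (hR : R.Finite) :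
    PrimrecPred (fun p : Word m × ℕ => PWP R p.1 p.2) := by
  have h := bwp_primrec hR
  have h2 : PrimrecPred (fun p : Word m × ℕ => p.2 = 0 ∨ ¬ BWP R p.1 (p.2 - 1)) :=
    (Primrec.eq.comp Primrec.snd (Primrec.const 0)).or
      (h.comp (Primrec.pair Primrec.fst (Primrec.pred.comp Primrec.snd))).not
  exact (h.and h2).of_eq fun p => pwp_iff.symm

theorem computablePred_of_primrec {α : Type*} [Primcodable α] {p : α → Prop}
    (h : PrimrecPred p) : ComputablePred p := by
  obtain ⟨hd, h⟩ := h
  exact ⟨hd, h.to_comp⟩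

end BoundedPrim

/-! ### Part G: groups from residue class moves -/

section GroupPart

/-- A move on `ℤ × ℤ` identifying `(A1 u + a1, A2 v + a2)` with `(B1 u + b1, B2 v + b2)`. -/
structure Mv where
  A1 : ℕ
  a1 : ℕ
  A2 : ℕ
  a2 : ℕ
  B1 : ℕ
  b1 : ℕ
  B2 : ℕ
  b2 : ℕ
  hA1 : a1 < A1
  hA2 : a2 < A2
  hB1 : b1 < B1
  hB2 : b2 < B2

/-- one move -/
def Mv.rel (f : Mv) (p q : ℤ × ℤ) : Prop :=
  ∃ u v : ℤ, p = (f.A1 * u + f.a1, f.A2 * v + f.a2) ∧ q = (f.B1 * u + f.b1, f.B2 * v + f.b2)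

/-- the equivalence relation generated by all moves -/
def EM {ι : Type*} (f : ι → Mv) : ℤ × ℤ → ℤ × ℤ → Prop :=
  Relation.EqvGen (fun p q => ∃ i, (f i).rel p q)

section Sat
variable {H : Type*} [Group H] {ι : Type*}

/-- the conjugate of `t` at position `z` -/
def tt (x y t : H) (z : ℤ × ℤ) : H := x ^ z.1 * y ^ z.2 * t * (x ^ z.1 * y ^ z.2)⁻¹

/-- the defining relations -/
structure Sat (f : ι → Mv) (x y t k : H) (r : ι → H) : Prop where
  xy : x * y = y * x
  kt : k * t = t * k
  kr : ∀ i, k * r i = r i * k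
  rx : ∀ i, r i * x ^ (f i).A1 * (r i)⁻¹ = x ^ (f i).B1
  ry : ∀ i, r i * y ^ (f i).A2 * (r i)⁻¹ = y ^ (f i).B2
  rt : ∀ i, r i * tt x y t ((f i).a1, (f i).a2) * (r i)⁻¹ = tt x y t ((f i).b1, (f i).b2)

theorem tt_add {x y t : H} (hxy : x * y = y * x) (p q a b : ℤ) :
    tt x y t (p + a, q + b) = x ^ p * y ^ q * tt x y t (a, b) * (x ^ p * y ^ q)⁻¹ := by
  have h : x ^ a * y ^ q = y ^ q * x ^ a := (Commute.zpow_zpow (show Commute x y from hxy) a q)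
  have e : x ^ (p + a) * y ^ (q + b) = x ^ p * y ^ q * (x ^ a * y ^ b) := by
    rw [zpow_add, zpow_add, mul_assoc, ← mul_assoc (x ^ a), h]
    simp only [mul_assoc]
  simp only [tt]
  rw [e]; group

theorem Sat.conj_tt {f : ι → Mv} {x y t k : H} {r : ι → H} (S : Sat f x y t k r) (i : ι)
    {p q : ℤ × ℤ} (h : (f i).rel p q) : r i * tt x y t p * (r i)⁻¹ = tt x y t q := by
  obtain ⟨u, v, rfl, rfl⟩ := h
  rw [tt_add S.xy, tt_add S.xy, ← S.rt i]
  have hx : r i * x ^ ((f i).A1 * u : ℤ) * (r i)⁻¹ = x ^ ((f i).B1 * u : ℤ) := by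
    rw [zpow_mul, zpow_mul, zpow_natCast, zpow_natCast, ← S.rx i, conj_zpow]
  have hy : r i * y ^ ((f i).A2 * v : ℤ) * (r i)⁻¹ = y ^ ((f i).B2 * v : ℤ) := by
    rw [zpow_mul, zpow_mul, zpow_natCast, zpow_natCast, ← S.ry i, conj_zpow]
  rw [← hx, ← hy]
  group

theorem Sat.commute_of_EM {f : ι → Mv} {x y t k : H} {r : ι → H} (S : Sat f x y t k r)
    {z : ℤ × ℤ} (h : EM f z (0, 0)) : Commute k (tt x y t z) := by
  have key : ∀ p q, EM f p q → (Commute k (tt x y t p) ↔ Commute k (tt x y t q)) := by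
    intro p q h
    induction h with
    | rel p q h =>
      obtain ⟨i, h⟩ := h
      rw [← S.conj_tt i h]
      have hk : r i * k * (r i)⁻¹ = k := by rw [← S.kr i]; group
      constructor
      · intro hc
        have := (Commute.conj_iff (r i)).2 hc
        rwa [hk] at this
      · intro hc
        rw [← hk] at hc
        exact (Commute.conj_iff (r i)).1 hc
    | refl => rfl
    | symm _ _ _ ih => exact ih.symm
    | trans _ _ _ _ _ ih1 ih2 => exact ih1.trans ih2
  rw [key _ _ h]
  have h0 : Commute k t := S.kt
  simpa [tt] using h0

end Sat

/-! #### the concrete permutation model -/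

/-- labels -/
abbrev Kap := Set (ℤ × ℤ)
/-- sheets -/
abbrev Jt := Kap × Kap
/-- points -/
abbrev Om := ℤ × ℤ × Jt
/-- points with colour -/
abbrev Xm := Om × Fin 3

/-- pattern of a residue class in a set -/
def pat (A1 A2 : ℕ) (c : Fin A1 × Fin A2 × Jt) : Kap :=
  {w | ((A1 * w.1 + (c.1 : ℕ) : ℤ), (A2 * w.2 + (c.2.1 : ℕ) : ℤ)) ∈ c.2.2.1}

theorem pat_fiber (A1 A2 : ℕ) (a1 : Fin A1) (a2 : Fin A2) (S : Kap) :
    Cardinal.mk {c // pat A1 A2 c = S} = Cardinal.mk Kap := by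
  apply le_antisymm
  · refine (Cardinal.mk_subtype_le _).trans ?_
    have hinf : Cardinal.aleph0 ≤ Cardinal.mk Kap := Cardinal.infinite_iff.1 inferInstance
    simp only [Cardinal.mk_prod, Cardinal.lift_id, Cardinal.mk_fin]
    rw [Cardinal.mul_eq_self hinf]
    have h1 : ∀ n : ℕ, (n : Cardinal) ≤ Cardinal.mk Kap := fun n =>
      (Cardinal.natCast_le_aleph0).trans hinf
    exact Cardinal.mul_le_of_le hinf (h1 _) (Cardinal.mul_le_of_le hinf (h1 _) le_rfl)
  · have hA1 : (A1 : ℤ) ≠ 0 := by have := a1.2; omega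
    have hA2 : (A2 : ℤ) ≠ 0 := by have := a2.2; omega
    refine Cardinal.mk_le_of_injective (f := fun l => ⟨(a1, a2,
      ((fun w : ℤ × ℤ => ((A1 * w.1 + (a1 : ℕ) : ℤ), (A2 * w.2 + (a2 : ℕ) : ℤ))) '' S, l)), ?_⟩) ?_
    · have hinj : Function.Injective
        (fun w : ℤ × ℤ => ((A1 * w.1 + (a1 : ℕ) : ℤ), (A2 * w.2 + (a2 : ℕ) : ℤ))) := by
        rintro ⟨u, v⟩ ⟨u', v'⟩ h
        simp only [Prod.mk.injEq, add_left_inj, mul_eq_mul_left_iff, hA1, hA2, or_false] at h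
        exact Prod.ext h.1 h.2
      ext w
      exact hinj.mem_set_image
    · intro l l' h
      simpa using h

theorem exists_sigma {P Q κ : Type} (p : P → κ) (q : Q → κ)
    (h : ∀ s, Cardinal.mk {c // p c = s} = Cardinal.mk {c // q c = s}) (P0 : P) (Q0 : Q)
    (h0 : p P0 = q Q0) : ∃ σ : P ≃ Q, (∀ c, q (σ c) = p c) ∧ σ P0 = Q0 := by
  classical
  have e : ∀ s, {c // p c = s} ≃ {c // q c = s} := fun s => Classical.choice (Cardinal.eq.1 (h s))
  let τ : P ≃ Q := (Equiv.sigmaFiberEquiv p).symm.trans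
    ((Equiv.sigmaCongrRight fun s => (e s)).trans (Equiv.sigmaFiberEquiv q))
  have hτ : ∀ c, q (τ c) = p c := fun c => (e (p c) ⟨c, rfl⟩).2
  refine ⟨τ.trans (Equiv.swap (τ P0) Q0), fun c => ?_, by simp⟩
  rw [← hτ c, Equiv.trans_apply]
  by_cases h1 : τ c = τ P0
  · rw [h1, Equiv.swap_apply_left, hτ, h0]
  by_cases h2 : τ c = Q0
  · rw [h2, Equiv.swap_apply_right, hτ, h0]
  · rw [Equiv.swap_apply_of_ne_of_ne h1 h2]

/-- residue coordinates -/
noncomputable def coordE (A1 A2 : ℕ) [NeZero A1] [NeZero A2] :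
    (ℤ × ℤ) × (Fin A1 × Fin A2 × Jt) ≃ Om :=
  Equiv.ofBijective (fun p => ((A1 * p.1.1 + (p.2.1 : ℕ) : ℤ), (A2 * p.1.2 + (p.2.2.1 : ℕ) : ℤ),
    p.2.2.2)) (by
    constructor
    · rintro ⟨⟨u, v⟩, c1, c2, j⟩ ⟨⟨u', v'⟩, c1', c2', j'⟩ h
      simp only [Prod.mk.injEq] at h
      obtain ⟨h1, h2, rfl⟩ := h
      have e1 := (Int.divModEquiv A1).symm.injective (a₁ := (u, c1)) (a₂ := (u', c1'))
        (by simpa [Int.divModEquiv, mul_comm] using h1)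
      have e2 := (Int.divModEquiv A2).symm.injective (a₁ := (v, c2)) (a₂ := (v', c2'))
        (by simpa [Int.divModEquiv, mul_comm] using h2)
      simp only [Prod.mk.injEq] at e1 e2
      obtain ⟨rfl, rfl⟩ := e1
      obtain ⟨rfl, rfl⟩ := e2
      rfl
    · rintro ⟨a, b, j⟩
      obtain ⟨⟨u, c1⟩, h1⟩ := (Int.divModEquiv A1).symm.surjective a
      obtain ⟨⟨v, c2⟩, h2⟩ := (Int.divModEquiv A2).symm.surjective b
      refine ⟨((u, v), c1, c2, j), ?_⟩
      simp only [Prod.mk.injEq, and_true]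
      rw [← h1, ← h2]
      simp [Int.divModEquiv, mul_comm])

theorem coordE_apply (A1 A2 : ℕ) [NeZero A1] [NeZero A2] (p : ℤ × ℤ) (c : Fin A1 × Fin A2 × Jt) :
    coordE A1 A2 (p, c) = ((A1 * p.1 + (c.1 : ℕ) : ℤ), (A2 * p.2 + (c.2.1 : ℕ) : ℤ), c.2.2) := rfl

/-- a point is invisible to `k` -/
def Inv (ω : Om) : Prop := (ω.1, ω.2.1) ∈ ω.2.2.1

theorem exists_rho (f : Mv) (I : Kap)
    (hI : ∀ p q, f.rel p q → (p ∈ I ↔ q ∈ I)) : ∃ ρ : Om ≃ Om,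
    (∀ ω, Inv (ρ ω) ↔ Inv ω) ∧
    (∀ a b j, ∃ a' b' j', ρ (a, b, j) = (a', b', j') ∧
      ρ (a + f.A1, b, j) = (a' + f.B1, b', j') ∧
      ρ (a, b + f.A2, j) = (a', b' + f.B2, j')) ∧
    ρ ((f.a1 : ℤ), (f.a2 : ℤ), (I, ∅)) = ((f.b1 : ℤ), (f.b2 : ℤ), (I, ∅)) := by
  obtain ⟨A1, a1, A2, a2, B1, b1, B2, b2, hA1, hA2, hB1, hB2⟩ := f
  have : NeZero A1 := ⟨by omega⟩
  have : NeZero A2 := ⟨by omega⟩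
  have : NeZero B1 := ⟨by omega⟩
  have : NeZero B2 := ⟨by omega⟩
  obtain ⟨σ, hσ, hσ0⟩ := exists_sigma (pat A1 A2) (pat B1 B2)
    (fun s => (pat_fiber A1 A2 ⟨a1, hA1⟩ ⟨a2, hA2⟩ s).trans
      (pat_fiber B1 B2 ⟨b1, hB1⟩ ⟨b2, hB2⟩ s).symm)
    (⟨a1, hA1⟩, ⟨a2, hA2⟩, (I, ∅)) (⟨b1, hB1⟩, ⟨b2, hB2⟩, (I, ∅)) (by
      ext ⟨u, v⟩
      exact hI _ _ ⟨u, v, rfl, rfl⟩)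
  let ρ : Om ≃ Om := (coordE A1 A2).symm.trans
    ((Equiv.prodCongr (Equiv.refl _) σ).trans (coordE B1 B2))
  have hρ : ∀ p c, ρ (coordE A1 A2 (p, c)) = coordE B1 B2 (p, σ c) := by
    intro p c; simp [ρ]
  have hpat : ∀ (C1 C2 : ℕ) [NeZero C1] [NeZero C2] p (c : Fin C1 × Fin C2 × Jt),
      Inv (coordE C1 C2 (p, c)) ↔ p ∈ pat C1 C2 c := by
    intros; rfl
  refine ⟨ρ, ?_, ?_, ?_⟩
  · intro ω
    obtain ⟨⟨p, c⟩, rfl⟩ := (coordE A1 A2).surjective ω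
    rw [hρ, hpat, hpat, hσ]
  · intro a b j
    obtain ⟨⟨⟨u, v⟩, c⟩, h⟩ := (coordE A1 A2).surjective (a, b, j)
    rw [coordE_apply] at h
    simp only [Prod.mk.injEq] at h
    obtain ⟨rfl, rfl, rfl⟩ := h
    have h0 := hρ (u, v) c
    have h1 := hρ (u + 1, v) c
    have h2 := hρ (u, v + 1) c
    simp only [coordE_apply] at h0 h1 h2
    refine ⟨_, _, _, h0, ?_, ?_⟩
    · convert h1 using 2
      · simp only [Prod.mk.injEq, and_true]; ring
      · ring
    · convert h2 using 2
      · simp only [Prod.mk.injEq, and_true, true_and]; ring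
      · simp only [Prod.mk.injEq, and_true]; ring
  · have := hρ (0, 0) (⟨a1, hA1⟩, ⟨a2, hA2⟩, (I, ∅))
    rw [hσ0] at this
    simpa only [coordE_apply, mul_zero, zero_add] using this

/-- shift in the first coordinate -/
def shX (n : ℤ) : Equiv.Perm Xm where
  toFun p := ((p.1.1 + n, p.1.2), p.2)
  invFun p := ((p.1.1 - n, p.1.2), p.2)
  left_inv p := by simp
  right_inv p := by simp

/-- shift in the second coordinate -/
def shY (n : ℤ) : Equiv.Perm Xm where
  toFun p := ((p.1.1, p.1.2.1 + n, p.1.2.2), p.2)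
  invFun p := ((p.1.1, p.1.2.1 - n, p.1.2.2), p.2)
  left_inv p := by simp
  right_inv p := by simp

theorem zpow_of_add {H : Type*} [Group H] (s : ℤ → H) (h : ∀ a b, s (a + b) = s a * s b) (n : ℤ) :
    s 1 ^ n = s n := by
  let φ : Multiplicative ℤ →* H := MonoidHom.mk' (fun a => s a.toAdd) (fun a b => h _ _)
  have := map_zpow φ (Multiplicative.ofAdd 1) n
  rw [← ofAdd_zsmul] at this
  simpa [φ] using this.symm

theorem shX_zpow (n : ℤ) : shX 1 ^ n = shX n :=
  zpow_of_add shX (fun a b => by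
    ext1 p; simp only [shX, Equiv.Perm.mul_apply, Equiv.coe_fn_mk]
    rw [add_assoc, add_comm b]) n

theorem shY_zpow (n : ℤ) : shY 1 ^ n = shY n :=
  zpow_of_add shY (fun a b => by
    ext1 p; simp only [shY, Equiv.Perm.mul_apply, Equiv.coe_fn_mk]
    rw [add_assoc, add_comm b]) n

open Classical in
/-- the permutation `k` -/
noncomputable def kPerm : Equiv.Perm Xm :=
  Function.Involutive.toPerm
    (fun p => if Inv p.1 then p else (p.1, Equiv.swap (1 : Fin 3) 2 p.2)) (by
      intro p
      by_cases h : Inv p.1 <;> simp [h])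

theorem kPerm_of_inv {p : Xm} (h : Inv p.1) : kPerm p = p :=
  if_pos h

theorem kPerm_of_not_inv {p : Xm} (h : ¬ Inv p.1) :
    kPerm p = (p.1, Equiv.swap (1 : Fin 3) 2 p.2) :=
  if_neg h

open Classical in
theorem exists_model {ι : Type} (f : ι → Mv) : ∃ (x y t k : Equiv.Perm Xm)
    (r : ι → Equiv.Perm Xm), Sat f x y t k r ∧
      ∀ z, ¬ EM f z (0, 0) → ¬ Commute k (tt x y t z) := by
  let I : Kap := {z | EM f z (0, 0)}
  have hI : ∀ i p q, (f i).rel p q → (p ∈ I ↔ q ∈ I) := by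
    intro i p q h
    have h' : EM f p q := Relation.EqvGen.rel _ _ ⟨i, h⟩
    exact ⟨fun hp => (h'.symm _ _).trans _ _ _ hp, fun hq => h'.trans _ _ _ hq⟩
  choose ρ hρ1 hρ2 hρ3 using fun i => exists_rho (f i) I (hI i)
  let t : Equiv.Perm Xm := Equiv.swap ((0, 0, (I, ∅)), 0) ((0, 0, (I, ∅)), 1)
  have htt : ∀ z : ℤ × ℤ, tt (shX 1) (shY 1) t z =
      Equiv.swap ((z.1, z.2, (I, ∅)), 0) ((z.1, z.2, (I, ∅)), 1) := by
    intro z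
    rw [tt, ← Equiv.swap_apply_apply, shX_zpow, shY_zpow]
    simp [shX, shY]
  refine ⟨shX 1, shY 1, t, kPerm, fun i => Equiv.prodCongr (ρ i) (Equiv.refl _), ⟨?_, ?_, ?_, ?_, ?_, ?_⟩,
    ?_⟩
  · ext1 p; simp [shX, shY]
  · have h0 : (0, 0) ∈ I := Relation.EqvGen.refl _
    have : kPerm * t * kPerm⁻¹ = t := by
      rw [← Equiv.swap_apply_apply, kPerm_of_inv (by exact h0), kPerm_of_inv (by exact h0)]
    rw [mul_inv_eq_iff_eq_mul] at this
    exact this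
  · intro i
    ext1 ⟨ω, c⟩
    simp only [Equiv.Perm.mul_apply, Equiv.prodCongr_apply, Prod.map_apply, Equiv.refl_apply]
    by_cases h : Inv ω
    · rw [kPerm_of_inv (by exact (hρ1 i ω).2 h), kPerm_of_inv (by exact h)]
      rfl
    · rw [kPerm_of_not_inv (by exact (hρ1 i ω).not.2 h), kPerm_of_not_inv (by exact h)]
      rfl
  · intro i
    rw [mul_inv_eq_iff_eq_mul, ← zpow_natCast, ← zpow_natCast, shX_zpow, shX_zpow]
    ext1 ⟨⟨a, b, j⟩, c⟩
    obtain ⟨a', b', j', h0, h1, h2⟩ := hρ2 i a b j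
    simp [shX, h0, h1]
  · intro i
    rw [mul_inv_eq_iff_eq_mul, ← zpow_natCast, ← zpow_natCast, shY_zpow, shY_zpow]
    ext1 ⟨⟨a, b, j⟩, c⟩
    obtain ⟨a', b', j', h0, h1, h2⟩ := hρ2 i a b j
    simp [shY, h0, h2]
  · intro i
    rw [htt, htt, ← Equiv.swap_apply_apply]
    simp [hρ3]
  · intro z hz hc
    have hni : ¬ Inv (z.1, z.2, (I, ∅)) := hz
    rw [htt] at hc
    have := congrArg (fun e : Equiv.Perm Xm => e ((z.1, z.2, (I, ∅)), 0)) hc.eq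
    simp only [Equiv.Perm.mul_apply, Equiv.swap_apply_left] at this
    rw [kPerm_of_not_inv (by exact hni), kPerm_of_not_inv (by exact hni)] at this
    have e0 : Equiv.swap (1 : Fin 3) 2 0 = 0 := by decide
    simp only [Equiv.swap_apply_left, e0] at this
    simp at this

end GroupPart

section Presentation
variable {n : ℕ}

/-- generator numbering -/
def gx (n : ℕ) : Fin (4 + n) := finSumFinEquiv (Sum.inl 0)
/-- generator numbering -/
def gy (n : ℕ) : Fin (4 + n) := finSumFinEquiv (Sum.inl 1)
/-- generator numbering -/
def gt (n : ℕ) : Fin (4 + n) := finSumFinEquiv (Sum.inl 2)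
/-- generator numbering -/
def gk (n : ℕ) : Fin (4 + n) := finSumFinEquiv (Sum.inl 3)
/-- generator numbering -/
def gr (i : Fin n) : Fin (4 + n) := finSumFinEquiv (Sum.inr i)

/-- the relators, as elements of the free group -/
def relsF (f : Fin n → Mv) : Set (FreeGroup (Fin (4 + n))) :=
  let x := FreeGroup.of (gx n)
  let y := FreeGroup.of (gy n)
  let t := FreeGroup.of (gt n)
  let k := FreeGroup.of (gk n)
  let r := fun i : Fin n => FreeGroup.of (gr i)
  {x * y * (y * x)⁻¹, k * t * (t * k)⁻¹} ∪ Set.range (fun i => k * r i * (r i * k)⁻¹) ∪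
  Set.range (fun i => r i * x ^ (f i).A1 * (r i)⁻¹ * (x ^ (f i).B1)⁻¹) ∪
  Set.range (fun i => r i * y ^ (f i).A2 * (r i)⁻¹ * (y ^ (f i).B2)⁻¹) ∪
  Set.range (fun i => r i * tt x y t ((f i).a1, (f i).a2) * (r i)⁻¹ *
    (tt x y t ((f i).b1, (f i).b2))⁻¹)

theorem relsF_finite (f : Fin n → Mv) : (relsF f).Finite := by
  unfold relsF
  refine ((((Set.toFinite _).union (Set.finite_range _)).union (Set.finite_range _)).union
    (Set.finite_range _)).union (Set.finite_range _)

theorem map_tt {H K : Type*} [Group H] [Group K] (φ : H →* K) (x y t : H) (z : ℤ × ℤ) :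
    φ (tt x y t z) = tt (φ x) (φ y) (φ t) z := by
  simp [tt]

theorem sat_iff {K : Type*} [Group K] (f : Fin n → Mv) (φ : FreeGroup (Fin (4 + n)) →* K) :
    (∀ g ∈ relsF f, φ g = 1) ↔ Sat f (φ (FreeGroup.of (gx n))) (φ (FreeGroup.of (gy n)))
      (φ (FreeGroup.of (gt n))) (φ (FreeGroup.of (gk n)))
      (fun i => φ (FreeGroup.of (gr i))) := by
  have e : ∀ a b : FreeGroup (Fin (4 + n)), φ (a * b⁻¹) = 1 ↔ φ a = φ b := by
    intro a b; rw [map_mul, map_inv, mul_inv_eq_one]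
  constructor
  · intro h
    refine ⟨?_, ?_, fun i => ?_, fun i => ?_, fun i => ?_, fun i => ?_⟩
    · have := (e _ _).1 (h (FreeGroup.of (gx n) * FreeGroup.of (gy n) *
        (FreeGroup.of (gy n) * FreeGroup.of (gx n))⁻¹) (by simp [relsF]))
      simpa using this
    · have := (e _ _).1 (h (FreeGroup.of (gk n) * FreeGroup.of (gt n) *
        (FreeGroup.of (gt n) * FreeGroup.of (gk n))⁻¹) (by simp [relsF]))
      simpa using this
    · have := (e _ _).1 (h _ (Or.inl (Or.inl (Or.inl (Or.inr ⟨i, rfl⟩)))))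
      simpa using this
    · have := (e _ _).1 (h _ (Or.inl (Or.inl (Or.inr ⟨i, rfl⟩))))
      simpa using this
    · have := (e _ _).1 (h _ (Or.inl (Or.inr ⟨i, rfl⟩)))
      simpa using this
    · have := (e _ _).1 (h _ (Or.inr ⟨i, rfl⟩))
      simpa [map_tt] using this
  · rintro ⟨h1, h2, h3, h4, h5, h6⟩ g (((((rfl | rfl) | ⟨i, rfl⟩) | ⟨i, rfl⟩) | ⟨i, rfl⟩) | ⟨i, rfl⟩)
    · rw [e]; simpa using h1
    · rw [e]; simpa using h2
    · simp only [e]; simpa using h3 i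
    · simp only [e]; simpa using h4 i
    · simp only [e]; simpa using h5 i
    · simp only [e]; simpa [map_tt] using h6 i

theorem commutator_mem_iff (f : Fin n → Mv) (z : ℤ × ℤ) :
    FreeGroup.of (gk n) * tt (FreeGroup.of (gx n)) (FreeGroup.of (gy n)) (FreeGroup.of (gt n)) z *
      (FreeGroup.of (gk n))⁻¹ *
      (tt (FreeGroup.of (gx n)) (FreeGroup.of (gy n)) (FreeGroup.of (gt n)) z)⁻¹ ∈
        Subgroup.normalClosure (relsF f) ↔ EM f z (0, 0) := by
  constructor
  · intro h
    by_contra hz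
    obtain ⟨x, y, t, k, r, S, hS⟩ := exists_model f
    let φ : FreeGroup (Fin (4 + n)) →* Equiv.Perm Xm :=
      FreeGroup.lift (fun j => Sum.elim ![x, y, t, k] r (finSumFinEquiv.symm j))
    have hx : φ (FreeGroup.of (gx n)) = x := by simp [φ, gx, -finSumFinEquiv_apply_left]
    have hy : φ (FreeGroup.of (gy n)) = y := by simp [φ, gy, -finSumFinEquiv_apply_left]
    have ht : φ (FreeGroup.of (gt n)) = t := by simp [φ, gt, -finSumFinEquiv_apply_left]
    have hk : φ (FreeGroup.of (gk n)) = k := by simp [φ, gk, -finSumFinEquiv_apply_left]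
    have hr : ∀ i, φ (FreeGroup.of (gr i)) = r i := fun i => by
      simp [φ, gr, -finSumFinEquiv_apply_right]
    have hφ := (sat_iff f φ).2 (by simp only [hx, hy, ht, hk, hr]; exact S)
    have hle : Subgroup.normalClosure (relsF f) ≤ φ.ker :=
      Subgroup.normalClosure_le_normal (fun g hg => hφ g hg)
    have h1 : φ _ = 1 := hle h
    simp only [map_mul, map_inv, map_tt, hx, hy, ht, hk] at h1
    apply hS z hz
    rw [mul_inv_eq_one, mul_inv_eq_iff_eq_mul] at h1
    exact h1
  · intro h
    let φ := QuotientGroup.mk' (Subgroup.normalClosure (relsF f))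
    have hφ : ∀ g ∈ relsF f, φ g = 1 := fun g hg =>
      (QuotientGroup.eq_one_iff g).2 (Subgroup.subset_normalClosure hg)
    have hc := ((sat_iff f φ).1 hφ).commute_of_EM h
    refine (QuotientGroup.eq_one_iff (N := Subgroup.normalClosure (relsF f)) _).1 ?_
    change φ _ = 1
    simp only [map_mul, map_inv, map_tt]
    rw [mul_inv_eq_one, mul_inv_eq_iff_eq_mul]
    exact hc

/-- the word for a conjugate of `t^{±1}` -/
def ttW (n : ℕ) (b : Bool) (z : ℕ × ℕ) : Word (4 + n) :=
  List.replicate z.1 (gx n, true) ++ (List.replicate z.2 (gy n, true) ++ ((gt n, b) ::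
    (List.replicate z.2 (gy n, false) ++ List.replicate z.1 (gx n, false))))

/-- the test word -/
def cW (n : ℕ) (z : ℕ × ℕ) : Word (4 + n) :=
  (gk n, true) :: (ttW n true z ++ ((gk n, false) :: ttW n false z))

theorem mk_replicate_true {α : Type*} (a : α) (k : ℕ) :
    FreeGroup.mk (List.replicate k (a, true)) = FreeGroup.of a ^ k := by
  induction k with
  | zero => rfl
  | succ k ih =>
    rw [List.replicate_succ, pow_succ', ← ih]; rfl

theorem mk_replicate_false {α : Type*} (a : α) (k : ℕ) :
    FreeGroup.mk (List.replicate k (a, false)) = (FreeGroup.of a ^ k)⁻¹ := by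
  induction k with
  | zero => rfl
  | succ k ih =>
    rw [List.replicate_succ, pow_succ, mul_inv_rev, ← ih]; rfl

theorem mk_ttW_true (z : ℕ × ℕ) : FreeGroup.mk (ttW n true z) =
    tt (FreeGroup.of (gx n)) (FreeGroup.of (gy n)) (FreeGroup.of (gt n)) (z.1, z.2) := by
  have h : ∀ L, FreeGroup.mk ((gt n, true) :: L) = FreeGroup.of (gt n) * FreeGroup.mk L :=
    fun _ => rfl
  rw [ttW, ← FreeGroup.mul_mk, ← FreeGroup.mul_mk, h, ← FreeGroup.mul_mk, tt]
  simp only [mk_replicate_true, mk_replicate_false, zpow_natCast]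
  group

theorem mk_ttW_false (z : ℕ × ℕ) : FreeGroup.mk (ttW n false z) =
    (tt (FreeGroup.of (gx n)) (FreeGroup.of (gy n)) (FreeGroup.of (gt n)) (z.1, z.2))⁻¹ := by
  have h : ∀ L, FreeGroup.mk ((gt n, false) :: L) = (FreeGroup.of (gt n))⁻¹ * FreeGroup.mk L :=
    fun _ => rfl
  rw [ttW, ← FreeGroup.mul_mk, ← FreeGroup.mul_mk, h, ← FreeGroup.mul_mk, tt]
  simp only [mk_replicate_true, mk_replicate_false, zpow_natCast]
  group

theorem mk_cW (z : ℕ × ℕ) : FreeGroup.mk (cW n z) =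
    FreeGroup.of (gk n) * tt (FreeGroup.of (gx n)) (FreeGroup.of (gy n)) (FreeGroup.of (gt n))
      (z.1, z.2) * (FreeGroup.of (gk n))⁻¹ *
      (tt (FreeGroup.of (gx n)) (FreeGroup.of (gy n)) (FreeGroup.of (gt n)) (z.1, z.2))⁻¹ := by
  have h : ∀ L, FreeGroup.mk ((gk n, true) :: L) = FreeGroup.of (gk n) * FreeGroup.mk L :=
    fun _ => rfl
  have h' : ∀ L, FreeGroup.mk ((gk n, false) :: L) = (FreeGroup.of (gk n))⁻¹ * FreeGroup.mk L :=
    fun _ => rfl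
  rw [cW, h, ← FreeGroup.mul_mk, h', mk_ttW_true, mk_ttW_false]
  group

theorem primrec_replicate {α β : Type*} [Primcodable α] [Primcodable β] (b : β) {g : α → ℕ}
    (hg : Primrec g) : Primrec (fun a => List.replicate (g a) b) := by
  have : Primrec (fun k : ℕ => List.replicate k b) := by
    refine (Primrec.list_map Primrec.list_range (g := fun _ _ => b)
      (Primrec.const b).to₂).of_eq fun k => ?_
    simp
  exact this.comp hg

theorem primrec_ttW (b : Bool) : Primrec (ttW n b) := by
  unfold ttW
  refine Primrec.list_append.comp (primrec_replicate _ Primrec.fst) (Primrec.list_append.comp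
    (primrec_replicate _ Primrec.snd) (Primrec.list_cons.comp (Primrec.const _)
      (Primrec.list_append.comp (primrec_replicate _ Primrec.snd)
        (primrec_replicate _ Primrec.fst))))

theorem primrec_cW : Primrec (cW n) := by
  unfold cW
  exact Primrec.list_cons.comp (Primrec.const _) (Primrec.list_append.comp (primrec_ttW true)
    (Primrec.list_cons.comp (Primrec.const _) (primrec_ttW false)))

/-- the relators as words -/
def relsW (f : Fin n → Mv) : Set (Word (4 + n)) := FreeGroup.toWord '' relsF f

theorem evalW_relsW (f : Fin n → Mv) : evalW '' relsW f = relsF f := by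
  ext g
  simp [relsW, evalW, FreeGroup.mk_toWord]

theorem wp_cW (f : Fin n → Mv) (z : ℕ × ℕ) :
    WP (relsW f) (cW n z) ↔ EM f (z.1, z.2) (0, 0) := by
  unfold WP
  rw [evalW_relsW, evalW, mk_cW]
  exact commutator_mem_iff f _

end Presentation

/-! ### Part M: Turing machines to residue class moves -/

section MovesPart
open Turing StateTransition

theorem EM.of_rel {ι : Type*} {f : ι → Mv} (i : ι) {p q : ℤ × ℤ} (h : (f i).rel p q) : EM f p q :=
  Relation.EqvGen.rel _ _ ⟨i, h⟩

theorem EM.trans' {ι : Type*} {f : ι → Mv} {p q r : ℤ × ℤ} (h : EM f p q) (h' : EM f q r) :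
    EM f p r := Relation.EqvGen.trans _ _ _ h h'

theorem EM.mem_iff {ι : Type*} {f : ι → Mv} {N : ℤ × ℤ → Prop}
    (hN : ∀ i p q, (f i).rel p q → (N p ↔ N q)) {p q : ℤ × ℤ} (h : EM f p q) : N p ↔ N q := by
  induction h with
  | rel p q h => obtain ⟨i, h⟩ := h; exact hN i p q h
  | refl => rfl
  | symm _ _ _ ih => exact ih.symm
  | trans _ _ _ _ _ ih1 ih2 => exact ih1.trans ih2

theorem div_unique {M a a' : ℕ} {u u' : ℤ} (ha : a < M) (ha' : a' < M)
    (h : M * u + a = M * u' + a') : u = u' ∧ a = a' := by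
  have hM : (M : ℤ) ≠ 0 := by omega
  have h1 : (M * u + a : ℤ) % M = a := by
    rw [Int.mul_add_emod_self_left]; exact Int.emod_eq_of_lt (by omega) (by omega)
  have h2 : (M * u' + a' : ℤ) % M = a' := by
    rw [Int.mul_add_emod_self_left]; exact Int.emod_eq_of_lt (by omega) (by omega)
  rw [h, h2] at h1
  have h3 : a = a' := by exact_mod_cast h1.symm
  subst h3
  refine ⟨?_, rfl⟩
  exact mul_left_cancel₀ hM (by linarith)

variable {Γ Λ : Type} [Inhabited Γ] [Inhabited Λ]

/-- numerical data of an encoding -/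
structure Dat (Γ Λ : Type) [Inhabited Γ] (S : Finset Λ) where
  code : Γ → ℕ
  g : ℕ
  s : Λ → Γ → ℕ
  M : ℕ
  code_lt : ∀ a, code a < g
  code_inj : Function.Injective code
  code_def : code default = 0
  s_lt : ∀ q a, s q a < M
  s_pos : ∀ q a, 0 < s q a
  s_inj : ∀ q ∈ S, ∀ q' ∈ S, ∀ a a', s q a = s q' a' → q = q' ∧ a = a'

theorem exists_dat [Finite Γ] (S : Finset Λ) : Nonempty (Dat Γ Λ S) := by
  classical
  have := Fintype.ofFinite Γ
  let e := Fintype.equivFin Γ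
  let e' := Fintype.equivFin ({q // q ∈ S} × Γ)
  refine ⟨{
    code := fun a => Equiv.swap 0 (e default : ℕ) (e a)
    g := Fintype.card Γ
    s := fun q a => if h : q ∈ S then 1 + (e' (⟨q, h⟩, a) : ℕ) else 1
    M := Fintype.card ({q // q ∈ S} × Γ) + 2
    code_lt := ?_
    code_inj := ?_
    code_def := ?_
    s_lt := ?_
    s_pos := ?_
    s_inj := ?_ }⟩
  · intro a
    have h1 := (e a).2
    have h2 := (e default).2
    simp only [Equiv.swap_apply_def]
    split_ifs <;> omega
  · intro a b h
    have := (Equiv.swap 0 (e default : ℕ)).injective h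
    exact e.injective (Fin.ext this)
  · simp
  · intro q a
    split_ifs with h
    · have := (e' (⟨q, h⟩, a)).2
      omega
    · omega
  · intro q a
    split_ifs <;> omega
  · intro q hq q' hq' a a' h
    simp only [hq, hq', dif_pos] at h
    have h1 : e' (⟨q, hq⟩, a) = e' (⟨q', hq'⟩, a') := Fin.ext (by omega)
    have := e'.injective h1
    simpa using this

namespace Dat
variable {S : Finset Λ} (D : Dat Γ Λ S)

/-- encoding of half tapes -/
def enc (L : ListBlank Γ) : ℕ :=
  L.liftOn (fun l => l.foldr (fun a n => D.code a + D.g * n) 0) (by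
    rintro a b ⟨n, rfl⟩
    rw [List.foldr_append]
    congr 1
    induction n with
    | zero => rfl
    | succ n ih => rw [List.replicate_succ, List.foldr_cons, ← ih, D.code_def]; simp)

theorem enc_mk_nil : D.enc (ListBlank.mk []) = 0 := rfl

theorem enc_cons (a : Γ) (L : ListBlank Γ) :
    D.enc (L.cons a) = D.code a + D.g * D.enc L := by
  induction L using ListBlank.induction_on
  rfl

theorem enc_eq (L : ListBlank Γ) : D.enc L = D.code L.head + D.g * D.enc L.tail := by
  conv_lhs => rw [← L.cons_head_tail]
  rw [enc_cons]

/-- encoding of configurations -/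
def encC (q : Λ) (a : Γ) (L R : ListBlank Γ) : ℤ × ℤ :=
  ((D.M * D.enc L + D.s q a : ℤ), (D.enc R : ℤ))

theorem g_pos : 0 < D.g := (Nat.zero_le _).trans_lt (D.code_lt default)
theorem M_pos : 0 < D.M := (Nat.zero_le _).trans_lt (D.s_lt default default)

theorem mg_lt {b c : ℕ} (hb : b < D.g) (hc : c < D.M) : D.M * b + c < D.M * D.g := by
  calc D.M * b + c < D.M * b + D.M := by omega
    _ = D.M * (b + 1) := by ring
    _ ≤ D.M * D.g := Nat.mul_le_mul_left _ hb

/-- write move -/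
def mvW (q : Λ) (a : Γ) (q' : Λ) (a' : Γ) : Mv where
  A1 := D.M
  a1 := D.s q a
  A2 := 1
  a2 := 0
  B1 := D.M
  b1 := D.s q' a'
  B2 := 1
  b2 := 0
  hA1 := D.s_lt _ _
  hA2 := one_pos
  hB1 := D.s_lt _ _
  hB2 := one_pos

/-- right move -/
def mvR (q : Λ) (a : Γ) (q' : Λ) (b : Γ) : Mv where
  A1 := D.M
  a1 := D.s q a
  A2 := D.g
  a2 := D.code b
  B1 := D.M * D.g
  b1 := D.M * D.code a + D.s q' b
  B2 := 1
  b2 := 0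
  hA1 := D.s_lt _ _
  hA2 := D.code_lt _
  hB1 := D.mg_lt (D.code_lt _) (D.s_lt _ _)
  hB2 := one_pos

/-- left move -/
def mvL (q : Λ) (a : Γ) (q' : Λ) (b : Γ) : Mv where
  A1 := D.M * D.g
  a1 := D.M * D.code b + D.s q a
  A2 := 1
  a2 := 0
  B1 := D.M
  b1 := D.s q' b
  B2 := D.g
  b2 := D.code a
  hA1 := D.mg_lt (D.code_lt _) (D.s_lt _ _)
  hA2 := one_pos
  hB1 := D.s_lt _ _
  hB2 := D.code_lt _

/-- halting move -/
def mvH (q : Λ) (a : Γ) : Mv where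
  A1 := D.M
  a1 := D.s q a
  A2 := 1
  a2 := 0
  B1 := D.M
  b1 := 0
  B2 := 1
  b2 := 0
  hA1 := D.s_lt _ _
  hA2 := one_pos
  hB1 := (Nat.zero_le _).trans_lt (D.s_lt q a)
  hB2 := one_pos

/-- cleaning move, left -/
def mvCL (b : Γ) : Mv where
  A1 := D.M * D.g
  a1 := D.M * D.code b + 0
  A2 := 1
  a2 := 0
  B1 := D.M
  b1 := 0
  B2 := 1
  b2 := 0
  hA1 := D.mg_lt (D.code_lt _) D.M_pos
  hA2 := one_pos
  hB1 := D.M_pos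
  hB2 := one_pos

/-- cleaning move, right -/
def mvCR (b : Γ) : Mv where
  A1 := D.M
  a1 := 0
  A2 := D.g
  a2 := D.code b
  B1 := D.M
  b1 := 0
  B2 := 1
  b2 := 0
  hA1 := D.M_pos
  hA2 := D.code_lt _
  hB1 := D.M_pos
  hB2 := one_pos

/-- all moves -/
def mv (T : TM0.Machine Γ Λ) : ({q // q ∈ S} × Γ × Γ) ⊕ (Γ ⊕ Γ) → Mv
  | Sum.inl (q, a, b) =>
    match T q a with
    | none => D.mvH q a
    | some (q', TM0.Stmt.write a') => D.mvW q a q' a'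
    | some (q', TM0.Stmt.move Dir.right) => D.mvR q a q' b
    | some (q', TM0.Stmt.move Dir.left) => D.mvL q a q' b
  | Sum.inr (Sum.inl b) => D.mvCL b
  | Sum.inr (Sum.inr b) => D.mvCR b

/-- does not halt -/
def Nn (T : TM0.Machine Γ Λ) (z : ℤ × ℤ) : Prop := ∃ q a L R, q ∈ S ∧
  ¬ (eval (TM0.step T) ⟨q, ⟨a, L, R⟩⟩).Dom ∧ z = D.encC q a L R

theorem not_nn (T : TM0.Machine Γ Λ) (u v : ℤ) : ¬ D.Nn T (D.M * u, v) := by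
  rintro ⟨q, a, L, R, -, -, h⟩
  simp only [encC, Prod.mk.injEq] at h
  have h1 : (D.M : ℤ) * u + (0 : ℕ) = D.M * (D.enc L : ℤ) + (D.s q a : ℕ) := by
    simpa using h.1
  have := (div_unique D.M_pos (D.s_lt q a) h1).2
  have := D.s_pos q a
  omega

theorem eval_dom_step {T : TM0.Machine Γ Λ} {c c' : TM0.Cfg Γ Λ} (h : TM0.step T c = some c') :
    (eval (TM0.step T) c).Dom ↔ (eval (TM0.step T) c').Dom := by
  rw [reaches_eval (Relation.ReflTransGen.single h)]

theorem eval_dom_none {T : TM0.Machine Γ Λ} {c : TM0.Cfg Γ Λ} (h : TM0.step T c = none) :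
    (eval (TM0.step T) c).Dom := by
  rw [Part.dom_iff_mem]
  exact ⟨c, mem_eval.2 ⟨Relation.ReflTransGen.refl, h⟩⟩

theorem inv_mv (T : TM0.Machine Γ Λ) (hT : TM0.Supports T (S : Set Λ)) :
    ∀ i p q, (D.mv T i).rel p q → (D.Nn T p ↔ D.Nn T q) := by
  have key : ∀ {q q' : Λ} {a a' : Γ} {L : ListBlank Γ} {u : ℤ}, q ∈ S → q' ∈ S →
      (D.M : ℤ) * u + (D.s q a : ℕ) = D.M * (D.enc L : ℤ) + (D.s q' a' : ℕ) →
      u = D.enc L ∧ q = q' ∧ a = a' := by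
    intro q q' a a' L u hq hq' h
    obtain ⟨h1, h2⟩ := div_unique (D.s_lt q a) (D.s_lt q' a') h
    exact ⟨h1, D.s_inj q hq q' hq' a a' h2⟩
  have key2 : ∀ {b : Γ} {L : ListBlank Γ} {u : ℤ}, (D.g : ℤ) * u + (D.code b : ℕ) = D.enc L →
      u = D.enc L.tail ∧ b = L.head := by
    intro b L u h
    rw [D.enc_eq L] at h
    have h' : (D.g : ℤ) * u + (D.code b : ℕ) = D.g * (D.enc L.tail : ℤ) + (D.code L.head : ℕ) := by
      rw [h]; push_cast; ring
    obtain ⟨h1, h2⟩ := div_unique (D.code_lt b) (D.code_lt L.head) h'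
    exact ⟨h1, D.code_inj h2⟩
  have hno : ∀ {p q : ℤ × ℤ}, (∃ u, p.1 = D.M * u) → (∃ u, q.1 = D.M * u) →
      (D.Nn T p ↔ D.Nn T q) := by
    rintro ⟨p1, p2⟩ ⟨q1, q2⟩ ⟨u, rfl⟩ ⟨u', rfl⟩
    exact iff_of_false (D.not_nn T _ _) (D.not_nn T _ _)
  rintro (⟨⟨q, hq⟩, a, b⟩ | b | b) p p' h
  · rcases hTq : T q a with _ | ⟨q', (d | _) | a'⟩
    ·
      have hh : D.mv T (Sum.inl (⟨q, hq⟩, a, b)) = D.mvH q a := by simp only [mv, hTq]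
      rw [hh] at h
      obtain ⟨u, v, rfl, rfl⟩ := h
      refine iff_of_false ?_ ?_
      · rintro ⟨q1, a1, L, R, hq1, hd, h⟩
        simp only [encC, mvH, Prod.mk.injEq] at h
        obtain ⟨-, rfl, rfl⟩ := key hq hq1 h.1
        exact hd (eval_dom_none (by simp [TM0.step, hTq]))
      · have := D.not_nn T u v
        simpa [mvH] using this
    · -- left
      have hh : D.mv T (Sum.inl (⟨q, hq⟩, a, b)) = D.mvL q a q' b := by simp only [mv, hTq]
      have hq' : q' ∈ S := hT.2 hTq hq
      rw [hh] at h
      obtain ⟨u, v, rfl, rfl⟩ := h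
      constructor
      · rintro ⟨q1, a1, L, R, hq1, hd, h⟩
        simp only [encC, mvL, Prod.mk.injEq] at h
        obtain ⟨h1, h2⟩ := h
        obtain ⟨h3, rfl, rfl⟩ := key (u := D.g * u + D.code b) hq hq1
          (by rw [← h1]; push_cast; ring)
        obtain ⟨rfl, rfl⟩ := key2 h3
        refine ⟨q', L.head, L.tail, R.cons a, hq', ?_, ?_⟩
        · rwa [eval_dom_step (c' := ⟨q', ⟨L.head, L.tail, R.cons a⟩⟩)
            (by simp [TM0.step, hTq, Tape.move])] at hd
        · simp only [encC, mvL, enc_cons, Prod.mk.injEq, true_and]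
          rw [Nat.cast_add, Nat.cast_mul, ← h2]; push_cast; ring
      · rintro ⟨q1, a1, L, R, hq1, hd, h⟩
        simp only [encC, mvL, Prod.mk.injEq] at h
        obtain ⟨h1, h2⟩ := h
        obtain ⟨rfl, rfl, rfl⟩ := key hq' hq1 h1
        obtain ⟨rfl, rfl⟩ := key2 h2
        refine ⟨q, R.head, L.cons b, R.tail, hq, ?_, ?_⟩
        · rwa [eval_dom_step (c' := ⟨q', ⟨b, L, R⟩⟩)
            (by simp [TM0.step, hTq, Tape.move])]
        · simp only [encC, mvL, enc_cons, Prod.mk.injEq]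
          push_cast
          constructor <;> ring
    · -- right
      have hh : D.mv T (Sum.inl (⟨q, hq⟩, a, b)) = D.mvR q a q' b := by simp only [mv, hTq]
      have hq' : q' ∈ S := hT.2 hTq hq
      rw [hh] at h
      obtain ⟨u, v, rfl, rfl⟩ := h
      constructor
      · rintro ⟨q1, a1, L, R, hq1, hd, h⟩
        simp only [encC, mvR, Prod.mk.injEq] at h
        obtain ⟨h1, h2⟩ := h
        obtain ⟨rfl, rfl, rfl⟩ := key hq hq1 h1
        obtain ⟨rfl, rfl⟩ := key2 h2
        refine ⟨q', R.head, L.cons a, R.tail, hq', ?_, ?_⟩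
        · rwa [eval_dom_step (c' := ⟨q', ⟨R.head, L.cons a, R.tail⟩⟩)
            (by simp [TM0.step, hTq, Tape.move])] at hd
        · simp only [encC, mvR, enc_cons, Prod.mk.injEq]
          push_cast
          constructor <;> ring
      · rintro ⟨q1, a1, L, R, hq1, hd, h⟩
        simp only [encC, mvR, Prod.mk.injEq] at h
        obtain ⟨h1, h2⟩ := h
        obtain ⟨h3, rfl, rfl⟩ := key (u := D.g * u + D.code a) hq' hq1
          (by rw [← h1]; push_cast; ring)
        obtain ⟨rfl, rfl⟩ := key2 h3
        refine ⟨q, L.head, L.tail, R.cons b, hq, ?_, ?_⟩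
        · rwa [eval_dom_step (c' := ⟨q', ⟨b, L, R⟩⟩)
            (by simp [TM0.step, hTq, Tape.move])]
        · simp only [encC, mvR, enc_cons, Prod.mk.injEq, true_and]
          rw [Nat.cast_add, Nat.cast_mul, ← h2]; push_cast; ring
    · -- write
      have hh : D.mv T (Sum.inl (⟨q, hq⟩, a, b)) = D.mvW q a q' a' := by simp only [mv, hTq]
      have hq' : q' ∈ S := hT.2 hTq hq
      rw [hh] at h
      obtain ⟨u, v, rfl, rfl⟩ := h
      constructor
      · rintro ⟨q1, a1, L, R, hq1, hd, h⟩
        simp only [encC, mvW, Prod.mk.injEq] at h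
        obtain ⟨h1, h2⟩ := h
        obtain ⟨rfl, rfl, rfl⟩ := key hq hq1 h1
        refine ⟨q', a', L, R, hq', ?_, ?_⟩
        · rwa [eval_dom_step (c' := ⟨q', ⟨a', L, R⟩⟩)
            (by simp [TM0.step, hTq, Tape.write])] at hd
        · simp only [encC, mvW, Prod.mk.injEq, true_and]
          exact h2
      · rintro ⟨q1, a1, L, R, hq1, hd, h⟩
        simp only [encC, mvW, Prod.mk.injEq] at h
        obtain ⟨h1, h2⟩ := h
        obtain ⟨rfl, rfl, rfl⟩ := key hq' hq1 h1
        refine ⟨q, a, L, R, hq, ?_, ?_⟩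
        · rwa [eval_dom_step (c' := ⟨q', ⟨a', L, R⟩⟩)
            (by simp [TM0.step, hTq, Tape.write])]
        · simp only [encC, mvW, Prod.mk.injEq, true_and]
          exact h2
  · obtain ⟨u, v, rfl, rfl⟩ := h
    exact hno ⟨D.g * u + D.code b, by simp [mv, mvCL]; ring⟩ ⟨u, by simp [mv, mvCL]⟩
  · obtain ⟨u, v, rfl, rfl⟩ := h
    exact hno ⟨u, by simp [mv, mvCR]⟩ ⟨u, by simp [mv, mvCR]⟩

theorem step_mv (T : TM0.Machine Γ Λ) {c c' : TM0.Cfg Γ Λ} (hq : c.q ∈ S)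
    (h : TM0.step T c = some c') : EM (D.mv T) (D.encC c.q c.Tape.head c.Tape.left c.Tape.right)
      (D.encC c'.q c'.Tape.head c'.Tape.left c'.Tape.right) := by
  obtain ⟨q, a, L, R⟩ := c
  change q ∈ S at hq
  rcases hTq : T q a with _ | ⟨q', (d | _) | a'⟩
  · simp [TM0.step, hTq] at h
  · simp only [TM0.step, hTq, Option.map_some, Option.some.injEq] at h
    subst h
    have hh : D.mv T (Sum.inl (⟨q, hq⟩, a, L.head)) = D.mvL q a q' L.head := by simp only [mv, hTq]
    refine EM.of_rel (Sum.inl (⟨q, hq⟩, a, L.head)) ?_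
    rw [hh]
    refine ⟨D.enc L.tail, D.enc R, ?_, ?_⟩
    · simp only [encC, mvL, D.enc_eq L, Prod.mk.injEq]
      push_cast
      constructor <;> first | trivial | ring
    · simp only [encC, mvL, Tape.move, enc_cons, Prod.mk.injEq]
      push_cast
      constructor <;> first | trivial | ring
  · simp only [TM0.step, hTq, Option.map_some, Option.some.injEq] at h
    subst h
    have hh : D.mv T (Sum.inl (⟨q, hq⟩, a, R.head)) = D.mvR q a q' R.head := by simp only [mv, hTq]
    refine EM.of_rel (Sum.inl (⟨q, hq⟩, a, R.head)) ?_
    rw [hh]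
    refine ⟨D.enc L, D.enc R.tail, ?_, ?_⟩
    · simp only [encC, mvR, D.enc_eq R, Prod.mk.injEq]
      push_cast
      constructor <;> first | trivial | ring
    · simp only [encC, mvR, Tape.move, enc_cons, Prod.mk.injEq]
      push_cast
      constructor <;> first | trivial | ring
  · simp only [TM0.step, hTq, Option.map_some, Option.some.injEq] at h
    subst h
    have hh : D.mv T (Sum.inl (⟨q, hq⟩, a, R.head)) = D.mvW q a q' a' := by simp only [mv, hTq]
    refine EM.of_rel (Sum.inl (⟨q, hq⟩, a, R.head)) ?_
    rw [hh]
    refine ⟨D.enc L, D.enc R, ?_, ?_⟩ <;> simp [encC, mvW, Tape.write]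

theorem clean_mv (T : TM0.Machine Γ Λ) (L R : ListBlank Γ) :
    EM (D.mv T) ((D.M * D.enc L : ℤ), (D.enc R : ℤ)) (0, 0) := by
  have h1 : ∀ l : List Γ, EM (D.mv T) ((D.M * D.enc (ListBlank.mk l) : ℤ), (D.enc R : ℤ))
      (0, (D.enc R : ℤ)) := by
    intro l
    induction l with
    | nil => rw [enc_mk_nil]; simp only [Nat.cast_zero, mul_zero]; exact Relation.EqvGen.refl _
    | cons b l ih =>
      refine EM.trans' (EM.of_rel (Sum.inr (Sum.inl b))
        ⟨D.enc (ListBlank.mk l), D.enc R, ?_, rfl⟩) ?_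
      · rw [← ListBlank.cons_mk, enc_cons]
        simp only [mv, mvCL, Prod.mk.injEq]
        push_cast
        constructor <;> ring
      · simpa [mv, mvCL] using ih
  have h2 : ∀ l : List Γ, EM (D.mv T) (0, (D.enc (ListBlank.mk l) : ℤ)) (0, 0) := by
    intro l
    induction l with
    | nil => exact Relation.EqvGen.refl _
    | cons b l ih =>
      refine EM.trans' (EM.of_rel (Sum.inr (Sum.inr b))
        ⟨0, D.enc (ListBlank.mk l), ?_, rfl⟩) ?_
      · rw [← ListBlank.cons_mk, enc_cons]
        simp only [mv, mvCR, Prod.mk.injEq]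
        push_cast
        constructor <;> ring
      · simpa [mv, mvCR] using ih
  induction L using ListBlank.induction_on with
  | h l =>
    refine (h1 l).trans' ?_
    induction R using ListBlank.induction_on with
    | h l' => exact h2 l'

theorem main_mv (T : TM0.Machine Γ Λ) (hT : TM0.Supports T (S : Set Λ)) (c : TM0.Cfg Γ Λ)
    (hq : c.q ∈ S) :
    EM (D.mv T) (D.encC c.q c.Tape.head c.Tape.left c.Tape.right) (0, 0) ↔
      (eval (TM0.step T) c).Dom := by
  constructor
  · intro h
    by_contra hd
    have := (EM.mem_iff (D.inv_mv T hT) h).1 ⟨_, _, _, _, hq, hd, rfl⟩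
    exact D.not_nn T 0 0 (by simpa using this)
  · intro h
    obtain ⟨b, hb⟩ := Part.dom_iff_mem.1 h
    obtain ⟨hr, hb'⟩ := mem_eval.1 hb
    clear h hb
    induction hr using Relation.ReflTransGen.head_induction_on with
    | refl =>
      obtain ⟨q, a, L, R⟩ := b
      change q ∈ S at hq
      have hTq : T q a = none := by simpa [TM0.step] using hb'
      have hh : D.mv T (Sum.inl (⟨q, hq⟩, a, R.head)) = D.mvH q a := by simp only [mv, hTq]
      refine EM.trans' (EM.of_rel (Sum.inl (⟨q, hq⟩, a, R.head)) (q := ((D.M * D.enc L : ℤ),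
        (D.enc R : ℤ))) ?_) (D.clean_mv T L R)
      rw [hh]
      refine ⟨D.enc L, D.enc R, ?_, ?_⟩ <;> simp [encC, mvH]
    | head h _ ih =>
      exact (D.step_mv T hq h).trans' (ih (TM0.step_supports T hT h hq))

end Dat

theorem EM.reindex {ι : Type*} [Fintype ι] (f : ι → Mv) :
    ∃ (n : ℕ) (f' : Fin n → Mv), ∀ p q, EM f' p q ↔ EM f p q := by
  let e := Fintype.equivFin ι
  refine ⟨_, fun i => f (e.symm i), fun p q => ?_⟩
  unfold EM
  have : (fun p q => ∃ i, (f (e.symm i)).rel p q) = (fun p q => ∃ i, (f i).rel p q) := by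
    ext p q
    exact e.symm.surjective.exists (p := fun i => (f i).rel p q) |>.symm
  rw [this]

end MovesPart

/-! ### Part M2: an undecidable machine -/

section UndecidablePart
open Turing StateTransition

theorem tm0_moves {Γ Λ : Type} [Inhabited Γ] [Inhabited Λ] [Finite Γ] (T : TM0.Machine Γ Λ)
    (S : Finset Λ) (hT : TM0.Supports T (S : Set Λ)) (x y z : Γ)
    (hund : ¬ ComputablePred fun j : ℕ => (TM0.eval T (x :: y :: List.replicate j z)).Dom) :
    ∃ (n : ℕ) (f : Fin n → Mv) (h : ℕ → ℕ × ℕ), Primrec h ∧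
      ¬ ComputablePred fun j : ℕ => EM f (((h j).1 : ℤ), ((h j).2 : ℤ)) (0, 0) := by
  classical
  have : Fintype Γ := Fintype.ofFinite Γ
  obtain ⟨D⟩ := exists_dat (Γ := Γ) S
  obtain ⟨n, f, hf⟩ := EM.reindex (D.mv T)
  refine ⟨n, f, fun j => (D.s default x, D.enc (ListBlank.mk (y :: List.replicate j z))), ?_, ?_⟩
  · have h1 : Primrec fun j : ℕ => D.enc (ListBlank.mk (List.replicate j z)) := by
      refine (Primrec.nat_rec₁ 0 (f := fun _ m => D.code z + D.g * m) ?_).of_eq ?_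
      · exact Primrec.nat_add.comp (Primrec.const _)
          (Primrec.nat_mul.comp (Primrec.const _) Primrec.snd)
      · intro j
        induction j with
        | zero => rfl
        | succ j ih =>
          rw [List.replicate_succ, ← ListBlank.cons_mk, D.enc_cons, ← ih]
    have h2 : Primrec fun j : ℕ => D.enc (ListBlank.mk (y :: List.replicate j z)) := by
      refine (Primrec.nat_add.comp (Primrec.const (D.code y))
          (Primrec.nat_mul.comp (Primrec.const D.g) h1)).of_eq fun j => ?_
      rw [← ListBlank.cons_mk, D.enc_cons]
    exact (Primrec.const _).pair h2
  · refine fun hc => hund (hc.of_eq fun j => ?_)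
    rw [hf]
    have := D.main_mv T hT (TM0.init (x :: y :: List.replicate j z)) hT.1
    refine Iff.trans ?_ this
    refine iff_of_eq ?_
    congr 1
    simp [Dat.encC, TM0.init, Tape.mk₁, Tape.mk₂, Tape.mk', D.enc_mk_nil]

theorem trNat_two_pow (j : ℕ) : PartrecToTM2.trNat (2 ^ j) =
    List.replicate j PartrecToTM2.Γ'.bit0 ++ [PartrecToTM2.Γ'.bit1] := by
  have h : ∀ j : ℕ, ∃ p : PosNum, (((2 ^ j : ℕ) : Num) = Num.pos p) ∧ PartrecToTM2.trPosNum p =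
      List.replicate j PartrecToTM2.Γ'.bit0 ++ [PartrecToTM2.Γ'.bit1] := by
    intro j
    induction j with
    | zero => exact ⟨PosNum.one, by simp; rfl, rfl⟩
    | succ j ih =>
      obtain ⟨p, h1, h2⟩ := ih
      refine ⟨p.bit0, ?_, ?_⟩
      · have : ((2 ^ (j + 1) : ℕ) : Num) = ((2 ^ j : ℕ) : Num) + ((2 ^ j : ℕ) : Num) := by
          rw [← Nat.cast_add]; congr 1; ring
        rw [this, h1, Num.bit0_of_bit0]
        rfl
      · rw [PartrecToTM2.trPosNum, h2, List.replicate_succ, List.cons_append]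
  obtain ⟨p, h1, h2⟩ := h j
  rw [PartrecToTM2.trNat, h1, ← h2]
  rfl

theorem exists_code_und : ∃ c : ToPartrec.Code,
    ¬ ComputablePred fun j : ℕ => (c.eval [2 ^ j]).Dom := by
  let f : ℕ →. ℕ := fun n => (Nat.rfind fun j => Part.some (decide (2 ^ j = n))).bind fun j =>
    Nat.Partrec.Code.eval (Denumerable.ofNat Nat.Partrec.Code j) 0
  have hpow : Primrec₂ fun a b : ℕ => a ^ b := by
    refine (Primrec.nat_rec (f := fun _ : ℕ => 1) (g := fun (a : ℕ) (p : ℕ × ℕ) => p.2 * a)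
      (Primrec.const 1) ?_).of_eq ?_
    · exact Primrec.nat_mul.comp (Primrec.snd.comp Primrec.snd) Primrec.fst
    · intro a b
      induction b with
      | zero => rfl
      | succ b ih => rw [pow_succ, ← ih]
  have hf : Partrec f := by
    refine Partrec.bind (Partrec.rfind ?_) ?_
    · have : Primrec₂ fun n j : ℕ => decide (2 ^ j = n) :=
        (Primrec.eq (α := ℕ)).decide.comp
          (hpow.comp (Primrec.const 2) Primrec.snd) Primrec.fst
      exact this.to_comp.partrec₂
    · exact Nat.Partrec.Code.eval_part.comp
        ((Computable.ofNat Nat.Partrec.Code).comp Computable.snd) (Computable.const 0)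
  obtain ⟨c, hc⟩ := ToPartrec.Code.exists_code (Nat.Partrec'.part_iff₁.2 hf)
  refine ⟨c, fun h => ?_⟩
  have h0 := ComputablePred.halting_problem 0
  apply h0
  have key : ∀ j : ℕ, (c.eval [2 ^ j]).Dom ↔
      (Nat.Partrec.Code.eval (Denumerable.ofNat Nat.Partrec.Code j) 0).Dom := by
    intro j
    have h1 := hc (2 ^ j ::ᵥ List.Vector.nil)
    have h2 : (2 ^ j ::ᵥ List.Vector.nil : List.Vector ℕ 1).1 = [2 ^ j] := rfl
    rw [h2] at h1
    rw [h1]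
    have h3 : (Nat.rfind fun i => Part.some (decide (2 ^ i = 2 ^ j))) = Part.some j := by
      rw [Part.eq_some_iff]
      refine Nat.mem_rfind.2 ?_
      constructor
      · simp
      · intro m hm
        have : (2 : ℕ) ^ m ≠ 2 ^ j := (Nat.pow_lt_pow_right (by norm_num) hm).ne
        simp [this]
    have h4 : f (2 ^ j) = Nat.Partrec.Code.eval (Denumerable.ofNat Nat.Partrec.Code j) 0 := by
      change ((Nat.rfind fun i => Part.some (decide (2 ^ i = 2 ^ j))).bind _) = _
      rw [h3, Part.bind_some]
    change (f (2 ^ j)).Dom ↔ _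
    rw [h4]
  refine ComputablePred.computable_of_manyOneReducible (q := fun j : ℕ => (c.eval [2 ^ j]).Dom)
    ⟨Encodable.encode, Computable.encode, fun a => ?_⟩ h
  have h5 := key (Encodable.encode a)
  rw [Denumerable.ofNat_encode] at h5
  exact h5.symm

theorem finite_stacks : Finite PartrecToTM2.K' := by
  refine Finite.of_surjective (α := Fin 4) ![.main, .rev, .aux, .stack] ?_
  rintro (_ | _ | _ | _)
  · exact ⟨0, rfl⟩
  · exact ⟨1, rfl⟩
  · exact ⟨2, rfl⟩
  · exact ⟨3, rfl⟩

theorem exists_moves : ∃ (n : ℕ) (f : Fin n → Mv) (h : ℕ → ℕ × ℕ), Primrec h ∧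
    ¬ ComputablePred fun j : ℕ => EM f (((h j).1 : ℤ), ((h j).2 : ℤ)) (0, 0) := by
  classical
  obtain ⟨c, hc⟩ := exists_code_und
  let inst : Inhabited PartrecToTM2.Λ' := ⟨PartrecToTM2.trNormal c PartrecToTM2.Cont'.halt⟩
  have := finite_stacks
  have hs2 := PartrecToTM2.tr_supports c PartrecToTM2.Cont'.halt
  have hs1 := TM2to1.tr_supports _ hs2
  have hs0 := TM1to0.tr_supports _ hs1
  have hfin : Finite (TM2to1.Γ' PartrecToTM2.K' fun _ => PartrecToTM2.Γ') := by
    unfold TM2to1.Γ'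
    infer_instance
  let w : PartrecToTM2.Γ' → (PartrecToTM2.K' → Option PartrecToTM2.Γ') := fun a =>
    Function.update (fun _ => none) PartrecToTM2.K'.main (some a)
  refine tm0_moves _ _ hs0 (true, w .cons) (false, w .bit1) (false, w .bit0) fun hh => hc
    (hh.of_eq fun j => ?_)
  have e1 : ((true, w .cons) :: (false, w .bit1) :: List.replicate j (false, w .bit0) :
      List (TM2to1.Γ' PartrecToTM2.K' fun _ => PartrecToTM2.Γ')) =
      TM2to1.trInit PartrecToTM2.K'.main (PartrecToTM2.trList [2 ^ j]) := by
    have e0 : (PartrecToTM2.trList [2 ^ j]).reverse =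
        .cons :: .bit1 :: List.replicate j .bit0 := by
      simp [PartrecToTM2.trList, trNat_two_pow]
    unfold TM2to1.trInit
    rw [e0]
    have e4 : List.replicate j (false, w .bit0) =
        List.map (fun a => (false, w a)) (List.replicate j .bit0) := by
      rw [List.map_replicate]
    exact congrArg (fun l => (true, w .cons) :: (false, w .bit1) :: l) e4
  rw [e1, TM1to0.tr_eval]
  refine (TM2to1.tr_eval_dom PartrecToTM2.tr PartrecToTM2.K'.main
    (PartrecToTM2.trList [2 ^ j])).trans ?_
  have e2 : TM2.init PartrecToTM2.K'.main (PartrecToTM2.trList [2 ^ j]) =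
      PartrecToTM2.init c [2 ^ j] := by
    unfold TM2.init PartrecToTM2.init
    congr 1
    funext k
    cases k <;> rfl
  have e3 := PartrecToTM2.tr_eval c [2 ^ j]
  unfold TM2.eval
  rw [e2, e3]
  rfl

end UndecidablePart

/-- Proposition 1.1(d): there is a finite group presentation for which the bounded and
precise word problems are solvable while the word problem is unsolvable. -/
theorem statement3 :
    ∃ (m : ℕ) (R : Set (Word m)),
      R.Finite ∧
      ComputablePred (fun p : Word m × ℕ => BWP R p.1 p.2) ∧
      ComputablePred (fun p : Word m × ℕ => PWP R p.1 p.2) ∧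
      ¬ ComputablePred (fun w : Word m => WP R w) := by
  obtain ⟨n, f, h, hp, hund⟩ := exists_moves
  have hfin : (relsW f).Finite := (relsF_finite f).image _
  refine ⟨4 + n, relsW f, hfin, computablePred_of_primrec (bwp_primrec hfin),
    computablePred_of_primrec (pwp_primrec hfin), fun hw => hund ?_⟩
  exact ComputablePred.computable_of_manyOneReducible (q := fun w : Word (4 + n) => WP (relsW f) w)
    ⟨fun j => cW n (h j), (primrec_cW.comp hp).to_comp, fun j => (wp_cW f (h j)).symm⟩ hw

end Stmt3
end

section
/- Let κ : {1, 2, 3, ...} → {1, 2, 3, ...} be a function with κ(1) = 1 and image K = κ({1, 2, 3, ...}), and in the free group F(a, b) let R = {a^i : i ≥ 1} ∪ {a^i b^{κ(i)} : i ≥ 1}. Then: (i) the normal closure of R in F(a, b) is all of F(a, b), i.e., the presented group ⟨a, b ∥ R⟩ is trivial; (ii) for every k ≥ 1, the word b^k is a product of at most 2 conjugates of words in R^{±1} if and only if k ∈ K; (iii) for every k ∈ K, b^k is not a product of at most 1 conjugate of a word in R^{±1}, so 2 is the minimal number of conjugates needed. [claims in the proof of Proposition 1.1(a)] -/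
namespace Stmt4

/-- The free group `F(a, b)` on two generators. -/
abbrev F2 := FreeGroup (Fin 2)

/-- The generator `a`. -/
def a : F2 := FreeGroup.of 0

/-- The generator `b`. -/
def b : F2 := FreeGroup.of 1

/-- `g` is a product of exactly `n` conjugates of elements of `R ∪ R⁻¹`. -/
def IsProdConj {G : Type*} [Group G] (R : Set G) (n : ℕ) (g : G) : Prop :=
  ∃ r s : Fin n → G,
    (∀ i, r i ∈ R ∨ (r i)⁻¹ ∈ R) ∧
    g = (List.ofFn fun i => s i * r i * (s i)⁻¹).prod

/-- The relator set `R = {a^i : i ≥ 1} ∪ {a^i b^{κ(i)} : i ≥ 1}`. -/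
def Rjk (κ : ℕ → ℕ) : Set F2 :=
  {x | ∃ i : ℕ, 1 ≤ i ∧ x = a ^ i} ∪ {x | ∃ i : ℕ, 1 ≤ i ∧ x = a ^ i * b ^ κ i}

/-- Exponent sum homomorphism with weights `w` on the generators. -/
def expo (w : Fin 2 → ℤ) : F2 →* Multiplicative ℤ :=
  FreeGroup.lift fun i => Multiplicative.ofAdd (w i)

/-- Exponent sum as an integer. -/
def ex (w : Fin 2 → ℤ) (g : F2) : ℤ := Multiplicative.toAdd (expo w g)

lemma ex_mul (w : Fin 2 → ℤ) (g h : F2) : ex w (g * h) = ex w g + ex w h := by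
  simp [ex]

lemma ex_inv (w : Fin 2 → ℤ) (g : F2) : ex w g⁻¹ = - ex w g := by
  simp [ex]

lemma ex_one (w : Fin 2 → ℤ) : ex w 1 = 0 := by
  simp [ex]

lemma ex_pow (w : Fin 2 → ℤ) (g : F2) (n : ℕ) : ex w (g ^ n) = n * ex w g := by
  simp [ex]

lemma ex_a (w : Fin 2 → ℤ) : ex w a = w 0 := by
  simp [ex, expo, a]

lemma ex_b (w : Fin 2 → ℤ) : ex w b = w 1 := by
  simp [ex, expo, b]

lemma ex_conj (w : Fin 2 → ℤ) (s r : F2) : ex w (s * r * s⁻¹) = ex w r := by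
  simp only [ex_mul, ex_inv]; ring

/-- Exponent sums of a relator or the inverse of one. -/
lemma ex_rel (κ : ℕ → ℕ) (r : F2) (h : r ∈ Rjk κ ∨ r⁻¹ ∈ Rjk κ) :
    ∃ i : ℕ, 1 ≤ i ∧
      ((ex ![1, 0] r = i ∧ (ex ![0, 1] r = 0 ∨ ex ![0, 1] r = κ i)) ∨
       (ex ![1, 0] r = -i ∧ (ex ![0, 1] r = 0 ∨ ex ![0, 1] r = -κ i))) := by
  have key : ∀ x ∈ Rjk κ, ∃ i : ℕ, 1 ≤ i ∧ ex ![1, 0] x = i ∧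
      (ex ![0, 1] x = 0 ∨ ex ![0, 1] x = κ i) := by
    rintro x (⟨i, hi, rfl⟩ | ⟨i, hi, rfl⟩)
    · exact ⟨i, hi, by simp [ex_pow, ex_a], Or.inl (by simp [ex_pow, ex_a])⟩
    · exact ⟨i, hi, by simp [ex_mul, ex_pow, ex_a, ex_b],
        Or.inr (by simp [ex_mul, ex_pow, ex_a, ex_b])⟩
  rcases h with h | h
  · obtain ⟨i, hi, h1, h2⟩ := key _ h
    exact ⟨i, hi, Or.inl ⟨h1, h2⟩⟩
  · obtain ⟨i, hi, h1, h2⟩ := key _ h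
    rw [ex_inv] at h1 h2
    refine ⟨i, hi, Or.inr ⟨by omega, ?_⟩⟩
    omega

lemma not_zero (κ : ℕ → ℕ) (k : ℕ) (hk : 1 ≤ k) : ¬ IsProdConj (Rjk κ) 0 (b ^ k) := by
  rintro ⟨r, s, -, h⟩
  have h2 := congrArg (ex ![0, 1]) h
  simp [ex_pow, ex_b, ex_one] at h2
  omega

lemma not_one (κ : ℕ → ℕ) (k : ℕ) : ¬ IsProdConj (Rjk κ) 1 (b ^ k) := by
  rintro ⟨r, s, hr, h⟩
  have h2 := congrArg (ex ![1, 0]) h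
  simp [ex_pow, ex_b, ex_conj] at h2
  obtain ⟨i, hi, h | h⟩ := ex_rel κ _ (hr 0) <;> omega

lemma of_two (κ : ℕ → ℕ) (k : ℕ) (hk : 1 ≤ k) (h : IsProdConj (Rjk κ) 2 (b ^ k)) :
    ∃ i : ℕ, 1 ≤ i ∧ κ i = k := by
  obtain ⟨r, s, hr, h⟩ := h
  have h1 := congrArg (ex ![1, 0]) h
  have h2 := congrArg (ex ![0, 1]) h
  simp [List.ofFn_succ, ex_pow, ex_b, ex_mul _ (_ * _⁻¹), ex_conj] at h1 h2
  obtain ⟨i, hi, hi'⟩ := ex_rel κ _ (hr 0)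
  obtain ⟨j, hj, hj'⟩ := ex_rel κ _ (hr 1)
  have hij : i = j := by omega
  subst hij
  exact ⟨i, hi, by omega⟩

/-- Claims in the proof of Proposition 1.1(a): for `κ : {1,2,...} → {1,2,...}` with
`κ(1) = 1` and `K = κ({1,2,...})`, the presentation `⟨a, b ∥ R⟩` with
`R = {a^i : i ≥ 1} ∪ {a^i b^{κ(i)} : i ≥ 1}` defines the trivial group; for `k ≥ 1`
the word `b^k` is a product of at most `2` conjugates of words in `R^{±1}` iff `k ∈ K`;
and for `k ∈ K` it is not a product of at most `1` conjugate, so `2` is minimal. -/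
theorem statement4 (κ : ℕ → ℕ) (hκ1 : κ 1 = 1) (hκpos : ∀ i, 1 ≤ i → 1 ≤ κ i) :
    Subgroup.normalClosure (Rjk κ) = ⊤ ∧
    (∀ k : ℕ, 1 ≤ k →
      ((∃ n ≤ 2, IsProdConj (Rjk κ) n (b ^ k)) ↔ ∃ i : ℕ, 1 ≤ i ∧ κ i = k)) ∧
    (∀ k : ℕ, (∃ i : ℕ, 1 ≤ i ∧ κ i = k) → ¬ ∃ n ≤ 1, IsProdConj (Rjk κ) n (b ^ k)) := by
  refine ⟨?_, ?_, ?_⟩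
  · have ha : a ∈ Subgroup.normalClosure (Rjk κ) :=
      Subgroup.subset_normalClosure (Or.inl ⟨1, le_rfl, by simp⟩)
    have hab : a * b ∈ Subgroup.normalClosure (Rjk κ) :=
      Subgroup.subset_normalClosure (Or.inr ⟨1, le_rfl, by simp [hκ1]⟩)
    have hb : b ∈ Subgroup.normalClosure (Rjk κ) := (Subgroup.mul_mem_cancel_left _ ha).1 hab
    rw [eq_top_iff, ← FreeGroup.closure_range_of (Fin 2), Subgroup.closure_le]
    rintro _ ⟨i, rfl⟩
    fin_cases i
    · exact ha
    · exact hb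
  · intro k hk
    constructor
    · rintro ⟨n, hn, h⟩
      interval_cases n
      · exact absurd h (not_zero κ k hk)
      · exact absurd h (not_one κ k)
      · exact of_two κ k hk h
    · rintro ⟨i, hi, rfl⟩
      refine ⟨2, le_rfl, ![(a ^ i)⁻¹, a ^ i * b ^ κ i], ![1, 1], ?_, ?_⟩
      · intro j
        fin_cases j
        · exact Or.inr (Or.inl ⟨i, hi, by simp⟩)
        · exact Or.inl (Or.inr ⟨i, hi, by simp⟩)
      · simp [List.ofFn_succ]
  · rintro k ⟨i, hi, rfl⟩ ⟨n, hn, h⟩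
    interval_cases n
    · exact not_zero κ _ (hκpos i hi) h
    · exact not_one κ _ h

end Stmt4
end

section
/- Let G_2 be given by presentation (1.2). If a word W over A^{±1} is a product of at most n conjugates of words in R_2^{±1} in F(A), then there exist k ≤ min(n, |W|), relators R_1, ..., R_k ∈ R_2 ∪ R_2^{-1}, and elements S_1, ..., S_k ∈ F(A) such that W = S_1R_1S_1^{-1}···S_kR_kS_k^{-1} in F(A) and additionally |R_1| + ... + |R_k| ≤ |W|. [group-theoretic content of Lemma 2.2 combined with Lemma 2.1] -/
namespace Stmt5

/-- Words over the alphabet `A^{±1}` where `A = {a_1, ..., a_m}`. -/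
abbrev Word (m : ℕ) := List (Fin m × Bool)

/-- The image of a word in the free group `F(A)`. -/
def evalW {m : ℕ} (w : Word m) : FreeGroup (Fin m) := FreeGroup.mk w

/-- Exponent sum of a word. -/
def expo {m : ℕ} (s : Word m) : ℤ := (s.map fun x => if x.2 then (1 : ℤ) else -1).sum

theorem expo_append {m : ℕ} (s t : Word m) : expo (s ++ t) = expo s + expo t := by
  simp [expo]

theorem expo_cons {m : ℕ} (x : Fin m × Bool) (t : Word m) :
    expo (x :: t) = (if x.2 then (1 : ℤ) else -1) + expo t := by
  simp [expo]

theorem expo_nil {m : ℕ} : expo ([] : Word m) = 0 := by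
  simp [expo]

/-- Words that can be erased by deleting one-generator blocks, with the number of relators. -/
inductive Good {m : ℕ} (E : Fin m → Set ℕ) : Word m → ℕ → Prop
  | nil : Good E [] 0
  | step (u v s : Word m) (a : Fin m) (l : List ℤ) (k : ℕ)
      (hs : ∀ x ∈ s, x.1 = a) (hl : ∀ z ∈ l, z ≠ 0 ∧ z.natAbs ∈ E a)
      (he : expo s = l.sum) (h : Good E (u ++ v) k) : Good E (u ++ s ++ v) (k + l.length)

theorem split_cons {α : Type*} {A B p q : List α} {x : α} (h : A ++ B = p ++ x :: q) :
    (∃ t, p = A ++ t ∧ B = t ++ x :: q) ∨ (∃ t, A = p ++ x :: t ∧ q = t ++ B) := by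
  rw [List.append_eq_append_iff] at h
  rcases h with ⟨t, h1, h2⟩ | ⟨t, h1, h2⟩
  · exact Or.inl ⟨t, h1, h2⟩
  · cases t with
    | nil => left; exact ⟨[], by simpa using h1.symm, by simpa using h2.symm⟩
    | cons y t =>
      simp only [List.cons_append, List.cons.injEq] at h2
      obtain ⟨rfl, h2⟩ := h2
      exact Or.inr ⟨t, h1, h2⟩

theorem Good.subst {m : ℕ} {E : Fin m → Set ℕ} {w : Word m} {k : ℕ} (h : Good E w k) :
    ∀ (p q t : Word m) (x : Fin m × Bool) (l : List ℤ), w = p ++ x :: q →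
      (∀ y ∈ t, y.1 = x.1) → (∀ z ∈ l, z ≠ 0 ∧ z.natAbs ∈ E x.1) →
      expo t = expo [x] + l.sum → Good E (p ++ t ++ q) (k + l.length) := by
  induction h with
  | nil => intro p q t x l h; simp at h
  | step u v s a l1 k hs hl he h ih =>
    intro p q t x l heq ht hl2 hsum
    rcases split_cons heq with ⟨c, rfl, rfl⟩ | ⟨c, hc, rfl⟩
    · have := ih (u ++ c) q t x l (by simp) ht hl2 hsum
      have := Good.step u (c ++ t ++ q) s a l1 _ hs hl he (by simpa using this)
      convert this using 1
      · simp
      · omega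
    · rcases split_cons hc with ⟨d, rfl, rfl⟩ | ⟨d, rfl, rfl⟩
      · have hx : x.1 = a := hs x (by simp)
        subst hx
        have := Good.step u v (d ++ t ++ c) x.1 (l1 ++ l) k
          (by
            intro y hy
            simp only [List.mem_append] at hy
            rcases hy with (hy | hy) | hy
            · exact hs y (by simp [hy])
            · exact ht y hy
            · exact hs y (by simp [hy]))
          (by
            intro z hz
            rcases List.mem_append.1 hz with hz | hz
            · exact hl z hz
            · exact hl2 z hz)
          (by
            simp only [expo_append, expo_cons, expo_nil, List.sum_append] at *
            omega) h
        convert this using 1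
        · simp
        · simp; omega
      · have := ih p (d ++ v) t x l (by simp) ht hl2 hsum
        have := Good.step (p ++ t ++ d) v s a l1 _ hs hl he (by simpa using this)
        convert this using 1
        · simp
        · omega

theorem Good.delete {m : ℕ} {E : Fin m → Set ℕ} {w : Word m} {k : ℕ} (h : Good E w k) :
    ∀ (p q : Word m) (a : Fin m) (b : Bool), w = p ++ (a, b) :: (a, !b) :: q →
      Good E (p ++ q) k := by
  induction h with
  | nil => intro p q a b h; simp at h
  | step u v s c l k hs hl he h ih =>
    intro p q a b heq
    have hb : expo [(a, b)] + expo [(a, !b)] = 0 := by cases b <;> simp [expo]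
    rcases split_cons heq with ⟨t, rfl, rfl⟩ | ⟨t, hc, hq⟩
    · have := ih (u ++ t) q a b (by simp)
      have := Good.step u (t ++ q) s c l _ hs hl he (by simpa using this)
      simpa using this
    · cases t with
      | nil =>
        -- the first letter ends `u ++ s`, the second one starts `v`
        simp only [List.nil_append] at hq
        subst hq
        rcases split_cons hc with ⟨d, rfl, rfl⟩ | ⟨d, rfl, hd⟩
        · have hx : a = c := hs (a, b) (by simp)
          subst hx
          have := h.subst u q d (a, !b) l rfl (fun y hy => hs y (by simp [hy])) hl
            (by simp only [expo_append] at he; omega)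
          simpa using this
        · have hd' : d = [] ∧ s = [] := by simpa using hd.symm
          obtain ⟨rfl, rfl⟩ := hd'
          have h1 := ih p q a b (by simp)
          have := Good.step p q [] c l _ (by simp) hl he h1
          simpa using this
      | cons y t =>
        simp only [List.cons_append, List.cons.injEq] at hq
        obtain ⟨rfl, rfl⟩ := hq
        rcases split_cons hc with ⟨d, rfl, rfl⟩ | ⟨d, rfl, hd⟩
        · have := Good.step u v (d ++ t) c l k
            (by
              intro y hy
              rcases List.mem_append.1 hy with hy | hy
              · exact hs y (by simp [hy])
              · exact hs y (by simp [hy])) hl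
            (by
              simp only [expo_append, expo_cons, expo_nil] at *
              omega) h
          simpa using this
        · cases d with
          | nil =>
            simp only [List.nil_append] at hd
            subst hd
            have hx : a = c := hs (a, !b) (by simp)
            subst hx
            have := h.subst p v t (a, b) l (by simp) (fun y hy => hs y (by simp [hy])) hl
              (by simp only [expo_cons, expo_nil] at *; omega)
            simpa using this
          | cons y d =>
            simp only [List.cons_append, List.cons.injEq] at hd
            obtain ⟨rfl, rfl⟩ := hd
            have := ih p (d ++ v) a b (by simp)
            have := Good.step (p ++ d) v s c l _ hs hl he (by simpa using this)
            simpa using this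

theorem Good.insert {m : ℕ} {E : Fin m → Set ℕ} {k : ℕ} (p q : Word m) (a : Fin m) (b : Bool)
    (h : Good E (p ++ q) k) : Good E (p ++ (a, b) :: (a, !b) :: q) k := by
  have := Good.step p q [(a, b), (a, !b)] a [] k (by simp) (by simp)
    (by cases b <;> simp [expo]) h
  simpa using this

theorem Good.congr {m : ℕ} {E : Fin m → Set ℕ} {w w' : Word m} {k : ℕ} (h : Good E w k)
    (hw : FreeGroup.mk w = FreeGroup.mk w') : Good E w' k := by
  obtain ⟨c, h1, h2⟩ := FreeGroup.Red.exact.1 hw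
  have hc : Good E c k := by
    clear h2 hw
    induction h1 with
    | refl => exact h
    | tail _ hs ih =>
      cases hs
      exact ih.delete _ _ _ _ rfl
  clear h1 hw h
  induction h2 using Relation.ReflTransGen.head_induction_on with
  | refl => exact hc
  | head hs _ ih =>
    cases hs
    exact ih.insert _ _ _ _

theorem mk_block {m : ℕ} (a : Fin m) (s : Word m) (hs : ∀ x ∈ s, x.1 = a) :
    FreeGroup.mk s = FreeGroup.of a ^ expo s := by
  induction s with
  | nil => simp [expo_nil, FreeGroup.one_eq_mk]
  | cons x s ih =>
    obtain ⟨c, b⟩ := x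
    have hx : c = a := hs (c, b) (by simp)
    subst hx
    have h1 : FreeGroup.mk ((c, b) :: s) = FreeGroup.mk [(c, b)] * FreeGroup.mk s := by
      simp [FreeGroup.mul_mk]
    rw [h1, ih (fun y hy => hs y (by simp [hy])), expo_cons, zpow_add]
    congr 1
    cases b
    · simp [FreeGroup.of, FreeGroup.inv_mk, FreeGroup.invRev]
    · simp [FreeGroup.of]

theorem exists_block {m : ℕ} (a : Fin m) (z : ℤ) :
    ∃ s : Word m, (∀ x ∈ s, x.1 = a) ∧ expo s = z := by
  refine ⟨List.replicate z.natAbs (a, decide (0 ≤ z)), ?_, ?_⟩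
  · intro x hx
    rw [List.eq_of_mem_replicate hx]
  · by_cases hz : 0 ≤ z
    · simp [expo, hz]
    · simp [expo, hz, abs_of_neg (not_le.1 hz)]

theorem natAbs_expo_le {m : ℕ} (s : Word m) : (expo s).natAbs ≤ s.length := by
  induction s with
  | nil => simp [expo_nil]
  | cons x s ih =>
    rw [expo_cons, List.length_cons]
    split <;> omega

/-- Product of conjugates given by a list. -/
def conjProd {m : ℕ} (L : List (Fin m × ℤ × FreeGroup (Fin m))) : FreeGroup (Fin m) :=
  (L.map fun x => x.2.2 * FreeGroup.of x.1 ^ x.2.1 * x.2.2⁻¹).prod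

theorem good_of_list {m : ℕ} {E : Fin m → Set ℕ} (L : List (Fin m × ℤ × FreeGroup (Fin m)))
    (hL : ∀ x ∈ L, x.2.1 ≠ 0 ∧ x.2.1.natAbs ∈ E x.1) (w : Word m)
    (hw : FreeGroup.mk w = conjProd L) : Good E w L.length := by
  induction L generalizing w with
  | nil =>
    refine Good.nil.congr ?_
    rw [hw]; simp [conjProd, FreeGroup.one_eq_mk]
  | cons x L ih =>
    obtain ⟨a, z, g⟩ := x
    obtain ⟨s, hs, hz⟩ := exists_block a z
    have h1 := ih (fun y hy => hL y (by simp [hy]))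
      (g.toWord ++ (g⁻¹.toWord ++ (conjProd L).toWord))
      (by rw [← FreeGroup.mul_mk, ← FreeGroup.mul_mk]; simp only [FreeGroup.mk_toWord]; group)
    have h2 := Good.step _ _ s a [z] _ hs
      (by intro y hy; rw [List.mem_singleton] at hy; subst hy; exact hL (a, y, g) (by simp))
      (by simpa using hz) h1
    refine Good.congr h2 ?_
    rw [hw, ← List.append_assoc]
    simp only [← FreeGroup.mul_mk, FreeGroup.mk_toWord, mk_block a s hs, hz]
    simp [conjProd, mul_assoc]

theorem tighten {E : Set ℕ} (hE : E = {0} ∨ ∃ n : ℕ, 0 < n ∧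
      (E = {n} ∨ E = {k | ∃ t : ℕ, 1 ≤ t ∧ k = t * n})) (l : List ℤ)
    (hl : ∀ z ∈ l, z ≠ 0 ∧ z.natAbs ∈ E) :
    ∃ l' : List ℤ, (∀ z ∈ l', z ≠ 0 ∧ z.natAbs ∈ E) ∧ l'.sum = l.sum ∧ l'.length ≤ l.length ∧
      (l'.map Int.natAbs).sum ≤ l.sum.natAbs := by
  rcases hE with rfl | ⟨n, hn, rfl | rfl⟩
  · cases l with
    | nil => exact ⟨[], by simp⟩
    | cons z l =>
      have := hl z (by simp)
      simp at this
  · have key : ∃ t : ℤ, l.sum = t * n ∧ t.natAbs ≤ l.length := by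
      induction l with
      | nil => exact ⟨0, by simp⟩
      | cons z l ih =>
        obtain ⟨t, h1, h2⟩ := ih (fun y hy => hl y (by simp [hy]))
        have hz := (hl z (by simp)).2
        simp only [Set.mem_singleton_iff] at hz
        rcases Int.natAbs_eq z with h | h
        · refine ⟨t + 1, ?_, ?_⟩
          · rw [List.sum_cons, h1, h, hz]; ring
          · simp only [List.length_cons]; omega
        · refine ⟨t - 1, ?_, ?_⟩
          · rw [List.sum_cons, h1, h, hz]; ring
          · simp only [List.length_cons]; omega
    obtain ⟨t, h1, h2⟩ := key
    refine ⟨List.replicate t.natAbs (t.sign * n), ?_, ?_, by simpa using h2, ?_⟩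
    · intro z hz
      obtain ⟨h3, rfl⟩ := List.mem_replicate.1 hz
      have ht : t ≠ 0 := by simpa using h3
      refine ⟨?_, ?_⟩
      · simp [ht]; omega
      · simp [Int.natAbs_mul, Int.natAbs_sign_of_ne_zero ht]
    · rw [h1, List.sum_replicate, nsmul_eq_mul, ← mul_assoc]
      congr 1
      rw [mul_comm]
      exact Int.sign_mul_natAbs t
    · rw [h1, List.map_replicate, List.sum_replicate, smul_eq_mul, Int.natAbs_mul, Int.natAbs_mul]
      by_cases ht : t = 0
      · simp [ht]
      · simp [Int.natAbs_sign_of_ne_zero ht]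
  · by_cases h0 : l.sum = 0
    · exact ⟨[], by simp [h0]⟩
    · have hd : (n : ℤ) ∣ l.sum := by
        refine List.dvd_sum fun z hz => ?_
        obtain ⟨t, _, h⟩ := (hl z hz).2
        rw [← Int.dvd_natAbs, h]
        exact_mod_cast Dvd.intro_left t rfl
      refine ⟨[l.sum], ?_, by simp, ?_, by simp⟩
      · intro z hz
        rw [List.mem_singleton] at hz
        subst hz
        refine ⟨h0, ?_⟩
        obtain ⟨t, ht⟩ := Int.natCast_dvd.1 hd
        refine ⟨t, ?_, by rw [ht, mul_comm]⟩
        rcases Nat.eq_zero_or_pos t with rfl | h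
        · simp at ht; exact absurd ht h0
        · exact h
      · cases l with
        | nil => simp at h0
        | cons z l => simp

theorem conj_list {m : ℕ} (a : Fin m) (g : FreeGroup (Fin m)) (l : List ℤ) :
    conjProd (l.map fun z => (a, z, g)) = g * FreeGroup.of a ^ l.sum * g⁻¹ := by
  induction l with
  | nil => simp [conjProd]
  | cons z l ih =>
    have : conjProd ((z :: l).map fun z => (a, z, g)) =
        g * FreeGroup.of a ^ z * g⁻¹ * conjProd (l.map fun z => (a, z, g)) := by
      simp [conjProd]
    rw [this, ih, List.sum_cons, zpow_add]
    group

theorem Good.toList {m : ℕ} {E : Fin m → Set ℕ}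
    (hE : ∀ i, E i = {0} ∨ ∃ n : ℕ, 0 < n ∧
      (E i = {n} ∨ E i = {k | ∃ t : ℕ, 1 ≤ t ∧ k = t * n})) {w : Word m} {k : ℕ}
    (h : Good E w k) : ∃ L : List (Fin m × ℤ × FreeGroup (Fin m)),
      (∀ x ∈ L, x.2.1 ≠ 0 ∧ x.2.1.natAbs ∈ E x.1) ∧ FreeGroup.mk w = conjProd L ∧
      L.length ≤ k ∧ (L.map fun x => x.2.1.natAbs).sum ≤ w.length := by
  induction h with
  | nil => exact ⟨[], by simp [conjProd, FreeGroup.one_eq_mk]⟩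
  | step u v s a l k hs hl he h ih =>
    obtain ⟨L, h1, h2, h3, h4⟩ := ih
    obtain ⟨l', g1, g2, g3, g4⟩ := tighten (hE a) l hl
    refine ⟨l'.map (fun z => (a, z, FreeGroup.mk u)) ++ L, ?_, ?_, ?_, ?_⟩
    · intro x hx
      rcases List.mem_append.1 hx with hx | hx
      · obtain ⟨z, hz, rfl⟩ := List.mem_map.1 hx
        exact g1 z hz
      · exact h1 x hx
    · have : conjProd (l'.map (fun z => (a, z, FreeGroup.mk u)) ++ L) =
          conjProd (l'.map (fun z => (a, z, FreeGroup.mk u))) * conjProd L := by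
        simp [conjProd]
      rw [this, conj_list, ← h2, g2, ← he, ← mk_block a s hs]
      simp only [← FreeGroup.mul_mk]
      group
    · simp; omega
    · have := natAbs_expo_le s
      have e : ((l'.map (fun z => (a, z, FreeGroup.mk u))).map
          fun x => x.2.1.natAbs) = l'.map Int.natAbs := by
        simp [Function.comp_def]
      rw [List.map_append, List.sum_append, e]
      simp only [List.length_append] at *
      rw [he] at this
      omega

/-- Lemma 2.2 combined with Lemma 2.1 (group-theoretic content), for the presentation
(1.2) `G_2 = ⟨a_1, ..., a_m ∥ a_i^{k_i} = 1, k_i ∈ E_i⟩`: a relator of `R_2 ∪ R_2⁻¹` is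
`a_j^z` with `z ≠ 0` and `|z| ∈ E_j`, of length `|z|`.  If `W` is a product of at most
`n` conjugates of such relators in `F(A)`, then it is a product of at most
`min(n, |W|)` conjugates of such relators whose total length is at most `|W|`. -/
theorem statement5 (m : ℕ) (E : Fin m → Set ℕ)
    (hE : ∀ i, E i = {0} ∨ ∃ n : ℕ, 0 < n ∧
      (E i = {n} ∨ E i = {k | ∃ t : ℕ, 1 ≤ t ∧ k = t * n}))
    (W : Word m) (n : ℕ)
    (h : ∃ k ≤ n, ∃ (j : Fin k → Fin m) (z : Fin k → ℤ) (s : Fin k → FreeGroup (Fin m)),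
      (∀ i, z i ≠ 0 ∧ (z i).natAbs ∈ E (j i)) ∧
      evalW W = (List.ofFn fun i => s i * FreeGroup.of (j i) ^ z i * (s i)⁻¹).prod) :
    ∃ k ≤ min n W.length,
      ∃ (j : Fin k → Fin m) (z : Fin k → ℤ) (s : Fin k → FreeGroup (Fin m)),
        (∀ i, z i ≠ 0 ∧ (z i).natAbs ∈ E (j i)) ∧
        evalW W = (List.ofFn fun i => s i * FreeGroup.of (j i) ^ z i * (s i)⁻¹).prod ∧
        ∑ i, (z i).natAbs ≤ W.length := by
  obtain ⟨k, hk, j, z, s, hz, hW⟩ := h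
  have hg : Good E W (List.ofFn fun i => (j i, z i, s i)).length := by
    refine good_of_list _ ?_ W ?_
    · intro x hx
      obtain ⟨i, rfl⟩ := (List.mem_ofFn' _ _).1 hx
      exact hz i
    · rw [conjProd, List.map_ofFn]
      exact hW
  obtain ⟨L, h1, h2, h3, h4⟩ := hg.toList hE
  rw [List.length_ofFn] at h3
  have h5 : L.length ≤ (L.map fun x => x.2.1.natAbs).sum := by
    have := List.card_nsmul_le_sum (L.map fun x => x.2.1.natAbs) 1 (by
      intro y hy
      obtain ⟨x, hx, rfl⟩ := List.mem_map.1 hy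
      have := (h1 x hx).1
      omega)
    simpa using this
  refine ⟨L.length, le_min (h3.trans hk) (h5.trans h4), fun i => (L.get i).1,
    fun i => (L.get i).2.1, fun i => (L.get i).2.2, fun i => h1 _ (L.get_mem i), ?_, ?_⟩
  · have e : (List.ofFn fun i => (L.get i).2.2 * FreeGroup.of (L.get i).1 ^ (L.get i).2.1 *
        (L.get i).2.2⁻¹) = L.map fun x => x.2.2 * FreeGroup.of x.1 ^ x.2.1 * x.2.2⁻¹ := by
      conv_rhs => rw [← List.ofFn_get L, List.map_ofFn]
      rfl
    rw [e]
    exact h2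
  · refine le_trans (le_of_eq ?_) h4
    rw [← List.sum_ofFn]
    congr 1
    conv_rhs => rw [← List.ofFn_get L, List.map_ofFn]
    rfl

end Stmt5
end

section
/- Let W be a word over A^{±1} such that W = 1 in the free group F(A) and |W| > 2. Then there exist positions 0 ≤ v_1 < v_2 ≤ |W| such that, writing W ≡ p_1p_2p_3 where p_2 = W(v_1..v_2] is the subword of W occupying letter positions v_1+1, ..., v_2, the subword p_2 satisfies p_2 = 1 in F(A) and min(|p_2|, |p_1| + |p_3|) ≥ |W|/3. [group-theoretic content of Lemma 4.1] -/
namespace Stmt6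

/-- Words over the alphabet `A^{±1}` where `A = {a_1, ..., a_m}`. -/
abbrev Word (m : ℕ) := List (Fin m × Bool)

/-- The image of a word in the free group `F(A)`. -/
def evalW {m : ℕ} (w : Word m) : FreeGroup (Fin m) := FreeGroup.mk w

open FreeGroup in
theorem evalW_iff {m : ℕ} (L : Word m) : evalW L = 1 ↔ Red L [] := by
  unfold evalW
  rw [FreeGroup.one_eq_mk, Red.exact]
  constructor
  · rintro ⟨c, h1, h2⟩
    rw [Red.nil_iff] at h2
    exact h2 ▸ h1
  · intro h
    exact ⟨[], h, Relation.ReflTransGen.refl⟩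

open FreeGroup in
theorem split_word {m : ℕ} (L : Word m) (h : Red L []) : L ≠ [] →
    (∃ X Y : Word m, X ≠ [] ∧ Y ≠ [] ∧ L = X ++ Y ∧ Red X [] ∧ Red Y []) ∨
    (∃ (x y : Fin m × Bool) (U : Word m), L = [x] ++ U ++ [y] ∧ Red U []) := by
  induction h using Relation.ReflTransGen.head_induction_on with
  | refl => intro h; exact absurd rfl h
  | head h h' ih =>
    intro _
    cases h with
    | @not A B x b =>
    have key : ∀ P Q : Word m, Red (P ++ Q) [] → Red (P ++ (x, b) :: (x, !b) :: Q) [] :=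
      fun P Q hr => Relation.ReflTransGen.head Red.Step.not hr
    rcases A with _ | ⟨a, A⟩
    · rcases B with _ | ⟨c, B⟩
      · right
        exact ⟨(x, b), (x, !b), [], by simp, Relation.ReflTransGen.refl⟩
      · left
        exact ⟨[(x, b), (x, !b)], c :: B, by simp, by simp, by simp,
          key [] [] Relation.ReflTransGen.refl, h'⟩
    · rcases List.eq_nil_or_concat B with rfl | ⟨B, c, rfl⟩
      · left
        exact ⟨a :: A, [(x, b), (x, !b)], by simp, by simp, by simp,
          by rw [List.append_nil] at h'; exact h',
          key [] [] Relation.ReflTransGen.refl⟩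
      · rcases ih (by simp) with ⟨X, Y, hX, hY, e, rX, rY⟩ | ⟨y, z, U, e, rU⟩
        · left
          rcases List.append_eq_append_iff.1 e with ⟨T, e1, e2⟩ | ⟨T, e1, e2⟩
          · refine ⟨(a :: A) ++ (x, b) :: (x, !b) :: T, Y, by simp, hY, ?_, ?_, rY⟩
            · rw [e2]; simp
            · apply key; rw [← e1]; exact rX
          · refine ⟨X, T ++ (x, b) :: (x, !b) :: (B ++ [c]), hX, by simp, ?_, rX, ?_⟩
            · rw [e1]; simp
            · apply key; rw [← List.concat_eq_append, ← e2]; exact rY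
        · right
          have e' : (a :: (A ++ B)) ++ [c] = (y :: U) ++ [z] := by simpa using e
          obtain ⟨e1, e2⟩ := List.append_inj' e' rfl
          obtain ⟨rfl, rfl⟩ := List.cons.inj e1
          exact ⟨a, c, A ++ (x, b) :: (x, !b) :: B, by simp, key _ _ rU⟩

open FreeGroup in
theorem find_sub {m : ℕ} (W : Word m) (h2 : 2 < W.length)
    (hev : Even W.length) (d : ℕ) :
    ∀ p q r : Word m, q.length = d → W = p ++ q ++ r → Red q [] → W.length ≤ 3 * q.length →
    ∃ p q r : Word m, W = p ++ q ++ r ∧ Red q [] ∧ W.length ≤ 3 * q.length ∧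
      3 * q.length ≤ 2 * W.length := by
  induction d using Nat.strong_induction_on with
  | _ d ih =>
    intro p q r hd e hq hl
    by_cases hc : 3 * q.length ≤ 2 * W.length
    · exact ⟨p, q, r, e, hq, hl, hc⟩
    have hne : q ≠ [] := by rintro rfl; rw [List.length_nil] at hl; omega
    obtain ⟨k, hk⟩ := Red.length hq
    obtain ⟨j, hj⟩ := hev
    simp only [List.length_nil] at hk
    rcases split_word q hq hne with ⟨X, Y, hX, hY, e1, rX, rY⟩ | ⟨y, z, U, e1, rU⟩
    · have lX := List.length_pos_iff.2 hX
      have lY := List.length_pos_iff.2 hY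
      have l : q.length = X.length + Y.length := by rw [e1]; simp
      by_cases hx : W.length ≤ 3 * X.length
      · exact ih X.length (by omega) p X (Y ++ r) rfl (by rw [e, e1]; simp) rX hx
      · exact ih Y.length (by omega) (p ++ X) Y r rfl (by rw [e, e1]; simp) rY (by omega)
    · have l : q.length = U.length + 2 := by rw [e1]; simp
      exact ih U.length (by omega) (p ++ [y]) U ([z] ++ r) rfl
        (by rw [e, e1]; simp) rU (by omega)

/-- Group-theoretic content of Lemma 4.1: if `W = 1` in the free group `F(A)` and
`|W| > 2`, then there are positions `0 ≤ v_1 < v_2 ≤ |W|` such that, writing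
`W ≡ p_1 p_2 p_3` with `p_2 = W(v_1..v_2]`, one has `p_2 = 1` in `F(A)` and
`min(|p_2|, |p_1| + |p_3|) ≥ |W|/3`. -/
theorem statement6 (m : ℕ) (W : Word m) (h1 : evalW W = 1) (h2 : 2 < W.length) :
    ∃ v1 v2 : ℕ, v1 < v2 ∧ v2 ≤ W.length ∧
      evalW ((W.take v2).drop v1) = 1 ∧
      W.length ≤
        3 * min ((W.take v2).drop v1).length ((W.take v1).length + (W.drop v2).length) := by
  have hr := (evalW_iff W).1 h1
  obtain ⟨k, hk⟩ := FreeGroup.Red.length hr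
  simp only [List.length_nil] at hk
  obtain ⟨p, q, r, e, hq, hl, hu⟩ := find_sub W h2 ⟨k, by omega⟩ _ [] W [] rfl (by simp) hr
    (by omega)
  have l : W.length = p.length + q.length + r.length := by rw [e]; simp; try omega
  have hs : (W.take (p.length + q.length)).drop p.length = q := by
    rw [e, ← List.length_append, List.take_left, List.drop_left]
  refine ⟨p.length, p.length + q.length, by omega, by omega, ?_, ?_⟩
  · rw [hs]; exact (evalW_iff q).2 hq
  · rw [hs, List.length_take, List.length_drop]; omega

end Stmt6
end

section
/- Let G_2 be given by presentation (1.2) and let W be a word over A^{±1} such that W = 1 in G_2 and |W| > 2. Then there exist positions 0 ≤ v_1 < v_2 ≤ |W|, an index j ∈ {1, ..., m}, and an integer t such that, writing W ≡ p_1p_2p_3 with p_2 = W(v_1..v_2] the subword occupying positions v_1+1, ..., v_2, one has p_2 = a_j^t in G_2 and min(|p_2|, |p_1| + |p_3|) ≥ |W|/6. [group-theoretic content of Lemma 4.2] -/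
namespace Stmt7

/-- Words over the alphabet `A^{±1}` where `A = {a_1, ..., a_m}`. -/
abbrev Word (m : ℕ) := List (Fin m × Bool)

/-- The image of a word in the free group `F(A)`. -/
def evalW {m : ℕ} (w : Word m) : FreeGroup (Fin m) := FreeGroup.mk w

/-- The normal closure of the relator set `R_2 = {a_i^k : k ∈ E_i, k ≠ 0}` of the
presentation (1.2) in the free group `F(A)`. -/
def NC2 (m : ℕ) (E : Fin m → Set ℕ) : Subgroup (FreeGroup (Fin m)) :=
  Subgroup.normalClosure {g | ∃ (i : Fin m) (k : ℕ), k ∈ E i ∧ k ≠ 0 ∧ g = FreeGroup.of i ^ k}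

/-- `U` equals a power of a generator modulo the normal closure. -/
def Good {m : ℕ} (E : Fin m → Set ℕ) (U : Word m) : Prop :=
  ∃ p : Fin m × ℤ, evalW U * (FreeGroup.of p.1 ^ p.2)⁻¹ ∈ NC2 m E

instance nc2Normal (m : ℕ) (E : Fin m → Set ℕ) : (NC2 m E).Normal := by
  unfold NC2; infer_instance

lemma mem_iff_q {m : ℕ} (E : Fin m → Set ℕ) (x y : FreeGroup (Fin m)) :
    x * y⁻¹ ∈ NC2 m E ↔ (QuotientGroup.mk' (NC2 m E)) x = (QuotientGroup.mk' (NC2 m E)) y := by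
  rw [← div_eq_mul_inv]
  exact (QuotientGroup.eq_iff_div_mem).symm

lemma evalW_append {m : ℕ} (U V : Word m) : evalW (U ++ V) = evalW U * evalW V := by
  simp [evalW, FreeGroup.mul_mk]

lemma good_letter {m : ℕ} (E : Fin m → Set ℕ) (x : Fin m × Bool) : Good E [x] := by
  obtain ⟨i, b⟩ := x
  cases b
  · refine ⟨(i, -1), ?_⟩
    have : evalW [(i, false)] = (FreeGroup.of i)⁻¹ := by
      simp [evalW, FreeGroup.of, FreeGroup.inv_mk, FreeGroup.invRev]
    simp [this, one_mem]
  · refine ⟨(i, 1), ?_⟩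
    have : evalW [(i, true)] = FreeGroup.of i := rfl
    simp [this, one_mem]

lemma chain_or {α : Type*} (R : α → α → Prop) (l : List α) :
    List.IsChain R l ∨ ∃ P B C Q, l = P ++ B :: C :: Q ∧ ¬ R B C := by
  induction l with
  | nil => left; simp
  | cons a l ih =>
    rcases ih with h | ⟨P, B, C, Q, h, hR⟩
    · cases l with
      | nil => left; simp
      | cons b l =>
        by_cases hab : R a b
        · left; exact List.isChain_cons_cons.2 ⟨hab, h⟩
        · right; exact ⟨[], a, b, l, rfl, hab⟩
    · right; exact ⟨a :: P, B, C, Q, by simp [h], hR⟩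

lemma chain_all {α : Type*} (R : α → α → Prop) (p : α → Prop) (hp : ∀ a b, R a b → p a ∧ p b)
    (l : List α) (h : List.IsChain R l) (hl : 2 ≤ l.length) : ∀ a ∈ l, p a := by
  induction l with
  | nil => simp
  | cons a l ih =>
    match l, hl with
    | [b], _ =>
      have := hp a b (by simpa using h)
      simpa using this
    | b :: c :: l, _ =>
      rw [List.isChain_cons_cons] at h
      have h3 := ih h.2 (by simp)
      intro x hx
      rcases List.mem_cons.1 hx with rfl | hx
      · exact (hp _ _ h.1).1
      · exact h3 x hx

/-- The orders of the factors. -/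
lemma exists_orders (m : ℕ) (E : Fin m → Set ℕ)
    (hE : ∀ i, E i = {0} ∨ ∃ n : ℕ, 0 < n ∧
      (E i = {n} ∨ E i = {k | ∃ t : ℕ, 1 ≤ t ∧ k = t * n})) :
    ∃ n : Fin m → ℕ, ∀ i, (∀ k ∈ E i, n i ∣ k) ∧ FreeGroup.of i ^ (n i) ∈ NC2 m E := by
  have : ∀ i, ∃ n : ℕ, (∀ k ∈ E i, n ∣ k) ∧ FreeGroup.of i ^ n ∈ NC2 m E := by
    intro i
    rcases hE i with h | ⟨n, hn, h | h⟩
    · exact ⟨0, by simp [h], by simp [one_mem]⟩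
    · exact ⟨n, by simp [h], Subgroup.subset_normalClosure ⟨i, n, by simp [h], hn.ne', rfl⟩⟩
    · refine ⟨n, ?_, Subgroup.subset_normalClosure
        ⟨i, n, by rw [h]; exact ⟨1, le_rfl, by simp⟩, hn.ne', rfl⟩⟩
      intro k hk
      rw [h] at hk
      obtain ⟨t, _, rfl⟩ := hk
      exact Dvd.intro_left t rfl
  choose n hn using this
  exact ⟨n, hn⟩

/-- The map to the free product of cyclic groups. -/
noncomputable def phi {m : ℕ} (n : Fin m → ℕ) :
    FreeGroup (Fin m) →* Monoid.CoprodI (fun i => Multiplicative (ZMod (n i))) :=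
  FreeGroup.lift (fun i => Monoid.CoprodI.of (i := i) (Multiplicative.ofAdd (1 : ZMod (n i))))

lemma phi_zpow {m : ℕ} (n : Fin m → ℕ) (i : Fin m) (t : ℤ) :
    phi n (FreeGroup.of i ^ t) =
      Monoid.CoprodI.of (i := i) (Multiplicative.ofAdd (t : ZMod (n i))) := by
  rw [map_zpow, phi, FreeGroup.lift_apply_of, ← map_zpow, ← ofAdd_zsmul]
  simp

lemma phi_ker {m : ℕ} (E : Fin m → Set ℕ) (n : Fin m → ℕ) (hn : ∀ i, ∀ k ∈ E i, n i ∣ k)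
    (x : FreeGroup (Fin m)) (hx : x ∈ NC2 m E) : phi n x = 1 := by
  have : NC2 m E ≤ (phi n).ker := by
    apply Subgroup.normalClosure_le_normal
    rintro _ ⟨i, k, hk, -, rfl⟩
    have h := phi_zpow n i (k : ℤ)
    rw [zpow_natCast] at h
    have h0 : ((k : ℤ) : ZMod (n i)) = 0 := by
      rw [Int.cast_natCast, ZMod.natCast_eq_zero_iff]
      exact hn i k hk
    rw [h0, ofAdd_zero, map_one] at h
    exact h
  exact this hx

lemma zpow_mem_of_zero {m : ℕ} (E : Fin m → Set ℕ) (n : ℕ) (i : Fin m)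
    (hn : FreeGroup.of i ^ n ∈ NC2 m E) (t : ℤ) (ht : (t : ZMod n) = 0) :
    FreeGroup.of i ^ t ∈ NC2 m E := by
  obtain ⟨s, rfl⟩ := (CharP.intCast_eq_zero_iff (ZMod n) n t).1 ht
  rw [zpow_mul, zpow_natCast]
  exact Subgroup.zpow_mem _ hn s

lemma split_blocks (m : ℕ) (E : Fin m → Set ℕ)
    (hE : ∀ i, E i = {0} ∨ ∃ n : ℕ, 0 < n ∧
      (E i = {n} ∨ E i = {k | ∃ t : ℕ, 1 ≤ t ∧ k = t * n})) (r : ℕ) :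
    ∀ Bs : List (Word m), Bs.length = r + 2 → (∀ B ∈ Bs, B ≠ [] ∧ Good E B) →
      Good E Bs.flatten →
      ∃ U V : Word m, U ≠ [] ∧ V ≠ [] ∧ Good E U ∧ Good E V ∧ Bs.flatten = U ++ V := by
  induction r with
  | zero =>
    intro Bs hl hB _
    match Bs, hl with
    | [U, V], _ =>
      refine ⟨U, V, (hB U (by simp)).1, (hB V (by simp)).1, (hB U (by simp)).2,
        (hB V (by simp)).2, by simp⟩
  | succ r ih =>
    intro Bs hl hB hG
    rcases chain_or (fun B C => ¬ Good E (B ++ C)) Bs with h | ⟨P, B, C, Q, rfl, h⟩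
    · exfalso
      obtain ⟨n, hn⟩ := exists_orders m E hE
      obtain ⟨⟨j, s⟩, hj⟩ := hG
      have : Nonempty (Fin m × ℤ) := ⟨(j, s)⟩
      have hch : ∀ B : Word m, ∃ p : Fin m × ℤ, Good E B →
          evalW B * (FreeGroup.of p.1 ^ p.2)⁻¹ ∈ NC2 m E := by
        intro B
        by_cases hb : Good E B
        · obtain ⟨p, hp⟩ := hb
          exact ⟨p, fun _ => hp⟩
        · exact ⟨(j, s), fun h => absurd h hb⟩
      choose f hf using hch
      let g : Word m → Σ i, Multiplicative (ZMod (n i)) :=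
        fun B => ⟨(f B).1, Multiplicative.ofAdd (((f B).2 : ℤ) : ZMod (n (f B).1))⟩
      have hphi : ∀ B, Good E B → phi n (evalW B) =
          Monoid.CoprodI.of (M := fun i => Multiplicative (ZMod (n i))) (g B).2 := by
        intro B hb
        have h1 := phi_ker E n (fun i => (hn i).1) _ (hf B hb)
        rw [map_mul, map_inv, mul_inv_eq_one] at h1
        rw [h1, phi_zpow]
      have htriv : ∀ B, Good E B → (g B).2 = 1 → evalW B ∈ NC2 m E := by
        intro B hb h1
        have h2 := zpow_mem_of_zero E _ _ (hn (f B).1).2 (f B).2 (by simpa [g] using h1)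
        have := mul_mem (hf B hb) h2
        simpa using this
      let R : Word m → Word m → Prop := fun B C =>
        ((g B).1 ≠ (g C).1) ∧ (g B).2 ≠ 1 ∧ (g C).2 ≠ 1
      have hR : ∀ B C, Good E B → Good E C → ¬ Good E (B ++ C) → R B C := by
        intro B C hb hc hbc
        refine ⟨fun he => hbc ?_, fun he => hbc ?_, fun he => hbc ?_⟩
        · have he' : (f B).1 = (f C).1 := he
          refine ⟨((f B).1, (f B).2 + (f C).2), ?_⟩
          have h1 := hf B hb
          have h2 := hf C hc
          rw [mem_iff_q] at h1 h2 ⊢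
          rw [evalW_append, map_mul, h1, h2, zpow_add, map_mul, he']
        · have h3 := htriv B hb he
          refine ⟨f C, ?_⟩
          rw [evalW_append, mul_assoc]
          exact mul_mem h3 (hf C hc)
        · have h3 := htriv C hc he
          refine ⟨f B, ?_⟩
          have h1 := hf B hb
          rw [mem_iff_q] at h1 ⊢
          rw [evalW_append, map_mul, h1, (QuotientGroup.eq_one_iff (evalW C)).2 h3 |> fun h =>
            (show (QuotientGroup.mk' (NC2 m E)) (evalW C) = 1 from h), mul_one]
      have hchain : List.IsChain R Bs := by
        have key : ∀ l : List (Word m), (∀ B ∈ l, Good E B) →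
            List.IsChain (fun B C => ¬ Good E (B ++ C)) l → List.IsChain R l := by
          intro l
          induction l with
          | nil => simp
          | cons a l ih2 =>
            intro hg hc
            cases l with
            | nil => simp
            | cons b l =>
              rw [List.isChain_cons_cons] at hc ⊢
              exact ⟨hR a b (hg a (by simp)) (hg b (by simp)) hc.1,
                ih2 (fun B hB => hg B (List.mem_cons_of_mem _ hB)) hc.2⟩
        exact key Bs (fun B hb => (hB B hb).2) h
      have hne := chain_all R (fun B => (g B).2 ≠ 1) (fun a b h => h.2) Bs hchain (by omega)
      let w : Monoid.CoprodI.Word (fun i => Multiplicative (ZMod (n i))) :=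
        { toList := Bs.map g
          ne_one := by
            intro l hl
            obtain ⟨B, hb, rfl⟩ := List.mem_map.1 hl
            exact hne B hb
          chain_ne := by
            rw [List.isChain_map]
            exact hchain.imp (fun a b h => h.1) }
      have hprod : phi n (evalW Bs.flatten) = w.prod := by
        have key : ∀ l : List (Word m), (∀ B ∈ l, Good E B) →
            phi n (evalW l.flatten) =
              ((l.map g).map (fun x =>
                Monoid.CoprodI.of (M := fun i => Multiplicative (ZMod (n i))) x.2)).prod := by
          intro l
          induction l with
          | nil => intro _; exact map_one (phi n)
          | cons a l ih2 =>
            intro hg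
            rw [List.flatten_cons, evalW_append, map_mul, hphi a (hg a (by simp)),
              ih2 (fun B hB => hg B (List.mem_cons_of_mem _ hB))]
            simp
        exact key Bs (fun B hb => (hB B hb).2)
      have h1 := phi_ker E n (fun i => (hn i).1) _ hj
      rw [map_mul, map_inv, mul_inv_eq_one, phi_zpow, hprod] at h1
      have hlen : w.toList.length = r + 1 + 2 := by simp [w, hl]
      have hinj : Function.Injective
          (Monoid.CoprodI.Word.prod : Monoid.CoprodI.Word
            (fun i => Multiplicative (ZMod (n i))) → _) :=
        Monoid.CoprodI.Word.equiv.symm.injective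
      by_cases hs : (Multiplicative.ofAdd ((s : ℤ) : ZMod (n j))) = 1
      · have : w = Monoid.CoprodI.Word.empty := by
          apply hinj
          rw [h1]
          simp only at hs ⊢
          rw [hs]; simp
        rw [this] at hlen
        simp [Monoid.CoprodI.Word.empty] at hlen
      · let w1 : Monoid.CoprodI.Word (fun i => Multiplicative (ZMod (n i))) :=
          { toList := [⟨j, Multiplicative.ofAdd ((s : ℤ) : ZMod (n j))⟩]
            ne_one := by
              intro l hl
              rw [List.mem_singleton] at hl
              subst hl
              exact hs
            chain_ne := by simp }
        have : w = w1 := by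
          apply hinj
          rw [h1]
          simp [w1, Monoid.CoprodI.Word.prod]
        rw [this] at hlen
        simp [w1] at hlen
    · rw [not_not] at h
      have he : (P ++ B :: C :: Q).flatten = (P ++ (B ++ C) :: Q).flatten := by simp
      rw [he] at hG ⊢
      apply ih _ _ _ hG
      · simp at hl ⊢; omega
      · intro D hD
        simp only [List.mem_append, List.mem_cons] at hD
        rcases hD with hD | rfl | hD
        · exact hB D (by simp [hD])
        · exact ⟨by simp [(hB B (by simp)).1], h⟩
        · exact hB D (by simp [hD])

lemma split_good (m : ℕ) (E : Fin m → Set ℕ)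
    (hE : ∀ i, E i = {0} ∨ ∃ n : ℕ, 0 < n ∧
      (E i = {n} ∨ E i = {k | ∃ t : ℕ, 1 ≤ t ∧ k = t * n})) (W : Word m)
    (hl : 2 ≤ W.length) (hG : Good E W) :
    ∃ U V : Word m, U ≠ [] ∧ V ≠ [] ∧ Good E U ∧ Good E V ∧ W = U ++ V := by
  have hfl : (W.map (fun x => [x])).flatten = W := by
    clear hl hG
    induction W with
    | nil => rfl
    | cons a l ih => simp only [List.map_cons, List.flatten_cons, ih]; rfl
  have := split_blocks m E hE (W.length - 2) (W.map (fun x => [x])) (by simp; omega)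
    (by
      intro B hB
      obtain ⟨x, -, rfl⟩ := List.mem_map.1 hB
      exact ⟨by simp, good_letter E x⟩) (by rw [hfl]; exact hG)
  rwa [hfl] at this

lemma descend (m : ℕ) (E : Fin m → Set ℕ)
    (hE : ∀ i, E i = {0} ∨ ∃ n : ℕ, 0 < n ∧
      (E i = {n} ∨ E i = {k | ∃ t : ℕ, 1 ≤ t ∧ k = t * n})) (W : Word m)
    (h2 : 2 < W.length) (n : ℕ) :
    ∀ P U Q : Word m, W = P ++ U ++ Q → U.length = n → Good E U → 5 * W.length < 6 * n →
      ∃ P U Q : Word m, W = P ++ U ++ Q ∧ Good E U ∧ W.length ≤ 6 * U.length ∧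
        6 * U.length ≤ 5 * W.length := by
  induction n using Nat.strong_induction_on with
  | _ n ih =>
    intro P U Q hW hn hG h5
    obtain ⟨X, Y, hX, hY, gX, gY, rfl⟩ := split_good m E hE U (by omega) hG
    have lX := List.length_pos_iff.2 hX
    have lY := List.length_pos_iff.2 hY
    rw [List.length_append] at hn
    have eX : W = P ++ X ++ (Y ++ Q) := by simp [hW]
    have eY : W = (P ++ X) ++ Y ++ Q := by simp [hW]
    by_cases c1 : 5 * W.length < 6 * X.length
    · exact ih X.length (by omega) P X _ eX rfl gX c1
    by_cases c2 : 5 * W.length < 6 * Y.length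
    · exact ih Y.length (by omega) _ Y Q eY rfl gY c2
    by_cases c3 : W.length ≤ 6 * X.length
    · exact ⟨P, X, _, eX, gX, c3, by omega⟩
    · exact ⟨_, Y, Q, eY, gY, by omega, by omega⟩

/-- Group-theoretic content of Lemma 4.2: if `W = 1` in `G_2` and `|W| > 2`, then there
are positions `0 ≤ v_1 < v_2 ≤ |W|`, an index `j` and an integer `t` such that, writing
`W ≡ p_1 p_2 p_3` with `p_2 = W(v_1..v_2]`, one has `p_2 = a_j^t` in `G_2` and
`min(|p_2|, |p_1| + |p_3|) ≥ |W|/6`. -/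
theorem statement7 (m : ℕ) (E : Fin m → Set ℕ)
    (hE : ∀ i, E i = {0} ∨ ∃ n : ℕ, 0 < n ∧
      (E i = {n} ∨ E i = {k | ∃ t : ℕ, 1 ≤ t ∧ k = t * n}))
    (W : Word m) (h1 : evalW W ∈ NC2 m E) (h2 : 2 < W.length) :
    ∃ v1 v2 : ℕ, v1 < v2 ∧ v2 ≤ W.length ∧
      (∃ (j : Fin m) (t : ℤ),
        evalW ((W.take v2).drop v1) * (FreeGroup.of j ^ t)⁻¹ ∈ NC2 m E) ∧
      W.length ≤
        6 * min ((W.take v2).drop v1).length ((W.take v1).length + (W.drop v2).length) := by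
  have hpos : 0 < m := by
    match W, h2 with
    | x :: _, _ => exact x.1.pos
  have hG : Good E W := ⟨(⟨0, hpos⟩, 0), by simpa using h1⟩
  obtain ⟨P, U, Q, hW, ⟨⟨j, t⟩, hU⟩, ha, hb⟩ :=
    descend m E hE W h2 W.length [] W [] (by simp) rfl hG (by omega)
  have hlen : W.length = P.length + U.length + Q.length := by
    rw [hW]; simp; omega
  have hUe : (W.take (P.length + U.length)).drop P.length = U := by
    have : P.length + U.length = (P ++ U).length := by simp
    rw [this, hW, List.take_left, List.drop_left]
  refine ⟨P.length, P.length + U.length, by omega, by omega, ⟨j, t, ?_⟩, ?_⟩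
  · rw [hUe]; exact hU
  · rw [hUe, List.length_take, List.length_drop]
    omega

end Stmt7
end
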